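/- Let κ be an infinite cardinal such that κ⁺ = 2^κ. Then there exists a group X of cardinality |X| = κ⁺ such that X is 36-Shelah, X is absolutely T₁S-closed, and X is not polybounded. -/

import Mathlib

namespace ShelahFormalization

universe u v

/-- A group (monoid) `G` is `n`-Shelah if `Aⁿ = G` for every subset `A ⊆ G` with `|A| = |G|`. -/
def IsNShelah (G : Type u) [Monoid G] (n : ℕ) : Prop :=
  ∀ A : Set G, Cardinal.mk A = Cardinal.mk G →
    ∀ x : G, ∃ f : Fin n → G, (∀ i, f i ∈ A) ∧ (List.ofFn f).prod = x

/-- An algebraic subset of a semigroup `X`: the preimage of a point under a semigroup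
polynomial `p(x) = c₀ x c₁ x ⋯ x cₙ` (`n ≥ 1`, coefficients in `X¹ = X ∪ {1}`). -/
def IsAlgebraicSet {X : Type u} [Semigroup X] (A : Set X) : Prop :=
  ∃ (m : ℕ) (c : Fin (m + 2) → WithOne X) (b : X),
    A = {x : X |
      c 0 * (List.ofFn fun i : Fin (m + 1) => (x : WithOne X) * c i.succ).prod
        = (b : WithOne X)}

/-- A semigroup `X` is polybounded if it is the union of finitely many algebraic subsets. -/
def Polybounded (X : Type u) [Semigroup X] : Prop :=
  ∃ (k : ℕ) (A : Fin k → Set X), (∀ i, IsAlgebraicSet (A i)) ∧ ⋃ i, A i = Set.univ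

/-- A semigroup `X` is absolutely `T₁S`-closed if for every homomorphism `h : X → Y`
to a `T₁` topological semigroup `Y` the image `h[X]` is closed in `Y`. -/
def AbsolutelyT1SClosed (X : Type u) [Semigroup X] : Prop :=
  ∀ (Y : Type v) [Semigroup Y] [TopologicalSpace Y] [ContinuousMul Y] [T1Space Y]
    (h : X →ₙ* Y), IsClosed (Set.range h)

end ShelahFormalization

namespace ShelahFormalization

/-- a 0-hyperbolic even integer metric -/
structure TreeD (V : Type*) where
  d : V → V → ℤ
  self : ∀ x, d x x = 0
  symm : ∀ x y, d x y = d y x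
  even : ∀ x y, ∃ k, d x y = 2 * k
  fp : ∀ x y z w, d x y + d z w ≤ max (d x z + d y w) (d x w + d y z)

namespace TreeD
variable {V : Type*} (M : TreeD V)

theorem tri (x y z : V) : M.d x z ≤ M.d x y + M.d y z := by
  have h := M.fp x z y y
  have := M.self y
  have := M.symm z y
  grind

theorem nonneg (x y : V) : 0 ≤ M.d x y := by
  have := M.tri x y x
  have := M.self x
  have := M.symm x y
  omega

/-- geodesic line with steps of length 2 -/
def IsLine (a : ℤ → V) : Prop := ∀ i j, M.d (a i) (a j) = 2 * |i - j|

/-- projection coordinate -/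
def pr (a : ℤ → V) (v : V) : ℤ :=
  (M.d v (a (-(M.d v (a 0)))) - M.d v (a (M.d v (a 0)))) / 2
/-- distance to the line -/
def off (a : ℤ → V) (v : V) : ℤ :=
  (M.d v (a (-(M.d v (a 0)))) + M.d v (a (M.d v (a 0))) - 4 * M.d v (a 0)) / 2

variable {M}
theorem IsLine.formula_aux {a : ℤ → V} (ha : M.IsLine a) (v : V) (N i : ℤ) (h1 : -N ≤ i) (h2 : i ≤ N) :
    M.d v (a i) = max (M.d v (a (-N)) - 2 * N - 2 * i) (M.d v (a N) - 2 * N + 2 * i) := by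
  have e1 := M.fp v (a i) (a (-N)) (a N)
  have e2 := M.tri v (a i) (a (-N))
  have e3 := M.tri v (a i) (a N)
  rw [ha] at e1 e2 e3
  rw [ha] at e1
  rw [ha] at e1
  grind

theorem IsLine.formula {a : ℤ → V} (ha : M.IsLine a) (v : V) (i : ℤ) :
    M.d v (a i) = M.off a v + |2 * i - M.pr a v| := by
  have h0 := M.nonneg v (a 0)
  obtain ⟨k1, hk1⟩ := M.even v (a (-(M.d v (a 0))))
  obtain ⟨k2, hk2⟩ := M.even v (a (M.d v (a 0)))
  unfold off pr
  set c := M.d v (a 0) with hc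
  have key : ∀ i, M.d v (a i) = max (M.d v (a (-c)) - 2 * c - 2 * i) (M.d v (a c) - 2 * c + 2 * i) := by
    intro i
    obtain ⟨N, hN1, hN2, hN3⟩ : ∃ N : ℤ, -N ≤ i ∧ i ≤ N ∧ c ≤ N := ⟨max c (max i (-i)), by omega, by omega, by omega⟩
    have e0 := ha.formula_aux v N 0 (by omega) (by omega)
    have e1 := ha.formula_aux v N i (by omega) (by omega)
    have e2 := ha.formula_aux v N c (by omega) (by omega)
    have e3 := ha.formula_aux v N (-c) (by omega) (by omega)
    have e4 := M.tri (a 0) v (a N)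
    have e5 := M.tri (a 0) v (a (-N))
    rw [ha, M.symm _ v] at e4 e5
    have a1 : |0 - N| = N := by grind
    have a2 : |0 - -N| = N := by grind
    rw [a1] at e4
    rw [a2] at e5
    omega
  have := key i
  rcases abs_cases (2 * i - (M.d v (a (-c)) - M.d v (a c)) / 2) with h | h <;> omega

theorem IsLine.off_nonneg {a : ℤ → V} (ha : M.IsLine a) (v : V) : 0 ≤ M.off a v := by
  have h3 := M.tri (a (|M.pr a v|)) v (a (- |M.pr a v|))
  rw [ha, M.symm _ v, ha.formula, ha.formula] at h3
  grind

theorem IsLine.unique {a : ℤ → V} (ha : M.IsLine a) (v : V) (p o : ℤ)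
    (h : ∀ i, M.d v (a i) = o + |2 * i - p|) : M.pr a v = p ∧ M.off a v = o := by
  have h1 := h (|p| + |M.pr a v|)
  have h2 := h (-(|p| + |M.pr a v|))
  rw [ha.formula] at h1 h2
  grind

theorem IsLine.pr_self {a : ℤ → V} (ha : M.IsLine a) (k : ℤ) : M.pr a (a k) = 2 * k := by
  refine (ha.unique (a k) (2*k) 0 fun i => ?_).1
  rw [ha]; grind

theorem IsLine.off_self {a : ℤ → V} (ha : M.IsLine a) (k : ℤ) : M.off a (a k) = 0 := by
  refine (ha.unique (a k) (2*k) 0 fun i => ?_).2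
  rw [ha]; grind

theorem IsLine.dist_le {a : ℤ → V} (ha : M.IsLine a) (u v : V) :
    M.d u v ≤ M.off a u + |M.pr a u - M.pr a v| + M.off a v := by
  set N := |M.pr a u| + |M.pr a v| with hN
  have h := M.fp u v (a N) (a (-N))
  rw [ha, ha.formula, ha.formula, ha.formula, ha.formula] at h
  grind

theorem IsLine.dist_eq {a : ℤ → V} (ha : M.IsLine a) (u v : V) (hne : M.pr a u ≠ M.pr a v) :
    M.d u v = M.off a u + |M.pr a u - M.pr a v| + M.off a v := by
  apply le_antisymm (ha.dist_le u v)
  set N := |M.pr a u| + |M.pr a v| with hN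
  have h1 := M.fp u (a N) v (a (-N))
  have h2 := M.fp u (a (-N)) v (a N)
  rw [M.symm (a _) v, ha, ha.formula, ha.formula, ha.formula, ha.formula] at h1 h2
  rcases lt_or_gt_of_ne hne with h | h <;> grind

theorem IsLine.pr_lip {a : ℤ → V} (ha : M.IsLine a) (u v : V) :
    |M.pr a u - M.pr a v| ≤ M.d u v := by
  by_cases hne : M.pr a u = M.pr a v
  · rw [hne, sub_self, abs_zero]; exact M.nonneg _ _
  · have := ha.dist_eq u v hne
    have := ha.off_nonneg u
    have := ha.off_nonneg v
    omega

/-- (T3) part: betweenness is preserved by projections -/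
theorem IsLine.pr_between {a : ℤ → V} (ha : M.IsLine a) (w w' q : V)
    (h : M.d w q + M.d q w' = M.d w w') :
    (M.pr a w ≤ M.pr a q ∧ M.pr a q ≤ M.pr a w') ∨ (M.pr a w' ≤ M.pr a q ∧ M.pr a q ≤ M.pr a w) := by
  have h1 := ha.dist_le w w'
  have o1 := ha.off_nonneg w
  have o2 := ha.off_nonneg w'
  have o3 := ha.off_nonneg q
  by_cases e1 : M.pr a w = M.pr a q
  · grind
  by_cases e2 : M.pr a q = M.pr a w'
  · grind
  have h2 := ha.dist_eq w q e1
  have h3 := ha.dist_eq q w' e2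
  grind

theorem IsLine.exists_mid {a : ℤ → V} (ha : M.IsLine a) (w w' : V) (h : M.pr a w ≠ M.pr a w') :
    ∃ k, M.d w (a k) + M.d (a k) w' = M.d w w' ∧
      ((M.pr a w ≤ 2 * k ∧ 2 * k ≤ M.pr a w') ∨ (M.pr a w' ≤ 2 * k ∧ 2 * k ≤ M.pr a w)) := by
  have h1 := ha.dist_eq w w' h
  refine ⟨(max (M.pr a w) (M.pr a w')) / 2, ?_, ?_⟩
  · rw [M.symm _ w', ha.formula, ha.formula, h1]
    rcases lt_or_gt_of_ne h with h | h <;> grind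
  · rcases lt_or_gt_of_ne h with h | h <;> omega

/-- Behrstock -/
theorem IsLine.behrstock {a b : ℤ → V} (ha : M.IsLine a) (hb : M.IsLine b) (v : V) :
    (∃ n n', M.pr a (b n) ≤ M.pr a v ∧ M.pr a v ≤ M.pr a (b n')) ∨
    (∃ k, M.pr b v = M.pr b (a k)) := by
  by_cases h1 : ∃ n, M.pr a (b n) ≤ M.pr a v
  · by_cases h2 : ∃ n, M.pr a v ≤ M.pr a (b n)
    · obtain ⟨n, hn⟩ := h1
      obtain ⟨n', hn'⟩ := h2
      exact Or.inl ⟨n, n', hn, hn'⟩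
    · push Not at h2
      refine Or.inr ⟨|M.pr a v|, ?_⟩
      refine (hb.unique v _ (M.off b (a |M.pr a v|) + M.pr a v + M.off a v - 2 * |M.pr a v|) fun i => ?_).1
      have e1 := ha.dist_eq v (b i) (by have := h2 i; omega)
      have e2 := ha.dist_eq (a |M.pr a v|) (b i) (by
        rw [ha.pr_self]; have := h2 i; grind)
      rw [hb.formula, ha.pr_self, ha.off_self] at e2
      have := h2 i
      grind
  · push Not at h1
    refine Or.inr ⟨-|M.pr a v|, ?_⟩
    refine (hb.unique v _ (M.off b (a (-|M.pr a v|)) - M.pr a v + M.off a v - 2 * |M.pr a v|) fun i => ?_).1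
    have e1 := ha.dist_eq v (b i) (by have := h1 i; omega)
    have e2 := ha.dist_eq (a (-|M.pr a v|)) (b i) (by
      rw [ha.pr_self]; have := h1 i; grind)
    rw [hb.formula, ha.pr_self, ha.off_self] at e2
    have := h1 i
    grind

end TreeD
end ShelahFormalization

namespace ShelahFormalization

/-- Data for the windmill argument: a group with a left-invariant tree metric and a family of
periodic lines, closed under translation. -/
structure Mill (T : Type*) [Group T] (J : Type*) where
  M : TreeD T
  inv : ∀ g x y, M.d (g * x) (g * y) = M.d x y
  conn : ∀ W : Set T, W.Nonempty → (∀ w ∈ W, ∀ v, M.d v w ≤ 2 → v ∈ W) → W = Set.univ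
  h : J → ℤ → T
  R : J → T
  line0 : ∀ j, M.IsLine (h j)
  per : ∀ j n, R j * h j n = h j (n + 36)

namespace Mill
variable {T : Type*} [Group T] {J : Type*} (m : Mill T J)

def ax (l : T × J) (n : ℤ) : T := l.1 * m.h l.2 n
def rr (l : T × J) : T := l.1 * m.R l.2 * l.1⁻¹
def p (l : T × J) (v : T) : ℤ := m.M.pr (m.ax l) v
def sm (g : T) (l : T × J) : T × J := (g * l.1, l.2)

theorem line (l : T × J) : m.M.IsLine (m.ax l) := fun i j => by
  unfold ax; rw [m.inv]; exact m.line0 _ _ _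

theorem ax_sm (g : T) (l : T × J) (n : ℤ) : m.ax (sm g l) n = g * m.ax l n := by
  simp [ax, sm, mul_assoc]

theorem rr_sm (g : T) (l : T × J) : m.rr (sm g l) = g * m.rr l * g⁻¹ := by
  simp [rr, sm, mul_assoc]

theorem p_sm (g : T) (l : T × J) (v : T) : m.p (sm g l) (g * v) = m.p l v := by
  unfold p TreeD.pr
  simp only [ax_sm, m.inv]

theorem off_sm (g : T) (l : T × J) (v : T) : m.M.off (m.ax (sm g l)) (g * v) = m.M.off (m.ax l) v := by
  unfold TreeD.off
  simp only [ax_sm, m.inv]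

theorem rr_ax (l : T × J) (n : ℤ) : m.rr l * m.ax l n = m.ax l (n + 36) := by
  simp [rr, ax, mul_assoc, m.per]

theorem rr_shift (l : T × J) (v : T) :
    m.p l (m.rr l * v) = m.p l v + 72 ∧ m.M.off (m.ax l) (m.rr l * v) = m.M.off (m.ax l) v := by
  refine (m.line l).unique _ _ _ fun i => ?_
  have := m.rr_ax l (i - 36)
  rw [show i - 36 + 36 = i by ring] at this
  rw [← this, m.inv, (m.line l).formula]
  unfold p
  grind

theorem rr_shift_nat (l : T × J) (e : ℕ) (v : T) :
    m.p l (m.rr l ^ e * v) = m.p l v + 72 * e ∧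
      m.M.off (m.ax l) (m.rr l ^ e * v) = m.M.off (m.ax l) v := by
  induction e with
  | zero => simp
  | succ e ih =>
    rw [pow_succ', mul_assoc, (m.rr_shift l _).1, (m.rr_shift l _).2, ih.1, ih.2]
    push_cast
    exact ⟨by ring, rfl⟩

theorem rr_shift_zpow (l : T × J) (e : ℤ) (v : T) :
    m.p l (m.rr l ^ e * v) = m.p l v + 72 * e ∧
      m.M.off (m.ax l) (m.rr l ^ e * v) = m.M.off (m.ax l) v := by
  obtain ⟨n, rfl | rfl⟩ := e.eq_nat_or_neg
  · simpa using m.rr_shift_nat l n v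
  · have := m.rr_shift_nat l n (m.rr l ^ (-(n:ℤ)) * v)
    rw [← mul_assoc, ← zpow_natCast, ← zpow_add, add_neg_cancel, zpow_zero, one_mul] at this
    constructor
    · have := this.1; omega
    · exact this.2.symm

/-- overlap condition -/
def OV : Prop := ∀ l l', m.rr l ≠ m.rr l' → ∀ n n', |m.p l (m.ax l' n) - m.p l (m.ax l' n')| ≤ 8

structure St (K0 : Set T) (W : Set T) (N : Subgroup T) : Prop where
  sub : K0 ⊆ W
  stab : ∀ g ∈ N, ∀ w ∈ W, g * w ∈ W
  le : N ≤ Subgroup.normalClosure (Set.range m.R)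
  diam : ∀ l, m.rr l ∈ N ∨ ∀ w ∈ W, ∀ w' ∈ W, |m.p l w - m.p l w'| ≤ 16
  gr : ∀ g ∈ N, g ≠ 1 → ∃ l, ∀ x ∈ K0, ∀ x' ∈ K0, 48 ≤ |m.p l x - m.p l (g * x')|

def Lset (W : Set T) (N : Subgroup T) : Set (T × J) :=
  {l | m.rr l ∉ N ∧ ∃ w ∈ W, ∃ w' ∈ W, m.p l w ≠ m.p l w'}

def NB (W : Set T) (l : T × J) (v : T) : Prop :=
  (∃ w ∈ W, m.p l v ≤ m.p l w + 8) ∧ (∃ w ∈ W, m.p l w - 8 ≤ m.p l v)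

inductive Red (W : Set T) (N : Subgroup T) : T → Prop
  | base (g : T) (h : g ∈ N) : Red W N g
  | step (l : T × J) (hl : l ∈ m.Lset W N) (e : ℤ) (he : e ≠ 0) (g : T) (hg : Red W N g)
      (hnb : ∀ w ∈ W, m.NB W l (g * w)) : Red W N (m.rr l ^ e * g)

variable {m} {K0 W : Set T} {N : Subgroup T}

theorem touched_mid {l : T × J} (h : ∃ w ∈ W, ∃ w' ∈ W, m.p l w ≠ m.p l w') :
    ∃ k, ∀ l', ∃ w ∈ W, ∃ w' ∈ W, m.p l' w ≤ m.p l' (m.ax l k) ∧ m.p l' (m.ax l k) ≤ m.p l' w' := by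
  obtain ⟨w, hw, w', hw', hne⟩ := h
  obtain ⟨k, hk, -⟩ := (m.line l).exists_mid w w' hne
  refine ⟨k, fun l' => ?_⟩
  rcases (m.line l').pr_between w w' _ hk with h | h
  · exact ⟨w, hw, w', hw', h⟩
  · exact ⟨w', hw', w, hw, h⟩

theorem hullNB (ov : m.OV) {l l' : T × J} (h : ∃ w ∈ W, ∃ w' ∈ W, m.p l' w ≠ m.p l' w')
    (hne : m.rr l ≠ m.rr l') (n : ℤ) : m.NB W l (m.ax l' n) := by
  obtain ⟨k, hk⟩ := touched_mid h
  obtain ⟨w, hw, w', hw', h1, h2⟩ := hk l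
  have := abs_le.1 (ov l l' hne n k)
  exact ⟨⟨w', hw', by omega⟩, ⟨w, hw, by omega⟩⟩

theorem St.Ldiam (s : m.St K0 W N) {l : T × J} (hl : l ∈ m.Lset W N) :
    ∀ w ∈ W, ∀ w' ∈ W, |m.p l w - m.p l w'| ≤ 16 :=
  (s.diam l).resolve_left hl.1

theorem St.NB_near (s : m.St K0 W N) {l : T × J} (hl : l ∈ m.Lset W N) {v : T} (hv : m.NB W l v)
    {w : T} (hw : w ∈ W) : |m.p l v - m.p l w| ≤ 24 := by
  obtain ⟨⟨a, ha, h1⟩, ⟨b, hb, h2⟩⟩ := hv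
  have e1 := abs_le.1 (s.Ldiam hl a ha w hw)
  have e2 := abs_le.1 (s.Ldiam hl b hb w hw)
  rw [abs_le]; omega

theorem St.far (s : m.St K0 W N) {l : T × J} (hl : l ∈ m.Lset W N) {v : T} (hv : m.NB W l v)
    {e : ℤ} (he : e ≠ 0) {w : T} (hw : w ∈ W) : 48 ≤ |m.p l w - m.p l (m.rr l ^ e * v)| := by
  have := abs_le.1 (s.NB_near hl hv hw)
  rw [(m.rr_shift_zpow l e v).1]
  rw [le_abs]; omega

theorem St.pp1 (s : m.St K0 W N) {l : T × J} (hl : l ∈ m.Lset W N) {v : T} (hv : m.NB W l v)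
    {e : ℤ} (he : e ≠ 0) : ¬ m.NB W l (m.rr l ^ e * v) := by
  intro h
  obtain ⟨w, hw, -⟩ := h.1
  have h1 := s.far hl hv he hw
  have h2 := s.NB_near hl h hw
  rw [abs_sub_comm] at h2
  omega

theorem pp2 (ov : m.OV) {l l' : T × J} (hl : l ∈ m.Lset W N) (hl' : l' ∈ m.Lset W N)
    (hne : m.rr l ≠ m.rr l') {v : T} (hv : ¬ m.NB W l v) : m.NB W l' v := by
  rcases (m.line l).behrstock (m.line l') v with ⟨n, n', h1, h2⟩ | ⟨k, hk⟩
  · exfalso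
    apply hv
    obtain ⟨-, w, hw, h3⟩ := hullNB ov hl'.2 hne n
    obtain ⟨⟨w', hw', h4⟩, -⟩ := hullNB ov hl'.2 hne n'
    exact ⟨⟨w', hw', h2.trans h4⟩, ⟨w, hw, h3.trans h1⟩⟩
  · have := hullNB ov hl.2 hne.symm k
    unfold NB at this ⊢
    have hk' : m.p l' v = m.p l' (m.ax l k) := hk
    rwa [hk']

theorem St.nb_N (s : m.St K0 W N) {g : T} (hg : g ∈ N) (l : T × J) : ∀ w ∈ W, m.NB W l (g * w) :=
  fun w hw => ⟨⟨g * w, s.stab g hg w hw, by omega⟩, ⟨g * w, s.stab g hg w hw, by omega⟩⟩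

theorem St.L_sm (s : m.St K0 W N) {n : T} (hn : n ∈ N) {l : T × J} (hl : l ∈ m.Lset W N) :
    sm n l ∈ m.Lset W N := by
  refine ⟨fun h => hl.1 ?_, ?_⟩
  · rw [rr_sm] at h
    have := N.mul_mem (N.mul_mem (N.inv_mem hn) h) hn
    simpa [mul_assoc] using this
  · obtain ⟨w, hw, w', hw', h⟩ := hl.2
    exact ⟨n * w, s.stab n hn w hw, n * w', s.stab n hn w' hw', by rwa [p_sm, p_sm]⟩

theorem St.NB_sm (s : m.St K0 W N) {n : T} (hn : n ∈ N) {l : T × J} {v : T} (h : m.NB W l v) :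
    m.NB W (sm n l) (n * v) := by
  obtain ⟨⟨a, ha, h1⟩, ⟨b, hb, h2⟩⟩ := h
  exact ⟨⟨n * a, s.stab n hn a ha, by rwa [p_sm, p_sm]⟩, ⟨n * b, s.stab n hn b hb, by rwa [p_sm, p_sm]⟩⟩

theorem St.red_N (s : m.St K0 W N) {n : T} (hn : n ∈ N) {g : T} (hg : m.Red W N g) :
    m.Red W N (n * g) := by
  induction hg with
  | base g h => exact .base _ (N.mul_mem hn h)
  | step l hl e he g hg hnb ih =>
    have : n * (m.rr l ^ e * g) = m.rr (sm n l) ^ e * (n * g) := by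
      rw [rr_sm, conj_zpow]; group
    rw [this]
    refine .step _ (s.L_sm hn hl) e he _ ih fun w hw => ?_
    rw [mul_assoc]
    exact s.NB_sm hn (hnb w hw)

theorem St.red_L (s : m.St K0 W N) (ov : m.OV) {l : T × J} (hl : l ∈ m.Lset W N) (f : ℤ) {g : T}
    (hg : m.Red W N g) : m.Red W N (m.rr l ^ f * g) := by
  by_cases hf : f = 0
  · simpa [hf] using hg
  cases hg with
  | base g h => exact .step l hl f hf g (.base _ h) (s.nb_N h l)
  | step l' hl' e he g' hg' hnb =>
    by_cases hr : m.rr l = m.rr l'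
    · rw [hr, ← mul_assoc, ← zpow_add]
      by_cases h0 : f + e = 0
      · simpa [h0] using hg'
      · exact .step l' hl' _ h0 g' hg' hnb
    · refine .step l hl f hf _ (.step l' hl' e he g' hg' hnb) fun w hw => ?_
      refine pp2 ov hl' hl (Ne.symm hr) ?_
      rw [mul_assoc]
      exact s.pp1 hl' (hnb w hw) he

variable (m W N) in
def N' : Subgroup T := Subgroup.closure (N ∪ m.rr '' m.Lset W N)

theorem St.red_all (s : m.St K0 W N) (ov : m.OV) {g : T} (hg : g ∈ N' m W N) : m.Red W N g := by
  induction hg using Subgroup.closure_induction_left with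
  | one => exact .base _ N.one_mem
  | mul_left x hx y hy ih =>
    rcases hx with hx | ⟨l, hl, rfl⟩
    · exact s.red_N hx ih
    · simpa using s.red_L ov hl 1 ih
  | inv_mul_cancel x hx y hy ih =>
    rcases hx with hx | ⟨l, hl, rfl⟩
    · exact s.red_N (N.inv_mem hx) ih
    · simpa using s.red_L ov hl (-1) ih

theorem N_le : N ≤ N' m W N := fun _ hx => Subgroup.subset_closure (Or.inl hx)
theorem rr_mem_N' {l : T × J} (hl : l ∈ m.Lset W N) : m.rr l ∈ N' m W N :=
  Subgroup.subset_closure (Or.inr ⟨l, hl, rfl⟩)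

theorem St.min_case (s : m.St K0 W N) (ov : m.OV) {l' : T × J} (hl' : m.rr l' ∉ N' m W N)
    {w0 : T} (hw0 : w0 ∈ W) {n0 : ℤ}
    (hmin : ∀ g ∈ N' m W N, ∀ w ∈ W, ∀ n, m.M.d w0 (m.ax l' n0) ≤ m.M.d (g * w) (m.ax l' n))
    {g : T} (hg : g ∈ N' m W N) {w : T} (hw : w ∈ W) : |m.p l' (g * w) - m.p l' w0| ≤ 8 := by
  have hconst : ∀ u ∈ W, m.p l' u = m.p l' w0 := by
    intro u hu
    by_contra hne
    exact hl' (rr_mem_N' ⟨fun h => hl' (N_le h), u, hu, w0, hw0, hne⟩)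
  cases s.red_all ov hg with
  | base g h => rw [hconst _ (s.stab g h w hw)]; simp
  | step l hl e he g' hg' hnb =>
    have hne : m.rr l ≠ m.rr l' := fun h => hl' (h ▸ rr_mem_N' hl)
    have hNB := hnb w hw
    rw [mul_assoc]
    rcases (m.line l).behrstock (m.line l') (m.rr l ^ e * (g' * w)) with ⟨n, n', h1, h2⟩ | ⟨k, hk⟩
    · exfalso
      have hfar := s.far hl hNB he hw0
      have hnear := s.NB_near hl hNB hw0
      have o1 := ov l l' hne n n0
      have o2 := ov l l' hne n' n0
      have hu := m.rr_shift_zpow l e w0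
      have hv := m.rr_shift_zpow l e (g' * w)
      have hm := hmin (m.rr l ^ e) (Subgroup.zpow_mem _ (rr_mem_N' hl) e) w0 hw0 n0
      have d1 := (m.line l).dist_le (m.rr l ^ e * w0) (m.ax l' n0)
      rw [hu.2] at d1
      change m.p l _ ≤ m.p l _ at h1
      change m.p l _ ≤ m.p l _ at h2
      change _ ≤ _ + |m.p l _ - m.p l _| + _ at d1
      have hne2 : m.p l w0 ≠ m.p l (m.ax l' n0) := by
        intro h
        rw [abs_le] at o1 o2
        rw [le_abs] at hfar
        omega
      have d2 := (m.line l).dist_eq w0 (m.ax l' n0) hne2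
      change _ = _ + |m.p l _ - m.p l _| + _ at d2
      rw [hu.1] at d1
      rw [hv.1] at hfar h1 h2
      have a1 : |m.p l w0 + 72 * e - m.p l (m.ax l' n0)| ≤ 32 := by
        rw [abs_le] at o1 o2 hnear ⊢; omega
      have a2 : 40 ≤ |m.p l w0 - m.p l (m.ax l' n0)| := by
        rw [abs_le] at o1 o2
        rw [le_abs] at hfar ⊢; omega
      omega
    · obtain ⟨k0, hk0⟩ := touched_mid hl.2
      obtain ⟨u, hu, u', hu', h1, h2⟩ := hk0 l'
      rw [hconst u hu] at h1
      rw [hconst u' hu'] at h2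
      have := ov l' l hne.symm k k0
      change m.p l' _ = m.p l' _ at hk
      rw [hk]
      rwa [le_antisymm h2 h1] at this

theorem St.absorb (s : m.St K0 W N) (ov : m.OV) :
    m.St K0 {x | ∃ g ∈ N' m W N, ∃ w ∈ W, x = g * w} (N' m W N) where
  sub := fun x hx => ⟨1, Subgroup.one_mem _, x, s.sub hx, by simp⟩
  stab := by
    rintro g hg _ ⟨g', hg', w, hw, rfl⟩
    exact ⟨g * g', Subgroup.mul_mem _ hg hg', w, hw, by rw [mul_assoc]⟩
  le := by
    refine (Subgroup.closure_le _).2 (Set.union_subset s.le ?_)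
    rintro _ ⟨l, -, rfl⟩
    exact Subgroup.normalClosure_normal.conj_mem _ (Subgroup.subset_normalClosure (Set.mem_range_self _)) _
  gr := by
    intro g hg hg1
    cases s.red_all ov hg with
    | base g h => exact s.gr g h hg1
    | step l hl e he g' hg' hnb =>
      refine ⟨l, fun x hx x' hx' => ?_⟩
      rw [mul_assoc]
      exact s.far hl (hnb x' (s.sub hx')) he (s.sub hx)
  diam := by
    intro l
    by_cases hl : m.rr l ∈ N' m W N
    · exact Or.inl hl
    refine Or.inr ?_
    rcases W.eq_empty_or_nonempty with rfl | ⟨w1, hw1⟩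
    · rintro _ ⟨_, _, _, h, -⟩; exact h.elim
    obtain ⟨k, ⟨g0, hg0, w0, hw0, n0, hk⟩, hmin⟩ : ∃ k : ℕ, (∃ g ∈ N' m W N, ∃ w ∈ W, ∃ n,
        (m.M.d (g * w) (m.ax l n)).toNat = k) ∧ ∀ g ∈ N' m W N, ∀ w ∈ W, ∀ n,
          k ≤ (m.M.d (g * w) (m.ax l n)).toNat := by
      classical
      have hex : ∃ k : ℕ, (∃ g ∈ N' m W N, ∃ w ∈ W, ∃ n, (m.M.d (g * w) (m.ax l n)).toNat = k) :=
        ⟨_, 1, Subgroup.one_mem _, w1, hw1, 0, rfl⟩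
      exact ⟨Nat.find hex, Nat.find_spec hex, fun g hg w hw n => Nat.find_min' hex ⟨g, hg, w, hw, n, rfl⟩⟩
    have key : ∀ g ∈ N' m W N, ∀ w ∈ W, |m.p l (g * w) - m.p l (g0 * w0)| ≤ 8 := by
      intro g hg w hw
      have := s.min_case ov (l' := sm g0⁻¹ l) ?_ hw0 (n0 := n0) ?_ (g := g0⁻¹ * g)
        (Subgroup.mul_mem _ (Subgroup.inv_mem _ hg0) hg) hw
      · have e1 := m.p_sm g0⁻¹ l (g * w)
        have e2 := m.p_sm g0⁻¹ l (g0 * w0)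
        rw [← mul_assoc] at e1
        rw [← mul_assoc, inv_mul_cancel, one_mul] at e2
        rwa [e1, e2] at this
      · rw [rr_sm]
        intro h
        apply hl
        have := Subgroup.mul_mem _ (Subgroup.mul_mem _ hg0 h) (Subgroup.inv_mem _ hg0)
        simpa [mul_assoc] using this
      · intro g' hg' w' hw' n
        have e1 := m.inv g0 w0 (m.ax (sm g0⁻¹ l) n0)
        have e2 := m.inv g0 (g' * w') (m.ax (sm g0⁻¹ l) n)
        rw [ax_sm, ← mul_assoc g0 g0⁻¹, mul_inv_cancel, one_mul] at e1 e2
        rw [← mul_assoc] at e2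
        rw [ax_sm, ax_sm, ← e1, ← e2]
        have := hmin (g0 * g') (Subgroup.mul_mem _ hg0 hg') w' hw' n
        have h1 := m.M.nonneg (g0 * w0) (m.ax l n0)
        have h2 := m.M.nonneg (g0 * g' * w') (m.ax l n)
        omega
    rintro _ ⟨g, hg, w, hw, rfl⟩ _ ⟨g', hg', w', hw', rfl⟩
    have h1 := abs_le.1 (key g hg w hw)
    have h2 := abs_le.1 (key g' hg' w' hw')
    rw [abs_le]; omega

theorem St.grow (s : m.St K0 W N) (hL : m.Lset W N = ∅) :
    m.St K0 {v | ∃ w ∈ W, m.M.d v w ≤ 2} N where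
  sub := fun x hx => ⟨x, s.sub hx, by rw [m.M.self]; norm_num⟩
  stab := by
    rintro g hg v ⟨w, hw, h⟩
    exact ⟨g * w, s.stab g hg w hw, by rwa [m.inv]⟩
  le := s.le
  gr := s.gr
  diam := by
    intro l
    by_cases hl : m.rr l ∈ N
    · exact Or.inl hl
    right
    rintro v ⟨w, hw, h⟩ v' ⟨w', hw', h'⟩
    have : m.p l w = m.p l w' := by
      by_contra hne
      have : l ∈ m.Lset W N := ⟨hl, w, hw, w', hw', hne⟩
      rw [hL] at this
      exact this
    have h1 := (m.line l).pr_lip v w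
    have h2 := (m.line l).pr_lip v' w'
    change |m.p l _ - m.p l _| ≤ _ at h1
    change |m.p l _ - m.p l _| ≤ _ at h2
    rw [abs_le] at *
    omega

theorem windmill (ov : m.OV) (hne : K0.Nonempty)
    (hK : ∀ l, ∀ w ∈ K0, ∀ w' ∈ K0, |m.p l w - m.p l w'| ≤ 16) :
    ∀ g ∈ Subgroup.normalClosure (Set.range m.R), g ≠ 1 →
      ∃ l, ∀ x ∈ K0, ∀ x' ∈ K0, 48 ≤ |m.p l x - m.p l (g * x')| := by
  have s0 : m.St K0 K0 ⊥ :=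
    ⟨subset_rfl, by simp, bot_le, fun l => Or.inr (hK l), by simp⟩
  obtain ⟨⟨W, N⟩, -, hs, hmax⟩ := zorn_le_nonempty₀ {x : Set T × Subgroup T | m.St K0 x.1 x.2} (by
    intro c hc hchain y hy
    have hdir : DirectedOn (· ≤ ·) (Prod.snd '' c) := by
      rintro _ ⟨a, ha, rfl⟩ _ ⟨b, hb, rfl⟩
      rcases hchain.total ha hb with h | h
      · exact ⟨b.2, ⟨b, hb, rfl⟩, h.2, le_rfl⟩
      · exact ⟨a.2, ⟨a, ha, rfl⟩, le_rfl, h.2⟩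
    have hmem : ∀ g, g ∈ sSup (Prod.snd '' c) ↔ ∃ a ∈ c, g ∈ a.2 := by
      intro g
      rw [Subgroup.mem_sSup_of_directedOn (Set.Nonempty.image _ ⟨y, hy⟩) hdir]
      exact ⟨fun ⟨_, ⟨a, ha, e⟩, hg⟩ => ⟨a, ha, e ▸ hg⟩, fun ⟨a, ha, hg⟩ => ⟨_, ⟨a, ha, rfl⟩, hg⟩⟩
    refine ⟨(⋃ a ∈ c, a.1, sSup (Prod.snd '' c)), ?_, ?_⟩
    · refine ⟨fun x hx => ?_, ?_, ?_, ?_, ?_⟩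
      · exact Set.mem_biUnion hy ((hc hy).sub hx)
      · intro g hg w hw
        obtain ⟨a, ha, hga⟩ := (hmem g).1 hg
        obtain ⟨b, hb, hwb⟩ := Set.mem_iUnion₂.1 hw
        rcases hchain.total ha hb with h | h
        · exact Set.mem_biUnion hb ((hc hb).stab g (h.2 hga) w hwb)
        · exact Set.mem_biUnion ha ((hc ha).stab g hga w (h.1 hwb))
      · intro g hg
        obtain ⟨a, ha, hga⟩ := (hmem g).1 hg
        exact (hc ha).le hga
      · intro l
        by_cases hl : m.rr l ∈ sSup (Prod.snd '' c)
        · exact Or.inl hl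
        right
        intro w hw w' hw'
        have hl' : ∀ a ∈ c, m.rr l ∉ a.2 := fun a ha h => hl ((hmem _).2 ⟨a, ha, h⟩)
        obtain ⟨a, ha, hwa⟩ := Set.mem_iUnion₂.1 hw
        obtain ⟨b, hb, hwb⟩ := Set.mem_iUnion₂.1 hw'
        rcases hchain.total ha hb with h | h
        · exact ((hc hb).diam l).resolve_left (hl' b hb) w (h.1 hwa) w' hwb
        · exact ((hc ha).diam l).resolve_left (hl' a ha) w hwa w' (h.1 hwb)
      · intro g hg
        obtain ⟨a, ha, hga⟩ := (hmem g).1 hg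
        exact (hc ha).gr g hga
    · intro a ha
      exact ⟨fun x hx => Set.mem_biUnion ha hx, fun x hx => (hmem x).2 ⟨a, ha, hx⟩⟩) (K0, ⊥) s0
  change m.St K0 W N at hs
  have hN' : N' m W N ≤ N := by
    have := hmax (y := ({x | ∃ g ∈ N' m W N, ∃ w ∈ W, x = g * w}, N' m W N)) (hs.absorb ov) ⟨fun w hw => ⟨1, Subgroup.one_mem _, w, hw, by simp⟩, N_le⟩
    exact this.2
  have hL : m.Lset W N = ∅ := by
    ext l
    simp only [Set.mem_empty_iff_false, iff_false]
    intro hl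
    exact hl.1 (hN' (rr_mem_N' hl))
  have hW : W = Set.univ := by
    have := (hmax (y := ({v | ∃ w ∈ W, m.M.d v w ≤ 2}, N)) (hs.grow hL) ⟨fun w hw => ⟨w, hw, by rw [m.M.self]; norm_num⟩, le_rfl⟩).1
    exact m.conn W (hne.mono hs.sub) fun w hw v hv => this ⟨w, hw, hv⟩
  have hall : ∀ l, m.rr l ∈ N := by
    intro l
    by_contra hl
    have : l ∈ m.Lset W N := by
      refine ⟨hl, m.ax l 0, by simp [hW], m.ax l 1, by simp [hW], ?_⟩
      unfold p
      rw [(m.line l).pr_self, (m.line l).pr_self]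
      norm_num
    rw [hL] at this
    exact this
  intro g hg hg1
  refine hs.gr g ?_ hg1
  suffices h : Subgroup.normalClosure (Set.range m.R) ≤ N from h hg
  unfold Subgroup.normalClosure
  rw [Subgroup.closure_le]
  intro x hx
  obtain ⟨_, ⟨j, rfl⟩, hx⟩ := Group.mem_conjugatesOfSet_iff.1 hx
  obtain ⟨c, hc⟩ := isConj_iff.1 hx
  have := hall (c, j)
  unfold rr at this
  simp only at this
  rwa [hc] at this

end Mill
end ShelahFormalization

namespace ShelahFormalization

/-- reduced expressions of length `n` starting on the side `b` -/
inductive RW {T : Type*} [Group T] (A : Bool → Subgroup T) (S : Subgroup T) : Bool → ℕ → T → Prop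
  | nil (b : Bool) (s : T) (h : s ∈ S) : RW A S b 0 s
  | cons (b : Bool) (n : ℕ) (x g : T) (hx : x ∈ A b) (hxS : x ∉ S) (hg : RW A S (!b) n g) :
      RW A S b (n + 1) (x * g)

/-- internal amalgamated product -/
structure Amal (T : Type*) [Group T] where
  A : Bool → Subgroup T
  S : Subgroup T
  le : ∀ b, S ≤ A b
  gen : Subgroup.closure (A true ∪ A false : Set T) = ⊤
  nf : ∀ b n g, RW A S b (n + 1) g → g ∉ S

namespace Amal
variable {T : Type*} [Group T] (m : Amal T)

abbrev Rw (b : Bool) (n : ℕ) (g : T) : Prop := RW m.A m.S b n g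

variable {m}
theorem smul_rw {b : Bool} {n : ℕ} {g : T} (h : m.Rw b n g) {s : T} (hs : s ∈ m.S) :
    m.Rw b n (s * g) := by
  cases h with
  | nil b s' h => exact .nil _ _ (m.S.mul_mem hs h)
  | cons b n x g hx hxS hg =>
    rw [← mul_assoc]
    refine .cons _ _ _ _ ((m.A b).mul_mem (m.le b hs) hx) (fun h => hxS ?_) hg
    simpa using m.S.mul_mem (m.S.inv_mem hs) h

theorem side_zero {b b' : Bool} {g : T} (h : m.Rw b 0 g) : m.Rw b' 0 g := by
  cases h with
  | nil b s' h => exact .nil _ _ h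

theorem rw_zero {b : Bool} {g : T} : m.Rw b 0 g ↔ g ∈ m.S := by
  constructor
  · intro h
    cases h with
    | nil b s' h => exact h
  · intro h; exact .nil _ _ h

theorem head {b : Bool} {n : ℕ} {g : T} (h : m.Rw b (n + 1) g) :
    ∃ x, x ∈ m.A b ∧ x ∉ m.S ∧ m.Rw (!b) n (x⁻¹ * g) := by
  cases h with
  | cons b n x g hx hxS hg => exact ⟨x, hx, hxS, by simpa using hg⟩

theorem cons' {b : Bool} {n : ℕ} {g x : T} (hx : x ∈ m.A b) (hxS : x ∉ m.S)
    (h : m.Rw (!b) n (x⁻¹ * g)) : m.Rw b (n + 1) g := by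
  have := RW.cons b n x _ hx hxS h
  simpa using this

theorem notS_inv {x : T} (h : x ∉ m.S) : x⁻¹ ∉ m.S := fun h' => h (by simpa using m.S.inv_mem h')

theorem single {b : Bool} {x : T} (hx : x ∈ m.A b) (hxS : x ∉ m.S) : m.Rw b 1 x :=
  cons' hx hxS (by simpa using RW.nil _ 1 m.S.one_mem)

theorem inter {x : T} (h1 : x ∈ m.A true) (h2 : x ∈ m.A false) : x ∈ m.S := by
  by_contra hS
  have h3 : m.Rw false 1 x := single h2 hS
  have : m.Rw true 2 (x⁻¹ * x) := RW.cons true 1 _ _ ((m.A true).inv_mem h1) (notS_inv hS) h3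
  exact m.nf _ _ _ this (by simp)

theorem inter' {b : Bool} {x : T} (h1 : x ∈ m.A b) (h2 : x ∈ m.A (!b)) : x ∈ m.S := by
  cases b
  · exact inter h2 h1
  · exact inter h1 h2

theorem exists_rw (g : T) : ∃ b n, m.Rw b n g := by
  have hg : g ∈ Subgroup.closure (m.A true ∪ m.A false : Set T) := by rw [m.gen]; trivial
  have key : ∀ b, ∀ x ∈ m.A b, ∀ y, (∃ b n, m.Rw b n y) → ∃ b n, m.Rw b n (x * y) := by
    rintro b x hx y ⟨b', n, h⟩
    by_cases hxS : x ∈ m.S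
    · exact ⟨b', n, smul_rw h hxS⟩
    cases n with
    | zero => exact ⟨b, 1, .cons _ _ _ _ hx hxS (side_zero h)⟩
    | succ n =>
      by_cases hb : b' = b
      · subst hb
        obtain ⟨z, hz, hzS, hr⟩ := head h
        by_cases hxz : x * z ∈ m.S
        · refine ⟨!b', n, ?_⟩
          have := smul_rw hr hxz
          simpa [mul_assoc] using this
        · refine ⟨b', n + 1, cons' ((m.A b').mul_mem hx hz) hxz ?_⟩
          simpa [mul_assoc] using hr
      · have : b' = !b := by cases b <;> cases b' <;> simp_all
        subst this
        exact ⟨b, n + 2, .cons _ _ _ _ hx hxS h⟩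
  induction hg using Subgroup.closure_induction_left with
  | one => exact ⟨true, 0, .nil _ _ m.S.one_mem⟩
  | mul_left x hx y hy ih =>
    rcases hx with hx | hx
    · exact key _ x hx y ih
    · exact key _ x hx y ih
  | inv_mul_cancel x hx y hy ih =>
    rcases hx with hx | hx
    · exact key _ _ ((m.A _).inv_mem hx) y ih
    · exact key _ _ ((m.A _).inv_mem hx) y ih

theorem diff {n : ℕ} : ∀ {b : Bool} {u : T} {k : ℕ} {v : T}, m.Rw b n u → m.Rw (!b) k v →
    ∃ e, m.Rw e (n + k) (u⁻¹ * v) := by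
  induction n with
  | zero =>
    intro b u k v hu hv
    rw [rw_zero] at hu
    exact ⟨_, by simpa using smul_rw hv (m.S.inv_mem hu)⟩
  | succ n ih =>
    intro b u k v hu hv
    obtain ⟨x, hx, hxS, hr⟩ := head hu
    have h2 : m.Rw (!!b) (k + 1) (x⁻¹ * v) := by
      rw [Bool.not_not]
      exact .cons _ _ _ _ ((m.A b).inv_mem hx) (notS_inv hxS) hv
    obtain ⟨e, he⟩ := ih hr h2
    refine ⟨e, ?_⟩
    rw [show n + 1 + k = n + (k + 1) by ring]
    simpa [mul_assoc] using he

theorem side_unique {b b' : Bool} {n n' : ℕ} {g : T} (h : m.Rw b (n + 1) g) (h' : m.Rw b' (n' + 1) g) :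
    b = b' := by
  by_contra hb
  have : b' = !b := by cases b <;> cases b' <;> simp_all
  subst this
  obtain ⟨e, he⟩ := diff h h'
  exact m.nf e (n + 1 + n') _ he (by simp)

theorem len_unique {n : ℕ} : ∀ {b b' : Bool} {n' : ℕ} {g : T}, m.Rw b n g → m.Rw b' n' g → n = n' := by
  induction n with
  | zero =>
    intro b b' n' g h h'
    rw [rw_zero] at h
    cases n' with
    | zero => rfl
    | succ n' => exact absurd h (m.nf _ _ _ h')
  | succ n ih =>
    intro b b' n' g h h'
    cases n' with
    | zero =>
      rw [rw_zero] at h'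
      exact absurd h' (m.nf _ _ _ h)
    | succ n' =>
      obtain rfl := side_unique h h'
      obtain ⟨x, hx, hxS, hr⟩ := head h
      obtain ⟨y, hy, hyS, hr'⟩ := head h'
      by_cases hxy : x⁻¹ * y ∈ m.S
      · have := smul_rw hr' hxy
        have e : x⁻¹ * y * (y⁻¹ * g) = x⁻¹ * g := by group
        rw [e] at this
        rw [ih hr this]
      · have h3 : m.Rw b (n' + 1) (x⁻¹ * g) := by
          refine cons' ((m.A b).mul_mem ((m.A b).inv_mem hx) hy) hxy ?_
          have e : (x⁻¹ * y)⁻¹ * (x⁻¹ * g) = y⁻¹ * g := by group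
          rwa [e]
        cases n with
        | zero =>
          rw [rw_zero] at hr
          exact absurd hr (m.nf _ _ _ h3)
        | succ n =>
          have := side_unique hr h3
          cases b <;> simp at this

variable (m) in
noncomputable def len (g : T) : ℕ := (m.exists_rw g).choose_spec.choose

theorem len_spec (g : T) : ∃ b, m.Rw b (m.len g) g :=
  ⟨_, (m.exists_rw g).choose_spec.choose_spec⟩

theorem len_eq {b : Bool} {n : ℕ} {g : T} (h : m.Rw b n g) : m.len g = n := by
  obtain ⟨b', h'⟩ := m.len_spec g
  exact len_unique h' h

theorem len_inv (g : T) : m.len g⁻¹ = m.len g := by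
  obtain ⟨b, h⟩ := m.len_spec g
  obtain ⟨e, he⟩ := diff h (RW.nil (!b) 1 m.S.one_mem)
  rw [mul_one] at he
  simpa using len_eq he

theorem len_zero {g : T} : m.len g = 0 ↔ g ∈ m.S := by
  constructor
  · intro h
    obtain ⟨b, h'⟩ := m.len_spec g
    rw [h] at h'
    exact rw_zero.1 h'
  · intro h
    exact len_eq (RW.nil true g h)

theorem len_le_one {b : Bool} {g : T} (h : g ∈ m.A b) : m.len g ≤ 1 := by
  by_cases hS : g ∈ m.S
  · rw [len_zero.2 hS]; norm_num
  · rw [len_eq (single h hS)]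

theorem len_one {g : T} (h : m.len g ≤ 1) : ∃ b, g ∈ m.A b := by
  obtain ⟨b, h'⟩ := m.len_spec g
  interval_cases hl : m.len g
  · exact ⟨b, m.le b (rw_zero.1 h')⟩
  · obtain ⟨x, hx, hxS, hr⟩ := head h'
    rw [rw_zero] at hr
    exact ⟨b, by simpa using (m.A b).mul_mem hx (m.le b hr)⟩

variable (m) in
/-- twice the Gromov product -/
noncomputable def gp (u v : T) : ℤ := m.len u + m.len v - m.len (u⁻¹ * v)

theorem gp_same {b : Bool} {n k : ℕ} {u v x y : T} (hx : x ∈ m.A b) (hxS : x ∉ m.S)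
    (hy : y ∈ m.A b) (hyS : y ∉ m.S) (hu : m.Rw (!b) n (x⁻¹ * u)) (hv : m.Rw (!b) k (y⁻¹ * v))
    (hxy : x⁻¹ * y ∈ m.S) : m.gp u v = 2 + m.gp (x⁻¹ * u) (x⁻¹ * v) := by
  have h1 := len_eq (cons' hx hxS hu)
  have h2 := len_eq (cons' hy hyS hv)
  have h3 := len_eq hu
  have h4 := smul_rw hv hxy
  rw [show x⁻¹ * y * (y⁻¹ * v) = x⁻¹ * v by group] at h4
  have h5 := len_eq h4
  unfold gp
  rw [h1, h2, h3, h5, show (x⁻¹ * u)⁻¹ * (x⁻¹ * v) = u⁻¹ * v by group]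
  push_cast; ring

theorem gp_one {b : Bool} {n k : ℕ} {u v x y : T} (hx : x ∈ m.A b) (hxS : x ∉ m.S)
    (hy : y ∈ m.A b) (hyS : y ∉ m.S) (hu : m.Rw (!b) n (x⁻¹ * u)) (hv : m.Rw (!b) k (y⁻¹ * v))
    (hxy : x⁻¹ * y ∉ m.S) : m.gp u v = 1 := by
  have h1 := len_eq (cons' hx hxS hu)
  have h2 := len_eq (cons' hy hyS hv)
  have h3 : m.Rw (!!b) (k + 1) (x⁻¹ * v) := by
    rw [Bool.not_not]
    refine cons' ((m.A b).mul_mem ((m.A b).inv_mem hx) hy) hxy ?_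
    rwa [show (x⁻¹ * y)⁻¹ * (x⁻¹ * v) = y⁻¹ * v by group]
  obtain ⟨e, he⟩ := diff hu h3
  rw [show (x⁻¹ * u)⁻¹ * (x⁻¹ * v) = u⁻¹ * v by group] at he
  have := len_eq he
  unfold gp
  rw [h1, h2, this]
  push_cast; ring

theorem gp_zero {b : Bool} {n k : ℕ} {u v : T} (hu : m.Rw b n u) (hv : m.Rw (!b) k v) :
    m.gp u v = 0 := by
  obtain ⟨e, he⟩ := diff hu hv
  unfold gp
  rw [len_eq hu, len_eq hv, len_eq he]
  push_cast; ring

theorem gp_S {u v : T} (h : u ∈ m.S ∨ v ∈ m.S) : m.gp u v = 0 := by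
  rcases h with h | h
  · obtain ⟨b, hb⟩ := m.len_spec v
    exact gp_zero (b := !b) (RW.nil _ u h) (by rwa [Bool.not_not])
  · obtain ⟨b, hb⟩ := m.len_spec u
    exact gp_zero hb (RW.nil _ v h)

theorem gp_nonneg (n : ℕ) : ∀ u v : T, m.len u = n → 0 ≤ m.gp u v := by
  induction n with
  | zero => intro u v h; rw [gp_S (Or.inl (len_zero.1 h))]
  | succ n ih =>
    intro u v h
    obtain ⟨b, hb⟩ := m.len_spec u
    rw [h] at hb
    obtain ⟨b', hb'⟩ := m.len_spec v
    cases hk : m.len v with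
    | zero => rw [gp_S (Or.inr (len_zero.1 hk))]
    | succ k =>
      rw [hk] at hb'
      by_cases hbb : b' = b
      · subst hbb
        obtain ⟨x, hx, hxS, hr⟩ := head hb
        obtain ⟨y, hy, hyS, hr'⟩ := head hb'
        by_cases hxy : x⁻¹ * y ∈ m.S
        · rw [gp_same hx hxS hy hyS hr hr' hxy]
          have := ih (x⁻¹ * u) (x⁻¹ * v) (len_eq hr)
          omega
        · rw [gp_one hx hxS hy hyS hr hr' hxy]; norm_num
      · have : b' = !b := by cases b <;> cases b' <;> simp_all
        subst this
        rw [gp_zero hb hb']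

theorem gp_symm (u v : T) : m.gp u v = m.gp v u := by
  unfold gp
  rw [← len_inv (u⁻¹ * v)]
  simp only [mul_inv_rev, inv_inv]
  ring

theorem gp_hyp (n : ℕ) : ∀ u v w : T, m.len w = n → min (m.gp u w) (m.gp v w) ≤ m.gp u v := by
  induction n with
  | zero =>
    intro u v w h
    rw [gp_S (u := u) (v := w) (Or.inr (len_zero.1 h))]
    exact (min_le_left _ _).trans (gp_nonneg _ _ _ rfl)
  | succ n ih =>
    intro u v w h
    have h0 := gp_nonneg (m := m) _ u v rfl
    obtain ⟨b, hb⟩ := m.len_spec w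
    rw [h] at hb
    have red : ∀ u, m.gp u w ≤ 0 ∨ ∃ k, m.Rw b (k + 1) u := by
      intro u
      obtain ⟨b', hb'⟩ := m.len_spec u
      cases hk : m.len u with
      | zero => left; rw [gp_S (Or.inl (len_zero.1 hk))]
      | succ k =>
        rw [hk] at hb'
        by_cases hbb : b' = b
        · subst hbb; exact Or.inr ⟨k, hb'⟩
        · have : b = !b' := by cases b <;> cases b' <;> simp_all
          subst this
          left; rw [gp_zero hb' hb]
    rcases red u with hu | ⟨ku, hu⟩
    · exact (min_le_left _ _).trans (hu.trans h0)
    rcases red v with hv | ⟨kv, hv⟩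
    · exact (min_le_right _ _).trans (hv.trans h0)
    obtain ⟨z, hz, hzS, hr⟩ := head hb
    obtain ⟨x, hx, hxS, hru⟩ := head hu
    obtain ⟨y, hy, hyS, hrv⟩ := head hv
    have h1 : 1 ≤ m.gp u v := by
      by_cases hxy : x⁻¹ * y ∈ m.S
      · rw [gp_same hx hxS hy hyS hru hrv hxy]
        have := gp_nonneg (m := m) _ (x⁻¹ * u) (x⁻¹ * v) rfl
        omega
      · rw [gp_one hx hxS hy hyS hru hrv hxy]
    by_cases hxz : z⁻¹ * x ∈ m.S
    · by_cases hyz : z⁻¹ * y ∈ m.S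
      · have hxy : x⁻¹ * y ∈ m.S := by
          have := m.S.mul_mem (m.S.inv_mem hxz) hyz
          simpa [mul_assoc] using this
        have e1 := gp_same hz hzS hx hxS hr hru hxz
        have e2 := gp_same hz hzS hy hyS hr hrv hyz
        have hru' := smul_rw hru hxz
        rw [show z⁻¹ * x * (x⁻¹ * u) = z⁻¹ * u by group] at hru'
        have e3 := gp_same hz hzS hy hyS hru' hrv hyz
        rw [gp_symm] at e1 e2
        rw [e1, e2, e3]
        have := ih (z⁻¹ * u) (z⁻¹ * v) (z⁻¹ * w) (len_eq hr)
        rw [gp_symm (z⁻¹ * u) (z⁻¹ * w), gp_symm (z⁻¹ * v) (z⁻¹ * w)] at this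
        omega
      · rw [gp_symm v w, gp_one hz hzS hy hyS hr hrv hyz]
        omega
    · rw [gp_symm u w, gp_one hz hzS hx hxS hr hru hxz]
      omega

variable (m) in
/-- the tree metric -/
noncomputable def tree : TreeD T where
  d x y := 2 * m.len (x⁻¹ * y)
  self x := by simp [len_zero.2 m.S.one_mem]
  symm x y := by rw [← len_inv (x⁻¹ * y)]; simp
  even x y := ⟨_, rfl⟩
  fp x y z w := by
    have h := gp_hyp (m := m) _ (w⁻¹ * x) (w⁻¹ * y) (w⁻¹ * z) rfl
    unfold gp at h
    rw [show (w⁻¹ * x)⁻¹ * (w⁻¹ * z) = x⁻¹ * z by group,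
      show (w⁻¹ * y)⁻¹ * (w⁻¹ * z) = y⁻¹ * z by group,
      show (w⁻¹ * x)⁻¹ * (w⁻¹ * y) = x⁻¹ * y by group] at h
    have e1 := len_inv (m := m) (w⁻¹ * x)
    have e2 := len_inv (m := m) (w⁻¹ * y)
    have e3 := len_inv (m := m) (w⁻¹ * z)
    simp only [mul_inv_rev, inv_inv] at e1 e2 e3
    rw [← e1, ← e2, ← e3] at h
    have e4 : m.len (z⁻¹ * w) = m.len (w⁻¹ * z) := by rw [← e3]
    omega

theorem tree_d (x y : T) : m.tree.d x y = 2 * m.len (x⁻¹ * y) := rfl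

theorem tree_inv (g x y : T) : m.tree.d (g * x) (g * y) = m.tree.d x y := by
  rw [tree_d, tree_d]; congr 3; group

theorem tree_conn (W : Set T) (hne : W.Nonempty) (h : ∀ w ∈ W, ∀ v, m.tree.d v w ≤ 2 → v ∈ W) :
    W = Set.univ := by
  obtain ⟨w, hw⟩ := hne
  have hs : ∀ b, ∀ a ∈ m.A b, ∀ x ∈ W, x * a ∈ W := by
    intro b a ha x hx
    refine h x hx _ ?_
    rw [tree_d]
    have := len_le_one ((m.A b).inv_mem ha)
    simp only [mul_inv_rev, inv_mul_cancel_right]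
    omega
  have key : ∀ g ∈ Subgroup.closure (m.A true ∪ m.A false : Set T), w * g ∈ W := by
    intro g hg
    induction hg using Subgroup.closure_induction_right with
    | one => simpa
    | mul_right x hx y hy ih =>
      rw [← mul_assoc]
      rcases hy with hy | hy
      · exact hs _ _ hy _ ih
      · exact hs _ _ hy _ ih
    | mul_inv_cancel x hx y hy ih =>
      rw [← mul_assoc]
      rcases hy with hy | hy
      · exact hs _ _ ((m.A _).inv_mem hy) _ ih
      · exact hs _ _ ((m.A _).inv_mem hy) _ ih
  ext x
  simp only [Set.mem_univ, iff_true]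
  have := key (w⁻¹ * x) (by rw [m.gen]; trivial)
  simpa using this

end Amal
end ShelahFormalization

namespace ShelahFormalization

/-- small cancellation data over an amalgam -/
structure SC (T : Type*) [Group T] extends Amal T where
  l : Bool → ℕ → T
  E : Bool → Set T
  hE : ∀ b, ∀ e ∈ E b, e ∈ A (!b) ∧ e ∉ S
  hl : ∀ b, (E b).Nonempty → ∀ i < 18, l b i ∈ A b ∧ l b i ∉ S
  good : ∀ b, (E b).Nonempty → ∀ i < 18, ∀ s ∈ S, (l b i)⁻¹ * s * l b i ∈ S → s = 1
  dc : ∀ b, (E b).Nonempty → ∀ i < 18, ∀ j < 18, i ≠ j → ∀ s ∈ S, ∀ s' ∈ S,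
    l b i ≠ s * l b j * s' ∧ l b i ≠ s * (l b j)⁻¹ * s'

namespace SC
variable {T : Type*} [Group T] (m : SC T)

abbrev J := {j : Bool × T // j.2 ∈ m.E j.1}

variable {m}
def xs (j : m.J) (i : ℕ) : T := if i % 2 = 0 then j.1.2 else m.l j.1.1 (i / 2)
def Pi (j : m.J) (k : ℕ) : T := ((List.range k).map (xs j)).prod
def lt (j : m.J) (n : ℤ) : T := xs j (n % 36).toNat
def hh (j : m.J) (n : ℤ) : T := Pi j 36 ^ (n / 36) * Pi j (n % 36).toNat
def side (j : m.J) (n : ℤ) : Bool := if n % 2 = 0 then !j.1.1 else j.1.1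

theorem ne (j : m.J) : (m.E j.1.1).Nonempty := ⟨_, j.2⟩

theorem Pi_succ (j : m.J) (k : ℕ) : Pi j (k + 1) = Pi j k * xs j k := by
  simp [Pi, List.range_succ]

theorem Pi_double (j : m.J) (k : ℕ) :
    Pi j (2 * k) = ((List.range k).map fun i => j.1.2 * m.l j.1.1 i).prod := by
  induction k with
  | zero => simp [Pi]
  | succ k ih =>
    rw [show 2 * (k + 1) = 2 * k + 1 + 1 by ring, Pi_succ, Pi_succ, ih, List.range_succ]
    have h1 : xs j (2 * k) = j.1.2 := by simp [xs]
    have h2 : xs j (2 * k + 1) = m.l j.1.1 k := by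
      unfold xs
      rw [if_neg (by omega)]
      congr 1; omega
    rw [h1, h2]
    simp [mul_assoc]

theorem hh_succ (j : m.J) (n : ℤ) : hh j (n + 1) = hh j n * lt j n := by
  unfold hh lt
  by_cases h : n % 36 = 35
  · have h1 : (n + 1) % 36 = 0 := by omega
    have h2 : (n + 1) / 36 = n / 36 + 1 := by omega
    rw [h1, h2, h, zpow_add_one, mul_assoc, mul_assoc]
    have : Pi j (Int.toNat 0) = 1 := by simp [Pi]
    rw [this, mul_one]
    have := Pi_succ j 35
    congr 1
  · have h1 : ((n + 1) % 36).toNat = (n % 36).toNat + 1 := by omega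
    have h2 : (n + 1) / 36 = n / 36 := by omega
    rw [h1, h2, Pi_succ j (n % 36).toNat, mul_assoc]

theorem hh_per (j : m.J) (n : ℤ) : Pi j 36 * hh j n = hh j (n + 36) := by
  unfold hh
  rw [show (n + 36) / 36 = 1 + n / 36 by omega, show (n + 36) % 36 = n % 36 by omega, zpow_one_add,
    mul_assoc]

theorem hh_per' (j : m.J) (n k : ℤ) (h : n % 36 = k % 36) :
    Pi j 36 ^ (n / 36 - k / 36) * hh j k = hh j n := by
  unfold hh
  rw [← mul_assoc, ← zpow_add, h]
  congr 2; ring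

theorem lt_even (j : m.J) (n : ℤ) (h : n % 2 = 0) : lt j n = j.1.2 := by
  unfold lt xs
  rw [if_pos (by omega)]

theorem lt_odd (j : m.J) (n : ℤ) (h : n % 2 = 1) : lt j n = m.l j.1.1 ((n % 36) / 2).toNat := by
  unfold lt xs
  rw [if_neg (by omega)]
  congr 1; omega

theorem lt_mem (j : m.J) (n : ℤ) : lt j n ∈ m.A (side j n) ∧ lt j n ∉ m.S := by
  unfold side
  by_cases h : n % 2 = 0
  · rw [lt_even j n h, if_pos h]
    exact m.hE _ _ j.2
  · rw [lt_odd j n (by omega), if_neg h]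
    exact m.hl _ (ne j) _ (by omega)

theorem side_succ (j : m.J) (n : ℤ) : side j (n + 1) = !side j n := by
  unfold side
  by_cases h : n % 2 = 0
  · rw [if_pos h, if_neg (by omega), Bool.not_not]
  · rw [if_neg h, if_pos (by omega)]

theorem hh_rw (j : m.J) (k : ℕ) : ∀ n : ℤ, m.Rw (side j n) k ((hh j n)⁻¹ * hh j (n + k)) := by
  induction k with
  | zero => intro n; simpa using RW.nil _ 1 m.S.one_mem
  | succ k ih =>
    intro n
    refine Amal.cons' (lt_mem j n).1 (lt_mem j n).2 ?_
    have := ih (n + 1)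
    rw [side_succ, hh_succ] at this
    rw [← mul_assoc, ← mul_inv_rev]
    convert this using 3
    push_cast; ring

theorem hh_line (j : m.J) : m.tree.IsLine (hh j) := by
  have key : ∀ i (k : ℕ), m.tree.d (hh j i) (hh j (i + k)) = 2 * k := by
    intro i k
    rw [Amal.tree_d, Amal.len_eq (hh_rw j k i)]
  intro i k
  rcases le_total i k with h | h
  · have := key i (k - i).toNat
    rw [show i + ((k - i).toNat : ℤ) = k by omega] at this
    rw [this, abs_of_nonpos (by omega)]
    omega
  · have := key k (i - k).toNat
    rw [show k + ((i - k).toNat : ℤ) = i by omega] at this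
    rw [m.tree.symm, this, abs_of_nonneg (by omega)]
    omega

variable (m) in
noncomputable def mill : Mill T m.J where
  M := m.tree
  inv := Amal.tree_inv
  conn := Amal.tree_conn
  h := hh
  R := fun j => Pi j 36
  line0 := hh_line
  per := hh_per

theorem ax_succ (a : T × m.J) (n : ℤ) : m.mill.ax a (n + 1) = m.mill.ax a n * lt a.2 n := by
  unfold Mill.ax mill
  simp only
  rw [hh_succ, mul_assoc]

/-- same coset -/
def co (m : SC T) (u v : T) : Prop := u⁻¹ * v ∈ m.S

theorem co_iff {u v : T} : m.co u v ↔ m.mill.M.d u v = 0 := by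
  unfold co
  change _ ↔ m.tree.d u v = 0
  rw [Amal.tree_d, ← Amal.len_zero]
  omega

theorem fwd0 {a a' : T × m.J} {k i : ℤ} (hk : k % 2 = 1)
    (h : ∀ t : ℤ, 0 ≤ t → t ≤ 3 → m.co (m.mill.ax a (k + t)) (m.mill.ax a' (i + t))) :
    m.mill.rr a = m.mill.rr a' := by
  have hs : ∀ t : ℤ, 0 ≤ t → t ≤ 2 → ∃ s ∈ m.S, ∃ s' ∈ m.S,
      s = (m.mill.ax a (k + t))⁻¹ * m.mill.ax a' (i + t) ∧
      s' = (m.mill.ax a (k + (t+1)))⁻¹ * m.mill.ax a' (i + (t+1)) ∧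
      lt a.2 (k + t) * s' = s * lt a'.2 (i + t) := by
    intro t h0 h1
    refine ⟨_, h t h0 (by omega), _, h (t + 1) (by omega) (by omega), rfl, rfl, ?_⟩
    rw [← add_assoc, ax_succ, ← add_assoc, ax_succ]
    group
  obtain ⟨s0, hs0, s1, hs1, e0, e1, q0⟩ := hs 0 le_rfl (by norm_num)
  obtain ⟨s1', hs1', s2, hs2, e1', e2, q1⟩ := hs 1 (by norm_num) (by norm_num)
  obtain ⟨s2', hs2', s3, hs3, e2', e3, q2⟩ := hs 2 (by norm_num) (by norm_num)
  have hbk : side a.2 k = a.2.1.1 := by unfold side; rw [if_neg (by omega)]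
  have hm := lt_mem a.2 k
  have hm' := lt_mem a'.2 i
  simp only [add_zero] at q0 e0
  have hsd : lt a'.2 i ∈ m.A a.2.1.1 := by
    have e : lt a'.2 i = s0⁻¹ * (lt a.2 k * s1) := by rw [q0]; group
    rw [e, ← hbk]
    exact Subgroup.mul_mem _ (m.le _ (m.S.inv_mem hs0)) (Subgroup.mul_mem _ hm.1 (m.le _ hs1))
  have hsd2 : side a'.2 i = a.2.1.1 := by
    by_contra hne
    have : a.2.1.1 = !(side a'.2 i) := by
      revert hne; cases a.2.1.1 <;> cases side a'.2 i <;> simp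
    rw [this] at hsd
    exact hm'.2 (Amal.inter' hm'.1 hsd)
  by_cases hb : a'.2.1.1 = a.2.1.1
  · have hi : i % 2 = 1 := by
      by_contra hi
      unfold side at hsd2
      rw [if_pos (by omega), hb] at hsd2
      simp at hsd2
    rw [lt_odd _ _ hk, lt_odd _ _ hi, hb] at q0
    rw [lt_odd _ _ (by omega : (k + 2) % 2 = 1), lt_odd _ _ (by omega : (i + 2) % 2 = 1), hb] at q2
    have hki : k % 36 = i % 36 := by
      by_contra hne
      refine (m.dc _ (ne a.2) (k % 36 / 2).toNat (by omega) (i % 36 / 2).toNat (by omega) (by omega)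
        s0 hs0 s1⁻¹ (m.S.inv_mem hs1)).1 ?_
      rw [← q0]; group
    have g0 : s0 = 1 := by
      refine m.good _ (ne a.2) (k % 36 / 2).toNat (by omega) s0 hs0 ?_
      rw [mul_assoc, hki, ← q0, hki]
      simpa using hs1
    have g2 : s2' = 1 := by
      refine m.good _ (ne a.2) ((k + 2) % 36 / 2).toNat (by omega) s2' hs2' ?_
      have : (k + 2) % 36 = (i + 2) % 36 := by omega
      rw [mul_assoc, this, ← q2, this]
      simpa using hs3
    have g1 : s1 = 1 := by
      rw [g0, one_mul, hki] at q0
      simpa using q0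
    have g1' : s1' = 1 := by rw [e1', ← g1, e1]; norm_num
    have g2' : s2 = 1 := by rw [e2, ← g2, e2']; norm_num
    rw [g1', g2', mul_one, one_mul, lt_even _ _ (by omega), lt_even _ _ (by omega)] at q1
    have hj : a.2 = a'.2 := Subtype.ext (Prod.ext hb.symm q1)
    have hax : m.mill.ax a k = m.mill.ax a' i := by
      rw [g0] at e0
      exact inv_mul_eq_one.1 e0.symm
    obtain ⟨g, j⟩ := a
    obtain ⟨g', j'⟩ := a'
    simp only at hj
    subst hj
    unfold Mill.ax Mill.rr mill at *
    simp only at hax ⊢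
    have := hh_per' j k i hki
    rw [← this, ← mul_assoc] at hax
    have := mul_right_cancel hax
    rw [← this]
    have hc : Commute (Pi j 36) (Pi j 36 ^ (k / 36 - i / 36)) := Commute.self_zpow _ _
    rw [mul_inv_rev]
    simp only [mul_assoc]
    rw [← mul_assoc (Pi j 36) ((Pi j 36 ^ (k / 36 - i / 36))⁻¹), hc.inv_right.eq]
    rw [mul_assoc _ (Pi j 36) g⁻¹, mul_inv_cancel_left]
  · exfalso
    have hi : i % 2 = 0 := by
      by_contra hi
      unfold side at hsd2
      rw [if_neg hi] at hsd2
      exact hb hsd2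
    rw [lt_odd _ _ hk, lt_even _ _ hi] at q0
    rw [lt_odd _ _ (by omega : (k + 2) % 2 = 1), lt_even _ _ (by omega : (i + 2) % 2 = 0)] at q2
    refine (m.dc _ (ne a.2) (k % 36 / 2).toNat (by omega) ((k + 2) % 36 / 2).toNat (by omega) (by omega)
        (s0 * s2'⁻¹) (m.S.mul_mem hs0 (m.S.inv_mem hs2')) (s3 * s1⁻¹) (m.S.mul_mem hs3 (m.S.inv_mem hs1))).1 ?_
    rw [eq_mul_inv_of_mul_eq q0, eq_mul_inv_of_mul_eq q2]
    group

theorem bwd0 {a a' : T × m.J} {k i : ℤ} (hk : k % 2 = 1)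
    (h : ∀ t : ℤ, 0 ≤ t → t ≤ 3 → m.co (m.mill.ax a (k + t)) (m.mill.ax a' (i - t))) :
    False := by
  have hs : ∀ t : ℤ, 0 ≤ t → t ≤ 2 → ∃ s ∈ m.S, ∃ s' ∈ m.S,
      lt a.2 (k + t) * s' = s * (lt a'.2 (i - t - 1))⁻¹ := by
    intro t h0 h1
    refine ⟨_, h t h0 (by omega), _, h (t + 1) (by omega) (by omega), ?_⟩
    have := ax_succ a' (i - t - 1)
    rw [sub_add_cancel] at this
    rw [← add_assoc, ax_succ, this, show i - (t + 1) = i - t - 1 by ring]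
    group
  obtain ⟨s0, hs0, s1, hs1, q0⟩ := hs 0 le_rfl (by norm_num)
  obtain ⟨s2, hs2, s3, hs3, q2⟩ := hs 2 (by norm_num) (by norm_num)
  have hbk : side a.2 k = a.2.1.1 := by unfold side; rw [if_neg (by omega)]
  have hm := lt_mem a.2 k
  have hm' := lt_mem a'.2 (i - 1)
  simp only [add_zero, sub_zero] at q0
  have hsd : lt a'.2 (i - 1) ∈ m.A a.2.1.1 := by
    have e : lt a'.2 (i - 1) = (s0⁻¹ * (lt a.2 k * s1))⁻¹ := by rw [q0]; group
    rw [e, ← hbk]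
    exact Subgroup.inv_mem _ (Subgroup.mul_mem _ (m.le _ (m.S.inv_mem hs0))
      (Subgroup.mul_mem _ hm.1 (m.le _ hs1)))
  have hsd2 : side a'.2 (i - 1) = a.2.1.1 := by
    by_contra hne
    have : a.2.1.1 = !(side a'.2 (i - 1)) := by
      revert hne; cases a.2.1.1 <;> cases side a'.2 (i - 1) <;> simp
    rw [this] at hsd
    exact hm'.2 (Amal.inter' hm'.1 hsd)
  by_cases hb : a'.2.1.1 = a.2.1.1
  · have hi : (i - 1) % 2 = 1 := by
      by_contra hi
      unfold side at hsd2
      rw [if_pos (by omega), hb] at hsd2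
      simp at hsd2
    rw [lt_odd _ _ hk, lt_odd _ _ hi, hb] at q0
    rw [lt_odd _ _ (by omega : (k + 2) % 2 = 1), lt_odd _ _ (by omega : (i - 2 - 1) % 2 = 1), hb] at q2
    have h1 : (k % 36 / 2).toNat = ((i - 1) % 36 / 2).toNat := by
      by_contra hne
      refine (m.dc _ (ne a.2) (k % 36 / 2).toNat (by omega) ((i - 1) % 36 / 2).toNat (by omega) hne
        s0 hs0 s1⁻¹ (m.S.inv_mem hs1)).2 ?_
      rw [← q0]; group
    have h2 : ((k + 2) % 36 / 2).toNat = ((i - 2 - 1) % 36 / 2).toNat := by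
      by_contra hne
      refine (m.dc _ (ne a.2) ((k + 2) % 36 / 2).toNat (by omega) ((i - 2 - 1) % 36 / 2).toNat
        (by omega) hne s2 hs2 s3⁻¹ (m.S.inv_mem hs3)).2 ?_
      rw [← q2]; group
    omega
  · have hi : (i - 1) % 2 = 0 := by
      by_contra hi
      unfold side at hsd2
      rw [if_neg hi] at hsd2
      exact hb hsd2
    rw [lt_odd _ _ hk, lt_even _ _ hi] at q0
    rw [lt_odd _ _ (by omega : (k + 2) % 2 = 1), lt_even _ _ (by omega : (i - 2 - 1) % 2 = 0)] at q2
    refine (m.dc _ (ne a.2) (k % 36 / 2).toNat (by omega) ((k + 2) % 36 / 2).toNat (by omega) (by omega)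
        (s0 * s2⁻¹) (m.S.mul_mem hs0 (m.S.inv_mem hs2)) (s3 * s1⁻¹) (m.S.mul_mem hs3 (m.S.inv_mem hs1))).1 ?_
    rw [eq_mul_inv_of_mul_eq q0, eq_mul_inv_of_mul_eq q2]
    group

theorem fwd {a a' : T × m.J} {k i : ℤ}
    (h : ∀ t : ℤ, 0 ≤ t → t ≤ 4 → m.co (m.mill.ax a (k + t)) (m.mill.ax a' (i + t))) :
    m.mill.rr a = m.mill.rr a' := by
  by_cases hk : k % 2 = 1
  · exact fwd0 hk fun t h0 h1 => h t h0 (by omega)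
  · refine fwd0 (k := k + 1) (i := i + 1) (by omega) fun t h0 h1 => ?_
    have := h (1 + t) (by omega) (by omega)
    rwa [← add_assoc, ← add_assoc] at this

theorem bwd {a a' : T × m.J} {k i : ℤ}
    (h : ∀ t : ℤ, 0 ≤ t → t ≤ 4 → m.co (m.mill.ax a (k + t)) (m.mill.ax a' (i - t))) : False := by
  by_cases hk : k % 2 = 1
  · exact bwd0 hk fun t h0 h1 => h t h0 (by omega)
  · refine bwd0 (a := a) (a' := a') (k := k + 1) (i := i - 1) (by omega) fun t h0 h1 => ?_
    have := h (1 + t) (by omega) (by omega)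
    rwa [← add_assoc, ← sub_sub] at this

end SC
namespace TreeD
variable {V : Type*} {M : TreeD V}

theorem same_point {u v a b : V} (h1 : M.d u a + M.d a v = M.d u v) (h2 : M.d u b + M.d b v = M.d u v)
    (h : M.d u a = M.d u b) : M.d a b = 0 := by
  have := M.fp a b u v
  rw [M.symm a u, M.symm b u] at this
  have := M.nonneg a b
  omega

theorem IsLine.between {a : ℤ → V} (ha : M.IsLine a) {u v : V} {k : ℤ}
    (hne : M.pr a u ≠ M.pr a v)
    (h : (M.pr a u ≤ 2 * k ∧ 2 * k ≤ M.pr a v) ∨ (M.pr a v ≤ 2 * k ∧ 2 * k ≤ M.pr a u)) :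
    M.d u (a k) + M.d (a k) v = M.d u v := by
  rw [ha.dist_eq u v hne, M.symm (a k) v, ha.formula, ha.formula]
  grind

theorem IsLine.parity {a : ℤ → V} (ha : M.IsLine a) (u : V) : ∃ c, M.off a u + M.pr a u = 2 * c := by
  obtain ⟨k, hk⟩ := M.even u (a (|M.pr a u|))
  rw [ha.formula] at hk
  refine ⟨k - |M.pr a u| + M.pr a u, ?_⟩
  grind

end TreeD
namespace SC
variable {T : Type*} [Group T] {m : SC T}

theorem ov : m.mill.OV := by
  suffices H : ∀ a a' n n', m.mill.p a (m.mill.ax a' n) + 8 < m.mill.p a (m.mill.ax a' n') →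
      m.mill.rr a = m.mill.rr a' by
    intro a a' hne n n'
    by_contra h
    rw [abs_le] at h
    by_cases h1 : m.mill.p a (m.mill.ax a' n) + 8 < m.mill.p a (m.mill.ax a' n')
    · exact hne (H _ _ _ _ h1)
    · exact hne (H a a' n' n (by omega))
  intro a a' n n' hlt
  set u := m.mill.ax a' n with hu
  set v := m.mill.ax a' n' with hv
  have hL := m.mill.line a
  have hL' := m.mill.line a'
  have hduv : m.mill.M.d u v = 2 * |n - n'| := hL' n n'
  obtain ⟨c, hc⟩ := hL.parity u
  have hlt' : m.mill.M.pr (m.mill.ax a) u + 8 < m.mill.M.pr (m.mill.ax a) v := hlt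
  have hoff := hL.off_nonneg u
  have hoff' := hL.off_nonneg v
  have hdd := hL.dist_eq u v (by omega)
  set P := m.mill.M.pr (m.mill.ax a) u
  set P' := m.mill.M.pr (m.mill.ax a) v
  set O := m.mill.M.off (m.mill.ax a) u
  set O' := m.mill.M.off (m.mill.ax a) v
  obtain ⟨k0, hk1, hk2⟩ : ∃ k0, P ≤ 2 * k0 ∧ 2 * (k0 + 4) ≤ P' := ⟨(P + 1) / 2, by omega, by omega⟩
  have key : ∀ t : ℤ, 0 ≤ t → t ≤ 4 → ∀ i, |n - i| = (O + 2 * (k0 + t) - P) / 2 → |n - i| + |i - n'| = |n - n'| →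
      m.co (m.mill.ax a (k0 + t)) (m.mill.ax a' i) := by
    intro t h0 h1 i hi hi2
    rw [co_iff]
    refine TreeD.same_point (u := u) (v := v) (hL.between (by omega) (Or.inl ⟨by omega, by omega⟩)) ?_ ?_
    · rw [hu, hv, hL', hL', hL']; omega
    · have f1 : m.mill.M.d u (m.mill.ax a (k0 + t)) = O + |2 * (k0 + t) - P| := hL.formula u _
      have f2 : m.mill.M.d u (m.mill.ax a' i) = 2 * |n - i| := hL' n i
      rw [f1, f2, hi, abs_of_nonneg (by omega)]
      omega
  have hd2 : 2 * |n - n'| = O + (P' - P) + O' := by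
    rw [← hduv, hdd, abs_of_nonpos (by omega)]; ring
  rcases le_total n n' with hnn | hnn
  · apply fwd (k := k0) (i := n + (O + 2 * k0 - P) / 2)
    intro t h0 h1
    rw [abs_of_nonpos (by omega)] at hd2
    apply key t h0 h1
    · rw [abs_of_nonpos (by omega)]; omega
    · rw [abs_of_nonpos (by omega), abs_of_nonpos (by omega), abs_of_nonpos (by omega)]; omega
  · exfalso
    apply bwd (a := a) (a' := a') (k := k0) (i := n - (O + 2 * k0 - P) / 2)
    intro t h0 h1
    rw [abs_of_nonneg (by omega)] at hd2
    apply key t h0 h1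
    · rw [abs_of_nonneg (by omega)]; omega
    · rw [abs_of_nonneg (by omega), abs_of_nonneg (by omega), abs_of_nonneg (by omega)]; omega

variable (m) in
def NN : Subgroup T := Subgroup.normalClosure (Set.range m.mill.R)

instance : (NN m).Normal := Subgroup.normalClosure_normal

theorem gr (b : Bool) : ∀ g ∈ NN m, g ≠ 1 →
    ∃ a, ∀ x ∈ m.A b, ∀ x' ∈ m.A b, 48 ≤ |m.mill.p a x - m.mill.p a (g * x')| := by
  apply Mill.windmill (K0 := (m.A b : Set T)) ov ⟨1, (m.A b).one_mem⟩
  intro a w hw w' hw'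
  have h1 := (m.mill.line a).pr_lip w w'
  have h2 := Amal.len_le_one ((m.A b).mul_mem ((m.A b).inv_mem hw) hw')
  have h3 : m.mill.M.d w w' = 2 * m.len (w⁻¹ * w') := rfl
  change |m.mill.p a _ - m.mill.p a _| ≤ _ at h1
  omega

theorem short {g : T} (hg : g ∈ NN m) (hl : m.len g < 24) : g = 1 := by
  by_contra h1
  obtain ⟨a, ha⟩ := gr true g hg h1
  have h2 := ha 1 (Subgroup.one_mem _) 1 (Subgroup.one_mem _)
  have h1 := (m.mill.line a).pr_lip 1 (g * 1)
  have h3 : m.mill.M.d 1 (g * 1) = 2 * m.len (1⁻¹ * (g * 1)) := rfl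
  simp only [inv_one, one_mul, mul_one] at h3 h2 h1
  change |m.mill.p a _ - m.mill.p a _| ≤ _ at h1
  omega

end SC
end ShelahFormalization

namespace ShelahFormalization
namespace SC
variable {T : Type*} [Group T] {m : SC T}

theorem rr_mem (a : T × m.J) : m.mill.rr a ∈ NN m :=
  Subgroup.normalClosure_normal.conj_mem _ (Subgroup.subset_normalClosure (Set.mem_range_self _)) _

theorem len_S_left {s g : T} (hs : s ∈ m.S) : m.len (s * g) = m.len g := by
  obtain ⟨b, h⟩ := m.len_spec g
  exact Amal.len_eq (Amal.smul_rw h hs)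

theorem shift_le {a : T × m.J} {u q : T} (h : ∀ e : ℤ, m.tree.d u q ≤ m.tree.d u (m.mill.rr a ^ e * q)) :
    |m.mill.p a q - m.mill.p a u| ≤ 36 := by
  by_contra hlt
  have hL := m.mill.line a
  obtain ⟨e, he⟩ : ∃ e : ℤ, |m.mill.p a u - (m.mill.p a q + 72 * e)| < |m.mill.p a u - m.mill.p a q| := by
    rcases lt_or_gt_of_ne (show m.mill.p a q ≠ m.mill.p a u by intro h; simp [h] at hlt) with h1 | h1
    · refine ⟨1, ?_⟩
      grind
    · refine ⟨-1, ?_⟩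
      grind
  have h1 := hL.dist_eq u q (by intro h; apply hlt; change |m.mill.M.pr _ _ - m.mill.M.pr _ _| ≤ _; simp [h])
  have h2 := hL.dist_le u (m.mill.rr a ^ e * q)
  have h3 := m.mill.rr_shift_zpow a e q
  have h4 := h e
  rw [h3.2] at h2
  change m.mill.M.d _ _ ≤ _ + |m.mill.p a _ - m.mill.p a _| + _ at h2
  change m.mill.M.d _ _ = _ + |m.mill.p a _ - m.mill.p a _| + _ at h1
  change m.mill.M.d _ _ ≤ m.mill.M.d _ _ at h4
  rw [h3.1] at h2
  omega

theorem off_lip {a : T × m.J} {u v : T} :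
    |m.mill.p a u - m.mill.p a v| + |m.mill.M.off (m.mill.ax a) u - m.mill.M.off (m.mill.ax a) v|
      ≤ m.mill.M.d u v := by
  have hL := m.mill.line a
  by_cases h : m.mill.p a u = m.mill.p a v
  · have h' : m.mill.M.pr (m.mill.ax a) u = m.mill.M.pr (m.mill.ax a) v := h
    have h1 := hL.formula u 0
    have h2 := hL.formula v 0
    have h3 := m.mill.M.tri u v (m.mill.ax a 0)
    have h4 := m.mill.M.tri v u (m.mill.ax a 0)
    rw [m.mill.M.symm v u] at h4
    rw [h'] at h1
    rw [h, sub_self, abs_zero, zero_add, abs_le]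
    constructor <;> omega
  · have := hL.dist_eq u v h
    have h1 := hL.off_nonneg u
    have h2 := hL.off_nonneg v
    change m.mill.M.d _ _ = _ + |m.mill.p a _ - m.mill.p a _| + _ at this
    rw [this]
    have : |m.mill.M.off (m.mill.ax a) u - m.mill.M.off (m.mill.ax a) v| ≤
      m.mill.M.off (m.mill.ax a) u + m.mill.M.off (m.mill.ax a) v := by rw [abs_le]; omega
    omega

/-- the core of the malnormality argument -/
theorem maln_core (b : Bool) (hmal : ∀ x ∈ m.A (!b), x ∉ m.S → ∀ s ∈ m.S, x⁻¹ * s * x ∈ m.S → s = 1)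
    {q k k' n : T} (hk : k ∈ m.A b) (hk' : k' ∈ m.A b) (hq : q ∉ m.A b)
    (hmin : ∀ c ∈ m.A b, ∀ c' ∈ m.A b, ∀ ν ∈ NN m, m.len q ≤ m.len (c * ν * q * c'))
    (hn : n ∈ NN m) (h : k * q = n * q * k') : k = 1 := by
  have hqS : q ∉ m.S := fun h => hq (m.le b h)
  obtain ⟨b0, hb0⟩ := m.len_spec q
  obtain ⟨N, hN⟩ : ∃ N, m.len q = N + 1 :=
    Nat.exists_eq_succ_of_ne_zero (fun h => hqS (Amal.len_zero.1 h))
  rw [hN] at hb0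
  have hb : b0 = !b := by
    by_contra hne
    have : b0 = b := by revert hne; cases b <;> cases b0 <;> simp
    subst this
    obtain ⟨x, hx, hxS, hr⟩ := Amal.head hb0
    have h1 := hmin x⁻¹ (Subgroup.inv_mem _ hx) 1 (Subgroup.one_mem _) 1 (Subgroup.one_mem _)
    rw [mul_one, mul_one, Amal.len_eq hr, hN] at h1
    omega
  subst hb
  by_cases hn1 : n = 1
  · subst hn1
    rw [one_mul] at h
    have hk2 : q⁻¹ * (k * q) = k' := by rw [h]; group
    have hlen : m.len (q⁻¹ * (k * q)) ≤ 1 := by rw [hk2]; exact Amal.len_le_one hk'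
    by_cases hkS : k ∈ m.S
    · cases N with
      | zero =>
        obtain ⟨x, hx, hxS, hr⟩ := Amal.head hb0
        rw [Amal.rw_zero] at hr
        have hqA : q ∈ m.A (!b) := by simpa using Subgroup.mul_mem _ hx (m.le _ hr)
        refine hmal q hqA hqS k hkS (Amal.inter' (b := b) ?_ ?_)
        · rw [mul_assoc, hk2]; exact hk'
        · exact Subgroup.mul_mem _ (Subgroup.mul_mem _ (Subgroup.inv_mem _ hqA) (m.le _ hkS)) hqA
      | succ N =>
        obtain ⟨x, hx, hxS, hr⟩ := Amal.head hb0
        by_contra hk1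
        have hx2 : x⁻¹ * (k * x) ∉ m.S := fun hh => hk1 (hmal x hx hxS k hkS (by rwa [mul_assoc]))
        have hkx : k * x ∉ m.S := fun hh => hxS (by simpa using m.S.mul_mem (m.S.inv_mem hkS) hh)
        have hr' : m.Rw (!!b) (N + 1) ((k * x)⁻¹ * (k * q)) := by
          rwa [show (k * x)⁻¹ * (k * q) = x⁻¹ * q by group]
        have h1 := Amal.gp_one hx hxS (Subgroup.mul_mem _ (m.le _ hkS) hx) hkx hr hr' hx2
        unfold Amal.gp at h1
        rw [len_S_left hkS, hN] at h1
        push_cast at h1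
        omega
    · exfalso
      have h1 : m.Rw (!!b) (N + 1 + 1) (k * q) := by
        rw [Bool.not_not]; exact .cons _ _ _ _ hk hkS hb0
      obtain ⟨e, he⟩ := Amal.diff hb0 h1
      have := Amal.len_eq he
      omega
  · exfalso
    obtain ⟨a, ha⟩ := gr b n⁻¹ (Subgroup.inv_mem _ hn) (by simpa using hn1)
    have h48 := ha 1 (Subgroup.one_mem _) k hk
    set γ := n⁻¹ * k with hγ
    have hγq : γ * q = q * k' := by rw [hγ, mul_assoc, h]; group
    have m1 : |m.mill.p a q - m.mill.p a 1| ≤ 36 := by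
      apply shift_le
      intro e
      rw [Amal.tree_d, Amal.tree_d]
      have := hmin 1 (Subgroup.one_mem _) 1 (Subgroup.one_mem _) _ (Subgroup.zpow_mem _ (rr_mem a) e)
      simp only [one_mul, mul_one, inv_one] at this ⊢
      omega
    have m2 : |m.mill.p a (q * k') - m.mill.p a γ| ≤ 36 := by
      apply shift_le
      intro e
      have e1 := Amal.tree_inv (m := m.toAmal) γ 1 q
      rw [mul_one, hγq] at e1
      rw [e1, Amal.tree_d, Amal.tree_d]
      have := hmin k⁻¹ (Subgroup.inv_mem _ hk) k' hk' _
        (Subgroup.mul_mem _ hn (Subgroup.zpow_mem _ (rr_mem a) e))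
      rw [show γ⁻¹ * (m.mill.rr a ^ e * (q * k')) = k⁻¹ * (n * m.mill.rr a ^ e) * q * k' by rw [hγ]; group]
      simp only [one_mul, inv_one]
      omega
    have m3 := off_lip (a := a) (u := q) (v := q * k')
    have m4 : m.mill.M.d q (q * k') ≤ 2 := by
      change m.tree.d _ _ ≤ _
      rw [Amal.tree_d, inv_mul_cancel_left]
      have := Amal.len_le_one hk'
      omega
    set a' := Mill.sm γ a with ha'
    have hL := m.mill.line a
    have hL' := m.mill.line a'
    have p1 : m.mill.M.pr (m.mill.ax a') γ = m.mill.p a 1 := by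
      have := m.mill.p_sm γ a 1
      rwa [mul_one] at this
    have p2 : m.mill.M.pr (m.mill.ax a') (q * k') = m.mill.p a q := by
      have := m.mill.p_sm γ a q
      rwa [hγq] at this
    have p3 : m.mill.M.off (m.mill.ax a') (q * k') = m.mill.M.off (m.mill.ax a) q := by
      have := m.mill.off_sm γ a q
      rwa [hγq] at this
    obtain ⟨c1, par1⟩ := hL.parity q
    obtain ⟨c2, par2⟩ := hL.parity (q * k')
    have f1 := hL.formula (q * k')
    have f2 := hL'.formula (q * k')
    have b1 := fun i => hL.between (u := q * k') (v := γ) (k := i)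
    have b2 := fun i => hL'.between (u := q * k') (v := γ) (k := i)
    rw [p2, p3] at f2
    rw [p1, p2] at b2
    change ∀ i, _ = _ + |_ - m.mill.p a _| at f1
    change ∀ i, m.mill.p a _ ≠ m.mill.p a _ → ((m.mill.p a _ ≤ _ ∧ _ ≤ m.mill.p a _) ∨
      (m.mill.p a _ ≤ _ ∧ _ ≤ m.mill.p a _)) → _ at b1
    change _ + m.mill.p a _ = _ at par1
    change _ + m.mill.p a _ = _ at par2
    set s := m.mill.p a 1
    set t' := m.mill.p a γ
    set x := m.mill.p a q
    set x' := m.mill.p a (q * k')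
    set F := m.mill.M.off (m.mill.ax a) q
    set F' := m.mill.M.off (m.mill.ax a) (q * k')
    obtain ⟨D, hD1, hD2, hD3⟩ : ∃ D, F ≤ 2 * D ∧ F' ≤ 2 * D ∧ (2 * D ≤ F + 1 ∨ 2 * D ≤ F' + 1) :=
      ⟨(max F F' + 1) / 2, by omega, by omega, by omega⟩
    have m34 := m3.trans m4
    clear m3 m4 ha h hmin
    have cosym : ∀ {u v}, m.co u v → m.co v u := by
      intro u v huv
      rw [co_iff] at huv ⊢
      rwa [m.mill.M.symm]
    rcases lt_or_gt_of_ne (show s ≠ t' by intro h; simp [h] at h48) with hst | hst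
    · apply bwd (a := a) (a' := a') (k := (x' + 2 * D - F') / 2) (i := (x - 2 * D + F) / 2)
      intro t h0 h1
      rw [co_iff]
      refine TreeD.same_point (u := q * k') (v := γ) (b1 _ ?_ ?_) (b2 _ ?_ ?_) ?_
      · grind
      · left; constructor <;> grind
      · grind
      · right; constructor <;> grind
      · rw [f1, f2]
        rw [abs_of_nonneg (by omega), abs_of_nonpos (by omega)]
        omega
    · apply bwd (a := a') (a' := a) (k := (x + 2 * D - F) / 2) (i := (x' - 2 * D + F') / 2)
      intro t h0 h1
      rw [co_iff]
      refine TreeD.same_point (u := q * k') (v := γ) (b2 _ ?_ ?_) (b1 _ ?_ ?_) ?_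
      · grind
      · left; constructor <;> grind
      · grind
      · right; constructor <;> grind
      · rw [f1, f2]
        rw [abs_of_nonneg (by omega), abs_of_nonpos (by omega)]
        omega

theorem maln (b : Bool) (hmal : ∀ x ∈ m.A (!b), x ∉ m.S → ∀ s ∈ m.S, x⁻¹ * s * x ∈ m.S → s = 1)
    {q k k' n : T} (hk : k ∈ m.A b) (hk' : k' ∈ m.A b) (hq : ∀ c ∈ m.A b, c⁻¹ * q ∉ NN m)
    (hn : n ∈ NN m) (h : k * q = n * q * k') : k = 1 := by
  classical
  have hex : ∃ L : ℕ, ∃ c ∈ m.A b, ∃ c' ∈ m.A b, ∃ ν ∈ NN m, m.len (c * ν * q * c') = L :=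
    ⟨_, 1, Subgroup.one_mem _, 1, Subgroup.one_mem _, 1, Subgroup.one_mem _, rfl⟩
  obtain ⟨c, hc, c', hc', ν, hν, hL⟩ := Nat.find_spec hex
  have hmin := fun c hc c' hc' ν hν => Nat.find_min' hex ⟨c, hc, c', hc', ν, hν, rfl⟩
  rw [← hL] at hmin
  have := maln_core (m := m) b hmal (q := c * ν * q * c') (k := c * k * c⁻¹) (k' := c'⁻¹ * k' * c')
    (n := c * (k * ν * k⁻¹) * n * ν⁻¹ * c⁻¹) ?_ ?_ ?_ ?_ ?_ ?_
  · have e : k = c⁻¹ * (c * k * c⁻¹) * c := by group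
    rw [e, this]; group
  · exact Subgroup.mul_mem _ (Subgroup.mul_mem _ hc hk) (Subgroup.inv_mem _ hc)
  · exact Subgroup.mul_mem _ (Subgroup.mul_mem _ (Subgroup.inv_mem _ hc') hk') hc'
  · intro hA
    have h1 : c⁻¹ * (c * ν * q * c') * c'⁻¹ ∈ m.A b :=
      Subgroup.mul_mem _ (Subgroup.mul_mem _ (Subgroup.inv_mem _ hc) hA) (Subgroup.inv_mem _ hc')
    apply hq _ h1
    have e : (c⁻¹ * (c * ν * q * c') * c'⁻¹)⁻¹ * q = q⁻¹ * ν⁻¹ * q⁻¹⁻¹ := by group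
    rw [e]
    exact Subgroup.Normal.conj_mem inferInstance _ (Subgroup.inv_mem _ hν) _
  · intro d hd d' hd' μ hμ
    have := hmin (d * c) (Subgroup.mul_mem _ hd hc) (c' * d') (Subgroup.mul_mem _ hc' hd')
      (c⁻¹ * μ * c⁻¹⁻¹ * ν) (Subgroup.mul_mem _ (Subgroup.Normal.conj_mem inferInstance _ hμ _) hν)
    convert this using 2
    group
  · have e : c * (k * ν * k⁻¹) * n * ν⁻¹ * c⁻¹ = c * ((k * ν * k⁻¹) * n * ν⁻¹) * c⁻¹ := by group
    rw [e]
    refine Subgroup.Normal.conj_mem inferInstance _ ?_ _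
    exact Subgroup.mul_mem _ (Subgroup.mul_mem _ (Subgroup.Normal.conj_mem inferInstance _ hν _) hn)
      (Subgroup.inv_mem _ hν)
  · have e : n * q = k * q * k'⁻¹ := by rw [h]; group
    have e1 : c * (k * ν * k⁻¹) * n * ν⁻¹ * c⁻¹ * (c * ν * q * c') * (c'⁻¹ * k' * c')
      = c * (k * ν * k⁻¹) * (n * q) * k' * c' := by group
    rw [e1, e]; group

end SC
end ShelahFormalization

namespace ShelahFormalization
open Monoid

section bridge
variable {S : Type*} [Group S] {G : Bool → Type*} [∀ b, Group (G b)] (φ : ∀ b, S →* G b)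

theorem rw_word (b : Bool) (n : ℕ) (g : PushoutI φ)
    (h : RW (fun b => (PushoutI.of (φ := φ) b).range) (PushoutI.base φ).range b n g) :
    ∃ w : CoprodI.Word G, PushoutI.Reduced φ w ∧ (∃ s ∈ (PushoutI.base φ).range,
      g = PushoutI.ofCoprodI w.prod * s) ∧ w.toList.length = n ∧ w.fstIdx ≠ some (!b) := by
  induction h with
  | nil b s h =>
    exact ⟨.empty, by intro g hg; simp [CoprodI.Word.empty] at hg, ⟨s, h, by simp⟩, by simp [CoprodI.Word.empty],
      by simp [CoprodI.Word.empty, CoprodI.Word.fstIdx]⟩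
  | cons b n x g hx hxS hg ih =>
    obtain ⟨w, hw, ⟨s, hs, rfl⟩, hl, hf⟩ := ih
    obtain ⟨y, rfl⟩ := hx
    have hy : y ∉ (φ b).range := by
      rintro ⟨t, rfl⟩
      exact hxS ⟨t, (PushoutI.of_apply_eq_base φ b t).symm⟩
    have hy1 : y ≠ 1 := by
      rintro rfl; exact hy (one_mem _)
    rw [Bool.not_not] at hf
    refine ⟨CoprodI.Word.cons y w hf hy1, ?_, ⟨s, hs, ?_⟩, ?_, ?_⟩
    · intro g hg
      simp only [CoprodI.Word.cons, List.mem_cons] at hg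
      rcases hg with rfl | hg
      · exact hy
      · exact hw g hg
    · simp [mul_assoc]
    · simp [CoprodI.Word.cons, hl]
    · simp

noncomputable def amalOf (hφ : ∀ b, Function.Injective (φ b)) : Amal (PushoutI φ) where
  A b := (PushoutI.of b).range
  S := (PushoutI.base φ).range
  le b := by
    rintro _ ⟨s, rfl⟩
    exact ⟨φ b s, PushoutI.of_apply_eq_base φ b s⟩
  gen := by
    rw [eq_top_iff]
    rintro x -
    induction x using PushoutI.induction_on with
    | of i g =>
      apply Subgroup.subset_closure
      cases i
      · right; exact ⟨g, rfl⟩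
      · left; exact ⟨g, rfl⟩
    | base h =>
      apply Subgroup.subset_closure
      left; exact ⟨φ true h, PushoutI.of_apply_eq_base φ true h⟩
    | mul x y hx hy => exact mul_mem hx hy
  nf b n g h hg := by
    obtain ⟨w, hw, ⟨s, hs, rfl⟩, hl, -⟩ := rw_word φ b _ g h
    have := hw.eq_empty_of_mem_range hφ ((Subgroup.mul_mem_cancel_right _ hs).1 hg)
    subst this
    simp [CoprodI.Word.empty] at hl

end bridge

theorem Amal.len_mul_le {T : Type*} [Group T] {m : Amal T} (u v : T) : m.len (u * v) ≤ m.len u + m.len v := by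
  have := m.gp_nonneg _ u⁻¹ v rfl
  rw [Amal.gp, Amal.len_inv] at this
  simp at this; omega

theorem Amal.conj_b {T : Type*} [Group T] {m : Amal T} {k p k' p' : T} (hk : k ∈ m.A true) (hk' : k' ∈ m.A true)
    (hp : p ∈ m.A false) (hp' : p' ∈ m.A false) (h : k * p * k' = p') (hpS : p ∉ m.S) : k ∈ m.S ∧ k' ∈ m.S := by
  have hl := Amal.len_le_one hp'
  rw [← h] at hl
  by_cases h1 : k ∈ m.S
  · refine ⟨h1, ?_⟩
    by_contra h2
    have h3 : m.Rw false 2 (k * (p * k')) := Amal.smul_rw (RW.cons false 1 p k' hp hpS (Amal.single hk' h2)) h1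
    rw [← mul_assoc] at h3
    have := Amal.len_eq h3; omega
  · exfalso
    by_cases h2 : k' ∈ m.S
    · have h3 : m.Rw true 2 (k * (p * k')) := RW.cons true 1 k _ hk h1
        (Amal.single (b := false) (mul_mem hp (m.le _ h2)) (fun h => hpS ((Subgroup.mul_mem_cancel_right _ h2).1 h)))
      rw [← mul_assoc] at h3
      have := Amal.len_eq h3; omega
    · have h3 : m.Rw true 3 (k * (p * k')) := RW.cons true 2 k _ hk h1
        (RW.cons false 1 p k' hp hpS (Amal.single hk' h2))
      rw [← mul_assoc] at h3
      have := Amal.len_eq h3; omega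

theorem Amal.conj_c {T : Type*} [Group T] {m : Amal T} {a p p' : T} (ha : a ∈ m.A true) (haS : a ∉ m.S)
    (hp : p ∈ m.A false) (hp' : p' ∈ m.A false) (h : p * a = a * p') : p ∈ m.S ∧ p' ∈ m.S := by
  have h1 : p ∈ m.S := by
    by_contra h1
    have h3 : m.Rw false 2 (p * a) := RW.cons false 1 p a hp h1 (Amal.single ha haS)
    by_cases h2 : p' ∈ m.S
    · have := Amal.len_eq h3
      have := Amal.len_le_one (mul_mem ha (m.le true h2))
      rw [h] at *; omega
    · have h4 : m.Rw true 2 (a * p') := RW.cons true 1 a p' ha haS (Amal.single hp' h2)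
      rw [h] at h3
      exact absurd (Amal.side_unique h3 h4) (by decide)
  refine ⟨h1, Amal.inter ?_ hp'⟩
  have : p' = a⁻¹ * p * a := by rw [mul_assoc, h]; group
  rw [this]
  exact mul_mem (mul_mem (inv_mem ha) (m.le _ h1)) ha

theorem smallCanc {S : Type*} [Group S] {G : Bool → Type*} [∀ b, Group (G b)] (φ : ∀ b, S →* G b)
    (hφ : ∀ b, Function.Injective (φ b)) (l : ∀ b, ℕ → G b) (E : ∀ b, Set (G (!b)))
    (hE : ∀ b, ∀ e ∈ E b, e ∉ (φ (!b)).range)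
    (hl : ∀ b, (E b).Nonempty → ∀ i < 18, l b i ∉ (φ b).range)
    (good : ∀ b, (E b).Nonempty → ∀ i < 18, ∀ s s', (l b i)⁻¹ * φ b s * l b i = φ b s' → s = 1)
    (dc : ∀ b, (E b).Nonempty → ∀ i < 18, ∀ j < 18, i ≠ j → ∀ s s',
      l b i ≠ φ b s * l b j * φ b s' ∧ l b i ≠ φ b s * (l b j)⁻¹ * φ b s')
    (hmal : ∀ x : G false, x ∉ (φ false).range → ∀ s s', x⁻¹ * φ false s * x = φ false s' → s = 1) :
    ∃ (N : Subgroup (PushoutI φ)) (_ : N.Normal) (f : ∀ b, G b →* (PushoutI φ ⧸ N)),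
      (∀ b, Function.Injective (f b)) ∧ (∀ s, f true (φ true s) = f false (φ false s)) ∧
      Subgroup.closure ((f true).range ∪ (f false).range : Set (PushoutI φ ⧸ N)) = ⊤ ∧
      (∀ b, ∀ e ∈ E b, ((List.range 18).map fun i => f (!b) e * f b (l b i)).prod = 1) ∧
      (∀ k p, f true k = f false p → ∃ s, k = φ true s ∧ p = φ false s) ∧
      (∀ k p k' p', f true k * f false p * f true k' = f false p' → p ∉ (φ false).range →
        k ∈ (φ true).range ∧ k' ∈ (φ true).range) ∧
      (∀ p a p', f false p * f true a = f true a * f false p' → a ∉ (φ true).range →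
        p ∈ (φ false).range ∧ p' ∈ (φ false).range) ∧
      (∀ q, q ∉ (f true).range → ∀ k k', f true k * q = q * f true k' → k = 1) ∧
      ((∀ b, E b = ∅) → N = ⊥) ∧ (∀ b x, f b x = ((PushoutI.of b x : PushoutI φ) : PushoutI φ ⧸ N)) := by
  classical
  have ofinj : ∀ b, Function.Injective (PushoutI.of (φ := φ) b) := fun b => PushoutI.of_injective hφ b
  have hS : ∀ b (x : G b), PushoutI.of (φ := φ) b x ∈ (PushoutI.base φ).range ↔ x ∈ (φ b).range := by
    intro b x
    constructor
    · rintro ⟨s, hs⟩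
      rw [← PushoutI.of_apply_eq_base φ b s] at hs
      exact ⟨s, ofinj b hs⟩
    · rintro ⟨s, rfl⟩
      exact ⟨s, (PushoutI.of_apply_eq_base φ b s).symm⟩
  let m : SC (PushoutI φ) :=
    { amalOf φ hφ with
      l := fun b i => PushoutI.of b (l b i)
      E := fun b => PushoutI.of (!b) '' E b
      hE := by
        rintro b _ ⟨e, he, rfl⟩
        exact ⟨⟨e, rfl⟩, fun h => hE b e he ((hS _ _).1 h)⟩
      hl := by
        intro b hne i hi
        exact ⟨⟨_, rfl⟩, fun h => hl b (by simpa using hne) i hi ((hS _ _).1 h)⟩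
      good := by
        rintro b hne i hi _ ⟨s, rfl⟩ ⟨s', hs'⟩
        rw [← PushoutI.of_apply_eq_base φ b s, ← PushoutI.of_apply_eq_base φ b s', ← map_inv, ← map_mul,
          ← map_mul] at hs'
        rw [good b (by simpa using hne) i hi s s' (ofinj b hs'.symm), map_one]
      dc := by
        rintro b hne i hi j hj hij _ ⟨s, rfl⟩ _ ⟨s', rfl⟩
        rw [← PushoutI.of_apply_eq_base φ b s, ← PushoutI.of_apply_eq_base φ b s', ← map_inv, ← map_mul,
          ← map_mul, ← map_mul, ← map_mul]
        have := dc b (by simpa using hne) i hi j hj hij s s'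
        exact ⟨fun h => this.1 (ofinj b h), fun h => this.2 (ofinj b h)⟩ }
  have mA : ∀ b (x : G b), PushoutI.of (φ := φ) b x ∈ m.A b := fun b x => ⟨x, rfl⟩
  have mS : ∀ b (x : G b), PushoutI.of (φ := φ) b x ∈ m.S ↔ x ∈ (φ b).range := hS
  have L1 : ∀ b (x : G b), m.len (PushoutI.of (φ := φ) b x) ≤ 1 := fun b x => Amal.len_le_one (mA b x)
  let π := QuotientGroup.mk' (SC.NN m)
  have key : ∀ u v : PushoutI φ, π u = π v → m.len u + m.len v < 24 → u = v := by
    intro u v h hlen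
    have h1 : u⁻¹ * v ∈ SC.NN m := QuotientGroup.eq.1 h
    have h2 := SC.short h1 (by
      have := Amal.len_mul_le (m := m.toAmal) u⁻¹ v
      rw [Amal.len_inv] at this; omega)
    exact (inv_mul_eq_one.1 h2)
  have L2 : ∀ u v, m.len (u * v) ≤ m.len u + m.len v := Amal.len_mul_le
  refine ⟨SC.NN m, inferInstance, fun b => π.comp (PushoutI.of b), ?_, ?_, ?_, ?_, ?_, ?_, ?_, ?_, ?_, fun _ _ => rfl⟩
  · intro b x y h
    apply ofinj b
    apply key _ _ h
    have := L1 b x; have := L1 b y; omega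
  · intro s
    simp only [MonoidHom.comp_apply]
    rw [PushoutI.of_apply_eq_base, PushoutI.of_apply_eq_base]
  · have := congrArg (Subgroup.map π) m.gen
    rw [MonoidHom.map_closure, Set.image_union, ← MonoidHom.range_eq_map, MonoidHom.range_eq_top.2 (QuotientGroup.mk'_surjective _)] at this
    rw [← this]
    congr 1
    rw [MonoidHom.range_comp, MonoidHom.range_comp]; rfl
  · intro b e he
    have h1 := SC.Pi_double (m := m) ⟨(b, PushoutI.of (!b) e), ⟨e, he, rfl⟩⟩ 18
    have h2 : π (m.mill.R ⟨(b, PushoutI.of (!b) e), ⟨e, he, rfl⟩⟩) = 1 :=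
      (QuotientGroup.eq_one_iff _).2 (Subgroup.subset_normalClosure ⟨_, rfl⟩)
    have h3 : m.mill.R ⟨(b, PushoutI.of (!b) e), ⟨e, he, rfl⟩⟩ = SC.Pi (m := m) ⟨(b, PushoutI.of (!b) e), ⟨e, he, rfl⟩⟩ (2 * 18) := rfl
    rw [h3, h1, map_list_prod, List.map_map] at h2
    rw [← h2]
    congr 1
  · intro k p h
    have h1 := key _ _ h (by have := L1 true k; have := L1 false p; omega)
    have h2 : PushoutI.of (φ := φ) true k ∈ m.S := Amal.inter (mA true k) (h1 ▸ mA false p)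
    obtain ⟨s, rfl⟩ := (mS _ _).1 h2
    refine ⟨s, rfl, ?_⟩
    apply ofinj false
    rw [← h1, PushoutI.of_apply_eq_base, PushoutI.of_apply_eq_base]
  · intro k p k' p' h hp
    simp only [MonoidHom.comp_apply] at h
    rw [← map_mul, ← map_mul] at h
    have h1 := key _ _ h (by
      have := L1 true k; have := L1 false p; have := L1 true k'; have := L1 false p'
      have := L2 (PushoutI.of true k * PushoutI.of false p) (PushoutI.of true k')
      have := L2 (PushoutI.of true k) (PushoutI.of false p)
      omega)
    have := Amal.conj_b (mA true k) (mA true k') (mA false p) (mA false p') h1 (fun h => hp ((mS _ _).1 h))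
    exact ⟨(mS _ _).1 this.1, (mS _ _).1 this.2⟩
  · intro p a p' h ha
    simp only [MonoidHom.comp_apply] at h
    rw [← map_mul, ← map_mul] at h
    have h1 := key _ _ h (by
      have := L1 false p; have := L1 true a; have := L1 false p'
      have := L2 (PushoutI.of false p) (PushoutI.of true a)
      have := L2 (PushoutI.of true a) (PushoutI.of false p')
      omega)
    have := Amal.conj_c (mA true a) (fun h => ha ((mS _ _).1 h)) (mA false p) (mA false p') h1
    exact ⟨(mS _ _).1 this.1, (mS _ _).1 this.2⟩
  · intro q hq k k' h
    obtain ⟨q, rfl⟩ := QuotientGroup.mk'_surjective _ q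
    simp only [MonoidHom.comp_apply] at h
    change π _ * π q = π q * π _ at h
    rw [← map_mul, ← map_mul] at h
    apply ofinj true
    rw [map_one]
    refine SC.maln (m := m) true ?_ (mA true k) (mA true k') (q := q)
      (n := (PushoutI.of true k * q) * (q * PushoutI.of true k')⁻¹) ?_ ?_ (by group)
    · rintro _ ⟨x, rfl⟩ hx _ ⟨s, rfl⟩ ⟨s', hs'⟩
      rw [← PushoutI.of_apply_eq_base φ false s, ← PushoutI.of_apply_eq_base φ false s'] at hs'
      change (PushoutI.of false) (φ false s') = (PushoutI.of false x)⁻¹ * PushoutI.of false (φ false s) * PushoutI.of false x at hs'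
      rw [← map_inv, ← map_mul, ← map_mul] at hs'
      rw [hmal x (fun h => hx ((mS false _).2 h)) s s' (ofinj false hs'.symm), map_one]
    · rintro _ ⟨c, rfl⟩ hc
      exact hq ⟨c, QuotientGroup.eq.2 hc⟩
    · rw [← QuotientGroup.eq_one_iff]
      change π _ = 1
      rw [map_mul, map_inv, h, mul_inv_cancel]
  · intro h
    rw [SC.NN, Subgroup.normalClosure_eq_bot_iff]
    rintro _ ⟨⟨⟨b, e⟩, ⟨x, hx, -⟩⟩, -⟩
    simp [h b] at hx

end ShelahFormalization

namespace ShelahFormalization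
open Monoid Cardinal
universe u

theorem card_closure_le {G : Type u} [Group G] (s : Set G) : #(Subgroup.closure s) ≤ max #s ℵ₀ := by
  rcases s.eq_empty_or_nonempty with rfl | hs
  · rw [Subgroup.closure_empty]
    refine le_trans ?_ (le_max_right _ _)
    exact mk_le_aleph0
  · have : Nonempty s := hs.to_subtype
    rw [FreeGroup.closure_eq_range, ← mk_freeGroup]
    exact mk_range_le

def BG (K P : Type u) (b : Bool) : Type u := bif b then K else P
instance (K P : Type u) [Group K] [Group P] (b : Bool) : Group (BG K P b) :=
  match b with
  | true => inferInstanceAs (Group K)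
  | false => inferInstanceAs (Group P)

def bphi {S K P : Type u} [Group S] [Group K] [Group P] (i : S →* K) (j : S →* P) (b : Bool) : S →* BG K P b :=
  match b with
  | true => i
  | false => j

/-- free product with `ℤ` -/
theorem freeExt (P : Type u) [Group P] :
    ∃ (Q : Type u) (_ : Group Q) (f : P →* Q) (x : Q) (χ : Q →* Multiplicative ℤ),
      Function.Injective f ∧ (∀ p, χ (f p) = 1) ∧ χ x = Multiplicative.ofAdd 1 ∧
      (∀ q, q ∉ f.range → ∀ k k', f k * q = q * f k' → k = 1) ∧ #Q ≤ max #P ℵ₀ := by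
  let Z := ULift.{u} (Multiplicative ℤ)
  let φ := bphi (S := PUnit.{u+1}) (1 : PUnit →* P) (1 : PUnit →* Z)
  obtain ⟨N, hN, f, hinj, -, hgen, -, -, -, -, hm, hbot, hf⟩ := smallCanc φ
    (fun b => Function.injective_of_subsingleton _) (fun b _ => 1) (fun b => ∅)
    (by simp) (by simp) (by simp) (by simp) (by intros; rfl)
  have hb := hbot (by simp)
  subst hb
  let h : ∀ b, BG P Z b →* Multiplicative ℤ := fun b => match b with
    | true => 1
    | false => MulEquiv.ulift.toMonoidHom
  let χ₀ : PushoutI φ →* Multiplicative ℤ := PushoutI.lift h 1 (by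
    rintro b; refine MonoidHom.ext fun x => ?_
    obtain rfl : x = 1 := rfl
    rw [map_one, map_one])
  let χ := QuotientGroup.lift (⊥ : Subgroup (PushoutI φ)) χ₀ (by
    intro x hx; rw [Subgroup.mem_bot.1 hx]; exact one_mem _)
  refine ⟨PushoutI φ ⧸ (⊥ : Subgroup (PushoutI φ)), inferInstance, f true,
    f false (ULift.up (Multiplicative.ofAdd 1) : Z), χ, hinj true, ?_, ?_, hm, ?_⟩
  · intro p
    refine (congrArg χ (hf true p)).trans ?_
    change χ₀ (PushoutI.of true p) = 1
    simp only [χ₀, PushoutI.lift_of]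
    rfl
  · refine (congrArg χ (hf false _)).trans ?_
    change χ₀ (PushoutI.of false (ULift.up (Multiplicative.ofAdd 1) : Z)) = _
    simp only [χ₀, PushoutI.lift_of]
    rfl
  · rw [← mk_univ, ← Subgroup.coe_top, ← hgen]
    refine (card_closure_le _).trans (max_le ?_ (le_max_right _ _))
    refine (mk_union_le _ _).trans ?_
    refine add_le_of_le (le_max_right _ _) ?_ ?_
    · exact le_trans (mk_range_le (f := f true)) (le_max_left _ _)
    · refine le_trans (mk_range_le (f := f false)) (le_trans ?_ (le_max_right _ _))
      change #Z ≤ _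
      exact mk_le_aleph0

theorem smallCanc' {S K P : Type u} [Group S] [Group K] [Group P] (i : S →* K) (j : S →* P)
    (hi : Function.Injective i) (hj : Function.Injective j) (a : ℕ → K) (s : ℕ → P) (Z : Set P)
    (hZ : ∀ e ∈ Z, e ∉ j.range)
    (hl : Z.Nonempty → ∀ n < 18, a n ∉ i.range)
    (good : Z.Nonempty → ∀ n < 18, ∀ t t', (a n)⁻¹ * i t * a n = i t' → t = 1)
    (dc : Z.Nonempty → ∀ n < 18, ∀ m < 18, n ≠ m → ∀ t t',
      a n ≠ i t * a m * i t' ∧ a n ≠ i t * (a m)⁻¹ * i t')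
    (hl' : ∀ n < 18, s n ∉ j.range)
    (dc' : ∀ n < 18, ∀ m < 18, n ≠ m → ∀ t t',
      s n ≠ j t * s m * j t' ∧ s n ≠ j t * (s m)⁻¹ * j t')
    (hmal : ∀ x, x ∉ j.range → ∀ t t', x⁻¹ * j t * x = j t' → t = 1) :
    ∃ (Q : Type u) (_ : Group Q) (f : K →* Q) (g : P →* Q) (x : Q) (χ : Q →* Multiplicative ℤ),
      Function.Injective f ∧ Function.Injective g ∧ (∀ t, f (i t) = g (j t)) ∧
      (∀ e ∈ Z, ((List.range 18).map fun n => g e * f (a n)).prod = 1) ∧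
      (∀ k, k ∉ i.range → ((List.range 18).map fun n => f k * g (s n)).prod = 1) ∧
      (∀ k p, f k = g p → ∃ t, k = i t ∧ p = j t) ∧
      (∀ k p k' p', f k * g p * f k' = g p' → p ∉ j.range → k ∈ i.range ∧ k' ∈ i.range) ∧
      (∀ p a p', g p * f a = f a * g p' → a ∉ i.range → p ∈ j.range ∧ p' ∈ j.range) ∧
      (∀ q, q ∉ f.range → ∀ k k', f k * q = q * f k' → k = 1) ∧
      (∀ p, χ (g p) = 1) ∧ χ x = Multiplicative.ofAdd 1 ∧
      #Q ≤ max (max #K #P) ℵ₀ := by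
  classical
  let φ := bphi i j
  obtain ⟨N, hN, f, hinj, hcomm, hgen, hrel, ha, hb, hc, hd, -, -⟩ := smallCanc φ
    (by rintro (_ | _); exacts [hj, hi])
    (fun b => match b with | true => a | false => s)
    (fun b => match b with | true => Z | false => {k | k ∉ i.range})
    (by rintro (_ | _) e he; exacts [he, hZ e he])
    (by rintro (_ | _) hne n hn; exacts [hl' n hn, hl hne n hn])
    (by rintro (_ | _) hne n hn; exacts [hmal _ (hl' n hn), good hne n hn])
    (by rintro (_ | _) hne n hn; exacts [dc' n hn, dc hne n hn])
    hmal
  obtain ⟨Q, _, F, x, χ, hF, hχ, hx, hmalQ, hcard⟩ := freeExt (PushoutI φ ⧸ N)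
  let ft : K →* (PushoutI φ ⧸ N) := f true
  let ff : P →* (PushoutI φ ⧸ N) := f false
  refine ⟨Q, inferInstance, F.comp ft, F.comp ff, x, χ, hF.comp (hinj true), hF.comp (hinj false),
    ?_, ?_, ?_, ?_, ?_, ?_, ?_, ?_, hx, ?_⟩
  · intro t; exact congrArg F (hcomm t)
  · intro e he
    have := congrArg F (hrel true e he)
    rw [map_list_prod, map_one, List.map_map] at this
    rw [← this]; congr 1
    apply List.map_congr_left
    intro n _
    exact (map_mul F _ _).symm
  · intro e he
    have := congrArg F (hrel false e he)
    rw [map_list_prod, map_one, List.map_map] at this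
    rw [← this]; congr 1
    apply List.map_congr_left
    intro n _
    exact (map_mul F _ _).symm
  · intro k p h; exact ha k p (hF h)
  · intro k p k' p' h
    refine hb k p k' p' (hF ?_)
    rw [map_mul, map_mul]; exact h
  · intro p a p' h
    refine hc p a p' (hF ?_)
    rw [map_mul, map_mul]; exact h
  · intro q hq k k' h
    by_cases h1 : q ∈ F.range
    · obtain ⟨q, rfl⟩ := h1
      refine hd q ?_ k k' (hF ?_)
      · rintro ⟨y, rfl⟩
        exact hq ⟨y, rfl⟩
      · rw [map_mul, map_mul]; exact h
    · have := hmalQ q h1 _ _ h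
      exact hinj true (this.trans (map_one _).symm)
  · intro p; exact hχ _
  · refine hcard.trans (max_le ?_ (le_max_right _ _))
    rw [← mk_univ, ← Subgroup.coe_top, ← hgen]
    refine (card_closure_le _).trans (max_le ?_ (le_max_right _ _))
    refine (mk_union_le _ _).trans ?_
    refine add_le_of_le (le_max_right _ _) ?_ ?_
    · exact le_trans (mk_range_le (f := ft)) (le_trans (le_max_left _ _) (le_max_left _ _))
    · exact le_trans (mk_range_le (f := ff)) (le_trans (le_max_right _ _) (le_max_left _ _))

end ShelahFormalization

namespace ShelahFormalization
open Cardinal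
universe u

/-- decomposition of a free action -/
theorem free_decomp (P : Type u) [Group P] (A : Type u) [MulAction P A] (hfree : ∀ (p : P) (a : A), p • a = a → p = 1) :
    ∃ (O : Type u) (e : O × P ≃ A), ∀ o p q, e (o, p * q) = p • e (o, q) := by
  classical
  let O := MulAction.orbitRel.Quotient P A
  let s : O → A := Quotient.out
  refine ⟨O, Equiv.ofBijective (fun x : O × P => x.2 • s x.1) ⟨?_, ?_⟩, ?_⟩
  · rintro ⟨o, p⟩ ⟨o', p'⟩ h
    simp only at h
    have ho : o = o' := by
      rw [← Quotient.out_eq o, ← Quotient.out_eq o']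
      apply Quotient.sound
      refine ⟨p⁻¹ * p', ?_⟩
      change (p⁻¹ * p') • s o' = s o
      rw [mul_smul, ← h, inv_smul_smul]
    subst ho
    have : (p'⁻¹ * p) • s o = s o := by rw [mul_smul, h, inv_smul_smul]
    rw [inv_mul_eq_one.1 (hfree _ _ this)]
  · intro a
    have : (Quotient.mk _ (s (Quotient.mk _ a)) : O) = Quotient.mk _ a := Quotient.out_eq _
    obtain ⟨p, hp⟩ := Quotient.exact this.symm
    exact ⟨(Quotient.mk _ a, p), hp⟩
  · intro o p q
    exact mul_smul _ _ _

theorem emb {Ω : Type u} {κ : Cardinal.{u}} (hκ : ℵ₀ ≤ κ) (hΩ : #Ω = Order.succ κ)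
    (P : Subgroup (Equiv.Perm Ω)) (hP : ∀ p ∈ P, ∀ ω, p ω = ω → p = 1) (hPc : #P ≤ κ)
    {Q : Type u} [Group Q] (hQ : #Q ≤ κ) (j : P →* Q) (hj : Function.Injective j) :
    ∃ ψ : Q →* Equiv.Perm Ω, (∀ p, ψ (j p) = p) ∧ ∀ q ω, ψ q ω = ω → q = 1 := by
  obtain ⟨O, e, he⟩ := free_decomp P Ω (fun p ω h => Subtype.ext (hP p p.2 ω h))
  let act : MulAction P Q := MulAction.compHom Q j
  obtain ⟨O', e', he'⟩ := free_decomp P Q (fun p q h => by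
    apply hj; rw [map_one]
    have : j p * q = q := h
    simpa using this)
  have hPc' : #P ≠ 0 := mk_ne_zero _
  have hO : #O = Order.succ κ := by
    have h1 : #O * #P = Order.succ κ := by
      rw [← hΩ, ← mk_congr e]; simp
    have hκs : ℵ₀ ≤ Order.succ κ := hκ.trans (Order.le_succ κ)
    apply le_antisymm
    · rw [← h1]; exact Cardinal.le_mul_right hPc'
    · by_contra h
      have h2 : #O ≤ κ := Order.lt_succ_iff.1 (not_le.1 h)
      have h3 : #O * #P ≤ κ := (mul_le_mul' h2 hPc).trans_eq (mul_eq_self hκ)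
      rw [h1] at h3
      exact absurd h3 (not_le.2 (Order.lt_succ κ))
  have hO' : #O' ≤ κ := by
    refine le_trans ?_ hQ
    rw [← mk_congr e']; simp only [mk_prod, lift_id]
    exact Cardinal.le_mul_right hPc'
  have hne : #O' ≠ 0 := by
    intro h
    have : IsEmpty O' := mk_eq_zero_iff.1 h
    exact IsEmpty.false (e'.symm 1).1
  have hOO : #(O × O') = #O := by
    simp only [mk_prod, lift_id]
    rw [hO]
    exact mul_eq_left (hκ.trans (Order.le_succ κ)) (hO'.trans (Order.le_succ κ)) hne
  obtain ⟨t⟩ := Cardinal.eq.1 hOO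
  -- O × Q ≃ Ω
  let E : O × Q ≃ Ω := ((Equiv.prodCongr (Equiv.refl O) e'.symm).trans
    ((Equiv.prodAssoc O O' P).symm.trans (Equiv.prodCongr t (Equiv.refl P)))).trans e
  have hE : ∀ o (p : P) q, E (o, j p * q) = (p : Equiv.Perm Ω) (E (o, q)) := by
    intro o p q
    have h1 : e'.symm (j p * q) = ((e'.symm q).1, p * (e'.symm q).2) := by
      rw [Equiv.symm_apply_eq, he']
      change _ = j p * _
      rw [Prod.mk.eta, Equiv.apply_symm_apply]
    simp only [E, Equiv.trans_apply, Equiv.prodCongr_apply, Prod.map, h1]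
    exact he _ _ _
  let ψ : Q →* Equiv.Perm Ω :=
    { toFun := fun q => E.symm.trans ((Equiv.prodCongr (Equiv.refl O) (Equiv.mulLeft q)).trans E)
      map_one' := by ext ω; simp [Prod.map]
      map_mul' := by intro a b; ext ω; simp [Prod.map, mul_assoc] }
  have hψ : ∀ q ω, ψ q ω = E ((E.symm ω).1, q * (E.symm ω).2) := fun q ω => rfl
  refine ⟨ψ, ?_, ?_⟩
  · intro p; ext ω
    rw [hψ, hE, Prod.mk.eta, Equiv.apply_symm_apply]
  · intro q ω h
    rw [hψ, ← Equiv.eq_symm_apply] at h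
    have := congrArg Prod.snd h
    simpa using this

end ShelahFormalization

namespace ShelahFormalization
open Cardinal
universe u

def Good {H : Type u} [Group H] (S : Subgroup H) (a : H) : Prop :=
  a ∉ S ∧ ∀ s ∈ S, a⁻¹ * s * a ∈ S → s = 1

def Large {H : Type u} [Group H] (κ : Cardinal.{u}) (A : Set H) : Prop :=
  ∀ T : Set H, #T < κ → ∃ a ∈ A, Good (Subgroup.closure T) a

def Im {H G : Type u} [Group H] [Group G] (Γ : Subgroup (H × G)) : Set G := {σ | ∃ h, (h, σ) ∈ Γ}

structure Inv {H Ω : Type u} [Group H] (κ : Cardinal.{u}) (s : ℕ → Equiv.Perm Ω)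
    (Γ : Subgroup (H × Equiv.Perm Ω)) (P : Subgroup (Equiv.Perm Ω)) : Prop where
  free : ∀ p ∈ P, ∀ ω, p ω = ω → p = 1
  card : #P ≤ κ
  sub : ∀ h σ, (h, σ) ∈ Γ → σ ∈ P
  inj1 : ∀ σ, (1, σ) ∈ Γ → σ = 1
  inj2 : ∀ h, (h, 1) ∈ Γ → h = 1
  mal : ∀ p ∈ P, p ∉ Im Γ → ∀ h σ h' σ', (h, σ) ∈ Γ → (h', σ') ∈ Γ → p⁻¹ * σ * p = σ' → h = 1
  sP : ∀ i < 18, s i ∈ P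
  sIm : ∀ i < 18, s i ∉ Im Γ
  sdc : ∀ i < 18, ∀ j < 18, i ≠ j → ∀ σ ∈ Im Γ, ∀ σ' ∈ Im Γ,
    s i ≠ σ * s j * σ' ∧ s i ≠ σ * (s j)⁻¹ * σ'
  gad : ∀ h σ, (h, σ) ∈ Γ → h ≠ 1 → ((List.range 18).map fun i => σ * s i).prod = 1
  sprod : ((List.range 18).map s).prod ∉ Im Γ

theorem letters {H : Type u} [Group H] {κ : Cardinal.{u}} (hκ : ℵ₀ ≤ κ) {A : Set H} (hA : Large κ A)
    {T : Set H} (hT : #T < κ) (n : ℕ) :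
    ∃ a : ℕ → H, ∀ i < n, a i ∈ A ∧ Good (Subgroup.closure (T ∪ a '' {j | j < i})) (a i) := by
  induction n with
  | zero => exact ⟨fun _ => 1, by simp⟩
  | succ n ih =>
    obtain ⟨a, ha⟩ := ih
    obtain ⟨b, hb, hgood⟩ := hA (T ∪ a '' {j | j < n}) (by
      refine (mk_union_le _ _).trans_lt (add_lt_of_lt hκ hT (lt_of_lt_of_le ?_ hκ))
      exact Set.Finite.lt_aleph0 ((Set.finite_lt_nat n).image a))
    refine ⟨Function.update a n b, fun i hi => ?_⟩
    have himg : Function.update a n b '' {j | j < i} = a '' {j | j < i} := by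
      apply Set.image_congr
      intro j hj
      simp only [Set.mem_ofPred_eq] at hj
      rw [Function.update_of_ne]; omega
    rw [himg]
    by_cases h : i = n
    · subst h; simp only [Function.update_self]; exact ⟨hb, hgood⟩
    · rw [Function.update_of_ne h]
      exact ha i (by omega)

theorem letters' {H : Type u} [Group H] {κ : Cardinal.{u}} (hκ : ℵ₀ ≤ κ) {A : Set H} (hA : Large κ A)
    {T : Set H} (hT : #T < κ) (y : H) :
    ∃ a l : ℕ → H, (∀ i < 18, a i ∈ A) ∧ (∀ i < 17, l i = a i) ∧ l 17 = a 17 * y⁻¹ ∧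
      (∀ i < 18, l i ∉ Subgroup.closure T) ∧
      (∀ i < 18, ∀ s ∈ Subgroup.closure T, (l i)⁻¹ * s * l i ∈ Subgroup.closure T → s = 1) ∧
      (∀ i < 18, ∀ j < 18, i ≠ j → ∀ s ∈ Subgroup.closure T, ∀ s' ∈ Subgroup.closure T,
        l i ≠ s * l j * s' ∧ l i ≠ s * (l j)⁻¹ * s') := by
  have hT' : #(insert y T : Set H) < κ := by
    refine (mk_insert_le).trans_lt (add_lt_of_lt hκ hT (lt_of_lt_of_le one_lt_aleph0 hκ))
  obtain ⟨a, ha⟩ := letters hκ hA hT' 18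
  let S : ℕ → Subgroup H := fun i => Subgroup.closure (insert y T ∪ a '' {j | j < i})
  let l : ℕ → H := fun i => if i = 17 then a 17 * y⁻¹ else a i
  have hTS : ∀ i, Subgroup.closure T ≤ S i := fun i =>
    Subgroup.closure_mono (by intro x hx; left; right; exact hx)
  have hyS : ∀ i, y ∈ S i := fun i => Subgroup.subset_closure (by left; left; rfl)
  have h1 : ∀ i < 18, l i ∉ S i := by
    intro i hi
    simp only [l]; split_ifs with h
    · subst h
      intro h2
      apply (ha 17 (by norm_num)).2.1
      exact (Subgroup.mul_mem_cancel_right _ (inv_mem (hyS 17))).1 h2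
    · exact (ha i hi).2.1
  have h2 : ∀ i < 18, ∀ s ∈ S i, (l i)⁻¹ * s * l i ∈ S i → s = 1 := by
    intro i hi
    simp only [l]; split_ifs with h
    · subst h
      intro s hs h2
      apply (ha 17 (by norm_num)).2.2 s hs
      have := mul_mem (mul_mem (inv_mem (hyS 17)) h2) (hyS 17)
      convert this using 1
      group
    · exact (ha i hi).2.2
  have h3 : ∀ i < 18, ∀ j < i, l j ∈ S i := by
    intro i hi j hj
    have : j ≠ 17 := by omega
    simp only [l, if_neg this]
    exact Subgroup.subset_closure (by right; exact ⟨j, hj, rfl⟩)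
  refine ⟨a, l, fun i hi => (ha i hi).1, ?_, ?_, ?_, ?_, ?_⟩
  · intro i hi
    have : i ≠ 17 := by omega
    simp only [l, if_neg this]
  · simp [l]
  · intro i hi h; exact h1 i hi (hTS i h)
  · intro i hi s hs h; exact h2 i hi s (hTS i hs) (hTS i h)
  · intro i hi j hj hij s hs s' hs'
    rcases lt_or_gt_of_ne hij with h | h
    · constructor
      · intro he
        apply h1 j hj
        have : l j = s⁻¹ * l i * s'⁻¹ := by rw [he]; group
        rw [this]
        exact mul_mem (mul_mem (inv_mem (hTS j hs)) (h3 j hj i h)) (inv_mem (hTS j hs'))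
      · intro he
        apply h1 j hj
        have : l j = s' * (l i)⁻¹ * s := by rw [he]; group
        rw [this]
        exact mul_mem (mul_mem (hTS j hs') (inv_mem (h3 j hj i h))) (hTS j hs)
    · constructor
      · intro he
        apply h1 i hi
        rw [he]
        exact mul_mem (mul_mem (hTS i hs) (h3 i hi j h)) (hTS i hs')
      · intro he
        apply h1 i hi
        rw [he]
        exact mul_mem (mul_mem (hTS i hs) (inv_mem (h3 i hi j h))) (hTS i hs')

theorem step {H Ω : Type u} [Group H] {κ : Cardinal.{u}} (hκ : ℵ₀ ≤ κ) (hΩ : #Ω = Order.succ κ) (hH : #H ≤ κ)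
    {s : ℕ → Equiv.Perm Ω} {Γ : Subgroup (H × Equiv.Perm Ω)} {P : Subgroup (Equiv.Perm Ω)} (hI : Inv κ s Γ P)
    {T : Set H} (hT : #T < κ) (hdom : ∀ h σ, (h, σ) ∈ Γ → h ∈ Subgroup.closure T)
    (h₀ : H) (A : Set H) (y : H) :
    ∃ (Γ' : Subgroup (H × Equiv.Perm Ω)) (P' : Subgroup (Equiv.Perm Ω)) (T' : Set H), T'.Finite ∧
      Γ ≤ Γ' ∧ P ≤ P' ∧ Inv κ s Γ' P' ∧ (∀ h σ, (h, σ) ∈ Γ' → h ∈ Subgroup.closure (T ∪ T')) ∧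
      (∃ σ, (h₀, σ) ∈ Γ') ∧ (∀ h σ, (h, σ) ∈ Γ' → σ ∈ P → (h, σ) ∈ Γ) ∧
      (∀ a α, (a, α) ∈ Γ' → (a, α) ∉ Γ → ∀ p ∈ P, ∀ p' ∈ P, p * α = α * p' → p ∈ Im Γ ∧ p' ∈ Im Γ) ∧
      (∃ x ∈ P', ∀ L : List (Equiv.Perm Ω), (∀ c ∈ L, c ∈ P) → L ≠ [] → ∀ c₀ ∈ P,
        c₀ * (L.map fun c => x * c).prod ∉ P) ∧
      (Large κ A → ∀ z ∈ P, z ∉ Im Γ → ∃ (a : ℕ → H) (α : ℕ → Equiv.Perm Ω) (η : Equiv.Perm Ω),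
        (∀ i < 18, a i ∈ A ∧ (a i, α i) ∈ Γ') ∧ (y, η) ∈ Γ' ∧
        ((List.range 18).map fun i => z * α i).prod = η) := by
  classical
  have hlet : ∃ a l : ℕ → H, (∀ i < 17, l i = a i) ∧ l 17 = a 17 * y⁻¹ ∧ (Large κ A →
      (∀ i < 18, a i ∈ A) ∧
      (∀ i < 18, l i ∉ Subgroup.closure T) ∧
      (∀ i < 18, ∀ s ∈ Subgroup.closure T, (l i)⁻¹ * s * l i ∈ Subgroup.closure T → s = 1) ∧
      (∀ i < 18, ∀ j < 18, i ≠ j → ∀ s ∈ Subgroup.closure T, ∀ s' ∈ Subgroup.closure T,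
        l i ≠ s * l j * s' ∧ l i ≠ s * (l j)⁻¹ * s')) := by
    by_cases hA : Large κ A
    · obtain ⟨a, l, h1, h2, h3, h4, h5, h6⟩ := letters' hκ hA hT y
      exact ⟨a, l, h2, h3, fun _ => ⟨h1, h4, h5, h6⟩⟩
    · exact ⟨fun _ => 1, fun i => if i = 17 then 1 * y⁻¹ else 1, fun i hi => by
        have : i ≠ 17 := by omega
        simp [this], by simp, fun h => absurd h hA⟩
  obtain ⟨a, l, hla, hla', hl⟩ := hlet
  let T' : Set H := insert h₀ (insert y (a '' {j | j < 18}))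
  let K : Subgroup H := Subgroup.closure (T ∪ T')
  have hTK : Subgroup.closure T ≤ K := Subgroup.closure_mono Set.subset_union_left
  have hyK : y ∈ K := Subgroup.subset_closure (by right; right; left; rfl)
  have hh₀K : h₀ ∈ K := Subgroup.subset_closure (by right; left; rfl)
  have haK : ∀ i < 18, a i ∈ K := fun i hi => Subgroup.subset_closure (by right; right; right; exact ⟨i, hi, rfl⟩)
  have hlK : ∀ i < 18, l i ∈ K := by
    intro i hi
    by_cases h : i = 17
    · subst h; rw [hla']; exact mul_mem (haK 17 hi) (inv_mem hyK)
    · rw [hla i (by omega)]; exact haK i hi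
  let i : Γ →* K := ((MonoidHom.fst _ _).comp Γ.subtype).codRestrict K (fun x => hTK (hdom _ _ x.2))
  let j : Γ →* P := ((MonoidHom.snd _ _).comp Γ.subtype).codRestrict P (fun x => hI.sub _ _ x.2)
  have hi : Function.Injective i := by
    rw [injective_iff_map_eq_one]
    rintro ⟨⟨h, σ⟩, hx⟩ h1
    have h1 : h = 1 := congrArg Subtype.val h1
    subst h1
    have := hI.inj1 _ hx
    subst this; rfl
  have hj : Function.Injective j := by
    rw [injective_iff_map_eq_one]
    rintro ⟨⟨h, σ⟩, hx⟩ h1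
    have h1 : σ = 1 := congrArg Subtype.val h1
    subst h1
    have := hI.inj2 _ hx
    subst this; rfl
  have hjr : ∀ p : P, p ∈ j.range ↔ (p : Equiv.Perm Ω) ∈ Im Γ := by
    intro p
    constructor
    · rintro ⟨⟨⟨h, σ⟩, hx⟩, rfl⟩
      exact ⟨h, hx⟩
    · rintro ⟨h, hx⟩
      exact ⟨⟨⟨h, p⟩, hx⟩, rfl⟩
  have him : ∀ t : Γ, ((j t : P) : Equiv.Perm Ω) ∈ Im Γ := fun t => (hjr _).1 ⟨t, rfl⟩
  have hit : ∀ t : Γ, ((i t : K) : H) ∈ Subgroup.closure T := fun t => hdom _ _ t.2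
  let aK : ℕ → K := fun n => if h : n < 18 then ⟨l n, hlK n h⟩ else 1
  have haKv : ∀ n < 18, ((aK n : K) : H) = l n := fun n hn => by simp [aK, hn]
  let sP : ℕ → P := fun n => if h : n < 18 then ⟨s n, hI.sP n h⟩ else 1
  have hsPv : ∀ n < 18, ((sP n : P) : Equiv.Perm Ω) = s n := fun n hn => by simp [sP, hn]
  let Z : Set P := {p | (p : Equiv.Perm Ω) ∉ Im Γ ∧ Large κ A}
  obtain ⟨Q, _, f, g, x, χ, hf, hg, hfg, rel1, rel2, pa, pb, pc, pd, hχ, hχx, hcard⟩ :=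
    smallCanc' i j hi hj aK sP Z
    (by rintro e ⟨h2, -⟩ h3; rw [hjr] at h3; exact h2 h3)
    (by
      rintro ⟨_, _, hA⟩ n hn ⟨t, ht⟩
      apply (hl hA).2.1 n hn
      rw [← haKv n hn, ← ht]; exact hit t)
    (by
      rintro ⟨_, _, hA⟩ n hn t t' ht
      apply hi
      rw [map_one]
      apply Subtype.ext
      apply (hl hA).2.2.1 n hn _ (hit t)
      have := congrArg Subtype.val ht
      simp only [Subgroup.coe_mul, Subgroup.coe_inv, haKv n hn] at this
      rw [this]; exact hit t')
    (by
      rintro ⟨_, _, hA⟩ n hn m hm hnm t t'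
      have := (hl hA).2.2.2 n hn m hm hnm _ (hit t) _ (hit t')
      constructor
      · intro h
        apply this.1
        have := congrArg Subtype.val h
        simpa only [Subgroup.coe_mul, Subgroup.coe_inv, haKv n hn, haKv m hm] using this
      · intro h
        apply this.2
        have := congrArg Subtype.val h
        simpa only [Subgroup.coe_mul, Subgroup.coe_inv, haKv n hn, haKv m hm] using this)
    (by intro n hn; rw [hjr, hsPv n hn]; exact hI.sIm n hn)
    (by
      intro n hn m hm hnm t t'
      have := hI.sdc n hn m hm hnm _ (him t) _ (him t')
      constructor
      · intro h
        apply this.1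
        have := congrArg Subtype.val h
        simpa only [Subgroup.coe_mul, Subgroup.coe_inv, hsPv n hn, hsPv m hm] using this
      · intro h
        apply this.2
        have := congrArg Subtype.val h
        simpa only [Subgroup.coe_mul, Subgroup.coe_inv, hsPv n hn, hsPv m hm] using this)
    (by
      rintro x hx ⟨⟨h, σ⟩, ht⟩ ⟨⟨h', σ'⟩, ht'⟩ he
      rw [hjr] at hx
      have := hI.mal x x.2 hx h σ h' σ' ht ht' (congrArg Subtype.val he)
      apply hi
      rw [map_one]
      exact Subtype.ext this)
  have hQ : #Q ≤ κ := hcard.trans (max_le (max_le ((mk_subtype_le _).trans hH) hI.card) hκ)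
  obtain ⟨ψ, hψ, hfree⟩ := emb hκ hΩ P hI.free hI.card hQ g hg
  have hψinj : Function.Injective ψ := by
    rw [injective_iff_map_eq_one]
    intro q hq
    have : Nonempty Ω := by
      rw [← mk_ne_zero_iff, hΩ]; exact (Order.bot_lt_succ κ).ne'
    exact hfree q this.some (by rw [hq]; rfl)
  let F : K →* H × Equiv.Perm Ω := K.subtype.prod (ψ.comp f)
  have hF : ∀ h σ, (h, σ) ∈ F.range ↔ ∃ hk : h ∈ K, σ = ψ (f ⟨h, hk⟩) := by
    intro h σ
    constructor
    · rintro ⟨k, hk⟩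
      have h1 : (k : H) = h := congrArg Prod.fst hk
      have h2 : ψ (f k) = σ := congrArg Prod.snd hk
      subst h1
      exact ⟨k.2, h2.symm⟩
    · rintro ⟨hk, rfl⟩
      exact ⟨⟨h, hk⟩, rfl⟩
  have hImF : ∀ σ, σ ∈ Im F.range ↔ ∃ k, σ = ψ (f k) := by
    intro σ
    constructor
    · rintro ⟨h, hx⟩
      obtain ⟨hk, rfl⟩ := (hF _ _).1 hx
      exact ⟨_, rfl⟩
    · rintro ⟨k, rfl⟩
      exact ⟨k, (hF _ _).2 ⟨k.2, rfl⟩⟩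
  have hΓ : Γ ≤ F.range := by
    rintro ⟨h, σ⟩ hx
    refine (hF _ _).2 ⟨hTK (hdom h σ hx), ?_⟩
    have h1 := hfg ⟨(h, σ), hx⟩
    have h2 := hψ (j ⟨(h, σ), hx⟩)
    rw [← h1] at h2
    exact h2.symm
  have hback : ∀ h σ, (h, σ) ∈ F.range → σ ∈ P → (h, σ) ∈ Γ := by
    intro h σ hx hσ
    obtain ⟨hk, rfl⟩ := (hF _ _).1 hx
    have h1 : f ⟨h, hk⟩ = g ⟨_, hσ⟩ := hψinj (hψ ⟨_, hσ⟩).symm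
    obtain ⟨⟨⟨h', σ'⟩, ht⟩, ht1, ht2⟩ := pa _ _ h1
    have e1 : h = h' := congrArg Subtype.val ht1
    have e2 : ψ (f ⟨h, hk⟩) = σ' := congrArg Subtype.val ht2
    rw [e2, e1]; exact ht
  have hbackI : ∀ σ ∈ P, σ ∈ Im F.range → σ ∈ Im Γ := by
    rintro σ h ⟨h', hx⟩
    exact ⟨h', hback _ _ hx h⟩
  have hPle : P ≤ ψ.range := fun p hp => ⟨g ⟨p, hp⟩, hψ _⟩
  have hnotir : ∀ k : K, ((k : H), ψ (f k)) ∉ Γ → k ∉ i.range := by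
    rintro k h ⟨t, rfl⟩
    apply h
    rw [hfg, hψ]
    exact t.2
  have hirange : ∀ k : K, k ∈ i.range → ψ (f k) ∈ Im Γ := by
    rintro _ ⟨t, rfl⟩
    rw [hfg, hψ]; exact him t
  refine ⟨F.range, ψ.range, T', ?_, hΓ, hPle, ?_, ?_, ?_, hback, ?_, ?_, ?_⟩
  · exact (((Set.finite_lt_nat 18).image a).insert _).insert _
  · exact
    { free := by
        rintro _ ⟨q, rfl⟩ ω h
        rw [hfree q ω h, map_one]
      card := mk_range_le.trans hQ
      sub := by
        intro h σ hx
        obtain ⟨hk, rfl⟩ := (hF _ _).1 hx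
        exact ⟨_, rfl⟩
      inj1 := by
        intro σ hx
        obtain ⟨hk, rfl⟩ := (hF _ _).1 hx
        have : (⟨1, hk⟩ : K) = 1 := rfl
        rw [this, map_one, map_one]
      inj2 := by
        intro h hx
        obtain ⟨hk, h1⟩ := (hF _ _).1 hx
        have h2 : f ⟨h, hk⟩ = 1 := hψinj (by rw [← h1, map_one])
        have h3 := hf (h2.trans (map_one f).symm)
        exact congrArg Subtype.val h3
      mal := by
        rintro _ ⟨q, rfl⟩ hq h σ h' σ' hx hx' he
        obtain ⟨hk, rfl⟩ := (hF _ _).1 hx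
        obtain ⟨hk', rfl⟩ := (hF _ _).1 hx'
        rw [← map_inv, ← map_mul, ← map_mul] at he
        have he := hψinj he
        have := pd q (by rintro ⟨k, rfl⟩; exact hq ((hImF _).2 ⟨k, rfl⟩)) ⟨h, hk⟩ ⟨h', hk'⟩ (by rw [← he]; group)
        exact congrArg Subtype.val this
      sP := fun n hn => hPle (hI.sP n hn)
      sIm := fun n hn h => hI.sIm n hn (hbackI _ (hI.sP n hn) h)
      sdc := by
        intro n hn m hm hnm σ hσ σ' hσ'
        obtain ⟨k, rfl⟩ := (hImF _).1 hσ
        obtain ⟨k', rfl⟩ := (hImF _).1 hσ'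
        have main : ∀ p : P, (p : Equiv.Perm Ω) ∉ Im Γ → s n = ψ (f k) * p * ψ (f k') →
            ψ (f k) ∈ Im Γ ∧ ψ (f k') ∈ Im Γ := by
          intro p hp he
          rw [← hψ p, ← map_mul, ← map_mul, ← hsPv n hn, ← hψ] at he
          have := pb _ _ _ _ (hψinj he).symm (fun h => hp ((hjr p).1 h))
          exact ⟨hirange _ this.1, hirange _ this.2⟩
        constructor
        · intro he
          have := main ⟨s m, hI.sP m hm⟩ (hI.sIm m hm) he
          exact (hI.sdc n hn m hm hnm _ this.1 _ this.2).1 he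
        · intro he
          have := main ⟨(s m)⁻¹, inv_mem (hI.sP m hm)⟩ (by
            rintro ⟨h, hx⟩
            apply hI.sIm m hm
            have := inv_mem hx
            simp only [Prod.inv_mk, inv_inv] at this
            exact ⟨_, this⟩) he
          exact (hI.sdc n hn m hm hnm _ this.1 _ this.2).2 he
      gad := by
        intro h σ hx h1
        by_cases hΓ' : (h, σ) ∈ Γ
        · exact hI.gad h σ hΓ' h1
        · obtain ⟨hk, rfl⟩ := (hF _ _).1 hx
          have := congrArg ψ (rel2 ⟨h, hk⟩ (hnotir _ hΓ'))
          rw [map_list_prod, List.map_map, map_one] at this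
          rw [← this]
          congr 1
          apply List.map_congr_left
          intro n hn
          rw [Function.comp_apply, map_mul, hψ, hsPv n (List.mem_range.1 hn)]
      sprod := by
        intro h
        refine hI.sprod (hbackI _ ?_ h)
        apply Subgroup.list_prod_mem
        intro x hx
        obtain ⟨n, hn, rfl⟩ := List.mem_map.1 hx
        exact hI.sP n (List.mem_range.1 hn) }
  · intro h σ hx
    exact ((hF _ _).1 hx).1
  · exact ⟨_, (hF _ _).2 ⟨hh₀K, rfl⟩⟩
  · intro b α hx hnx p hp p' hp' he
    obtain ⟨hk, rfl⟩ := (hF _ _).1 hx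
    have := pc ⟨p, hp⟩ ⟨b, hk⟩ ⟨p', hp'⟩ (hψinj (by
      rw [map_mul, map_mul, hψ, hψ]; exact he)) (hnotir _ hnx)
    exact ⟨(hjr _).1 this.1, (hjr _).1 this.2⟩
  · refine ⟨ψ x, ⟨x, rfl⟩, ?_⟩
    intro L hL hne c₀ hc₀ hmem
    have : ∀ L : List (Equiv.Perm Ω), (∀ c ∈ L, c ∈ P) → ∃ q, ψ q = (L.map fun c => ψ x * c).prod ∧
        χ q = Multiplicative.ofAdd (L.length : ℤ) := by
      intro L
      induction L with
      | nil => intro _; exact ⟨1, by simp, by simp⟩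
      | cons c L ih =>
        intro h
        obtain ⟨q, hq1, hq2⟩ := ih (fun c hc => h c (List.mem_cons_of_mem _ hc))
        refine ⟨x * g ⟨c, h c List.mem_cons_self⟩ * q, ?_, ?_⟩
        · simp [hq1, hψ]
        · rw [map_mul, map_mul, hχ, hχx, hq2, mul_one, ← ofAdd_add]
          congr 1; simp; ring
    obtain ⟨q, hq1, hq2⟩ := this L hL
    have h1 : g ⟨c₀, hc₀⟩ * q = g ⟨_, hmem⟩ := hψinj (by rw [map_mul, hψ, hψ, hq1])
    have h2 := congrArg χ h1
    rw [map_mul, hχ, hχ, hq2, one_mul] at h2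
    have h3 : (L.length : ℤ) = 0 := h2
    exact hne (List.length_eq_zero_iff.1 (by exact_mod_cast h3))
  · intro hA z hz hzΓ
    have ψf : ∀ n (hn : n < 18), ((a n : H), ψ (f ⟨a n, haK n hn⟩)) ∈ F.range := fun n hn => (hF _ _).2 ⟨haK n hn, rfl⟩
    refine ⟨a, fun n => if hn : n < 18 then ψ (f ⟨a n, haK n hn⟩) else 1, ψ (f ⟨y, hyK⟩), ?_, (hF _ _).2 ⟨hyK, rfl⟩, ?_⟩
    · intro n hn
      refine ⟨(hl hA).1 n hn, ?_⟩
      simp only [hn, dif_pos]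
      exact ψf n hn
    · have := congrArg ψ (rel1 ⟨z, hz⟩ ⟨hzΓ, hA⟩)
      rw [map_list_prod, List.map_map, map_one, List.range_succ, List.map_append, List.prod_append] at this
      rw [List.range_succ, List.map_append, List.prod_append]
      have e17 : aK 17 = ⟨a 17, haK 17 (by norm_num)⟩ * (⟨y, hyK⟩ : K)⁻¹ := by
        apply Subtype.ext
        rw [haKv 17 (by norm_num), hla']; rfl
      have e : (List.map (ψ ∘ fun n => g ⟨z, hz⟩ * f (aK n)) (List.range 17)) =
          List.map (fun n => z * if hn : n < 18 then ψ (f ⟨a n, haK n hn⟩) else 1) (List.range 17) := by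
        apply List.map_congr_left
        intro n hn
        have hn := List.mem_range.1 hn
        have hn' : n < 18 := by omega
        rw [Function.comp_apply, map_mul, hψ, dif_pos hn']
        congr 3
        apply Subtype.ext
        rw [haKv n hn', hla n hn]
      rw [e] at this
      simp only [List.map_cons, List.map_nil, List.prod_cons, List.prod_nil, mul_one, Function.comp_apply, map_mul,
        e17, map_inv, hψ] at this
      simp only [List.map_cons, List.map_nil, List.prod_cons, List.prod_nil, mul_one]
      rw [dif_pos (by norm_num)]
      rw [← mul_assoc, ← mul_assoc, mul_inv_eq_one] at this
      rw [← mul_assoc]; exact this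

end ShelahFormalization

namespace ShelahFormalization
open Cardinal
universe u

theorem chain_exists {I : Type*} [LinearOrder I] [WellFoundedLT I] {L : Type*} [CompleteLattice L] (base : L)
    (F : I → L → L) (hF : ∀ i x, x ≤ F i x) :
    ∃ f pre : I → L, (∀ i, f i = F i (pre i)) ∧ (∀ i, pre i ≤ f i) ∧ (∀ j i, j < i → f j ≤ pre i) ∧ Monotone f ∧
      (∀ i, base ≤ pre i) ∧ (∀ i, (Set.Iio i).Nonempty → pre i = ⨆ j : Set.Iio i, f j) ∧
      (∀ i, ¬ (Set.Iio i).Nonempty → pre i = base) := by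
  let f : I → L := WellFoundedLT.fix (fun i ih => F i (base ⊔ ⨆ j : Set.Iio i, ih j.1 j.2))
  let pre : I → L := fun i => base ⊔ ⨆ j : Set.Iio i, f j
  have h1 : ∀ i, f i = F i (pre i) := fun i => WellFoundedLT.fix_eq _ i
  have h2 : ∀ i, pre i ≤ f i := fun i => (hF i _).trans (h1 i).ge
  have h3 : ∀ j i, j < i → f j ≤ pre i := fun j i h =>
    le_sup_of_le_right (le_iSup (fun j : Set.Iio i => f j) ⟨j, h⟩)
  have h5 : ∀ i, base ≤ pre i := fun i => le_sup_left
  refine ⟨f, pre, h1, h2, h3, ?_, h5, ?_, ?_⟩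
  · intro j i h
    rcases h.eq_or_lt with rfl | h
    · exact le_rfl
    · exact (h3 j i h).trans (h2 i)
  · rintro i ⟨j, hj⟩
    apply le_antisymm
    · refine sup_le ?_ le_rfl
      exact ((h5 j).trans (h2 j)).trans (le_iSup (fun j : Set.Iio i => f j) ⟨j, hj⟩)
    · exact le_sup_right
  · intro i h
    have : IsEmpty (Set.Iio i) := Set.isEmpty_coe_sort.2 (Set.not_nonempty_iff_eq_empty.1 h)
    simp [pre]

theorem mk_iUnion_lt {κ : Cardinal.{u}} (hκ : ℵ₀ ≤ κ) {J α : Type u} (hJ : #J < κ) (F : J → Set α) (hF : ∀ j, (F j).Finite) :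
    #(⋃ j, F j) < κ := by
  rcases hκ.eq_or_lt with rfl | h
  · have : Finite J := lt_aleph0_iff_finite.1 hJ
    exact (Set.finite_iUnion hF).lt_aleph0
  · refine (mk_iUnion_le F).trans_lt ?_
    refine (mul_le_mul_right (ciSup_le' (a := ℵ₀) fun j => (hF j).lt_aleph0.le) _).trans_lt ?_
    exact mul_lt_of_lt hκ hJ h

theorem mk_Iic_lt {κ : Cardinal.{u}} (hκ : ℵ₀ ≤ κ) (i : κ.ord.ToType) : #(Set.Iic i) < κ := by
  have := noMaxOrder hκ
  obtain ⟨j, hj⟩ := exists_gt i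
  exact (mk_le_mk_of_subset (fun x hx => lt_of_le_of_lt hx hj)).trans_lt (mk_Iio_toType_ord_lt j)

theorem bookkeeping {κ : Cardinal.{u}} (hκ : ℵ₀ ≤ κ) {B : Type u} (hB : #B ≤ κ) [Nonempty B] :
    ∃ b : κ.ord.ToType → B, ∀ β j, ∃ i, j < i ∧ b i = β := by
  have h1 : #(κ.ord.ToType) = #(κ.ord.ToType × B) := by
    rw [mk_prod, lift_id, lift_id, mk_ord_toType, mul_eq_left hκ hB (mk_ne_zero _)]
  obtain ⟨e⟩ := Cardinal.eq.1 h1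
  refine ⟨fun i => (e i).2, fun β j => ?_⟩
  by_contra! h
  have h2 : Set.range (fun k => e.symm (k, β)) ⊆ Set.Iic j := by
    rintro _ ⟨k, rfl⟩
    by_contra h3
    exact h _ (not_le.1 h3) (by simp)
  have h3 := mk_le_mk_of_subset h2
  rw [mk_range_eq _ (by intro a b hab; simpa using hab), mk_ord_toType] at h3
  exact absurd h3 (not_le.2 (mk_Iic_lt hκ j))

theorem mem_iSup_mono {ι : Type*} [LinearOrder ι] [Nonempty ι] {G : Type*} [Group G] {K : ι → Subgroup G}
    (hK : Monotone K) {x : G} : x ∈ iSup K ↔ ∃ i, x ∈ K i :=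
  Subgroup.mem_iSup_of_directed hK.directed_le

theorem card_iSup_le {ι : Type u} [LinearOrder ι] [Nonempty ι] {G : Type u} [Group G] {K : ι → Subgroup G}
    (hK : Monotone K) {κ : Cardinal.{u}} (hκ : ℵ₀ ≤ κ) (hι : #ι ≤ κ) (h : ∀ i, #(K i) ≤ κ) :
    #(iSup K : Subgroup G) ≤ κ := by
  have h1 : ((iSup K : Subgroup G) : Set G) = ⋃ i, (K i : Set G) := by
    ext x; simp [mem_iSup_mono hK]
  change #((iSup K : Subgroup G) : Set G) ≤ κ
  rw [h1]
  refine (mk_iUnion_le _).trans ?_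
  refine (mul_le_mul' hι (ciSup_le' h)).trans_eq (mul_eq_self hκ)

theorem Inv_iSup {H Ω : Type u} [Group H] {κ : Cardinal.{u}} (hκ : ℵ₀ ≤ κ) {s : ℕ → Equiv.Perm Ω}
    {ι : Type u} [LinearOrder ι] [Nonempty ι] (hι : #ι ≤ κ)
    {Γ : ι → Subgroup (H × Equiv.Perm Ω)} {P : ι → Subgroup (Equiv.Perm Ω)} (hΓ : Monotone Γ) (hP : Monotone P)
    (h : ∀ i, Inv κ s (Γ i) (P i)) : Inv κ s (iSup Γ) (iSup P) := by
  have mΓ : ∀ {x}, x ∈ iSup Γ ↔ ∃ i, x ∈ Γ i := mem_iSup_mono hΓ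
  have mP : ∀ {x}, x ∈ iSup P ↔ ∃ i, x ∈ P i := mem_iSup_mono hP
  have mI : ∀ {σ}, σ ∈ Im (iSup Γ) ↔ ∃ i, σ ∈ Im (Γ i) := by
    intro σ
    constructor
    · rintro ⟨h, hx⟩
      obtain ⟨i, hi⟩ := mΓ.1 hx
      exact ⟨i, h, hi⟩
    · rintro ⟨i, h, hi⟩
      exact ⟨h, mΓ.2 ⟨i, hi⟩⟩
  have hIm : Monotone fun i => Im (Γ i) := by
    rintro i j hij σ ⟨h, hx⟩
    exact ⟨h, hΓ hij hx⟩
  exact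
  { free := by
      intro p hp
      obtain ⟨i, hi⟩ := mP.1 hp
      exact (h i).free p hi
    card := card_iSup_le hP hκ hι fun i => (h i).card
    sub := by
      intro g σ hx
      obtain ⟨i, hi⟩ := mΓ.1 hx
      exact mP.2 ⟨i, (h i).sub g σ hi⟩
    inj1 := by
      intro σ hx
      obtain ⟨i, hi⟩ := mΓ.1 hx
      exact (h i).inj1 σ hi
    inj2 := by
      intro σ hx
      obtain ⟨i, hi⟩ := mΓ.1 hx
      exact (h i).inj2 σ hi
    mal := by
      intro p hp hpI g σ g' σ' hx hx'
      obtain ⟨i, hi⟩ := mP.1 hp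
      obtain ⟨j, hj⟩ := mΓ.1 hx
      obtain ⟨k, hk⟩ := mΓ.1 hx'
      let m := max i (max j k)
      exact (h m).mal p (hP (le_max_left _ _) hi) (fun h => hpI (mI.2 ⟨m, h⟩)) g σ g' σ'
        (hΓ ((le_max_left _ _).trans (le_max_right _ _)) hj)
        (hΓ ((le_max_right _ _).trans (le_max_right _ _)) hk)
    sP := by
      intro n hn
      obtain ⟨i⟩ := ‹Nonempty ι›
      exact mP.2 ⟨i, (h i).sP n hn⟩
    sIm := by
      intro n hn hs
      obtain ⟨i, hi⟩ := mI.1 hs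
      exact (h i).sIm n hn hi
    sdc := by
      intro n hn m hm hnm σ hσ σ' hσ'
      obtain ⟨i, hi⟩ := mI.1 hσ
      obtain ⟨j, hj⟩ := mI.1 hσ'
      exact (h (max i j)).sdc n hn m hm hnm σ (hIm (le_max_left _ _) hi) σ' (hIm (le_max_right _ _) hj)
    gad := by
      intro g σ hx
      obtain ⟨i, hi⟩ := mΓ.1 hx
      exact (h i).gad g σ hi
    sprod := by
      intro hs
      obtain ⟨i, hi⟩ := mI.1 hs
      exact (h i).sprod hi }

theorem inv_init {Ω : Type u} {κ : Cardinal.{u}} (hκ : ℵ₀ ≤ κ) (hΩ : #Ω = Order.succ κ) (H : Type u) [Group H] :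
    ∃ (s : ℕ → Equiv.Perm Ω) (P : Subgroup (Equiv.Perm Ω)), Inv (H := H) κ s ⊥ P := by
  let Q := ULift.{u} (Multiplicative (ℕ →₀ ℤ))
  have : Countable (Multiplicative (ℕ →₀ ℤ)) := inferInstanceAs (Countable (ℕ →₀ ℤ))
  have : Countable Q := inferInstanceAs (Countable (ULift _))
  obtain ⟨ψ, -, hfree⟩ := emb (Q := Q) hκ hΩ ⊥ (by intro p hp; simp [Subgroup.mem_bot.1 hp]) (by
    refine le_trans mk_le_aleph0 hκ) (mk_le_aleph0.trans hκ) 1 (Function.injective_of_subsingleton _)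
  have hψinj : Function.Injective ψ := by
    rw [injective_iff_map_eq_one]
    intro q hq
    have : Nonempty Ω := by
      rw [← mk_ne_zero_iff, hΩ]; exact (Order.bot_lt_succ κ).ne'
    exact hfree q this.some (by rw [hq]; rfl)
  let t : ℕ → Q := fun i => ULift.up (Multiplicative.ofAdd (Finsupp.single i 1))
  let ev : ℕ → (Q →* Multiplicative ℤ) := fun k =>
    (AddMonoidHom.toMultiplicative (Finsupp.applyAddHom k)).comp MulEquiv.ulift.toMonoidHom
  have hev : ∀ k i, ev k (t i) = Multiplicative.ofAdd (if i = k then 1 else 0) := by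
    intro k i
    change Multiplicative.ofAdd (Finsupp.single i (1 : ℤ) k) = _
    rw [Finsupp.single_apply]
  have hIm : ∀ σ : Equiv.Perm Ω, σ ∈ Im (⊥ : Subgroup (H × Equiv.Perm Ω)) ↔ σ = 1 := by
    intro σ
    constructor
    · rintro ⟨h, hx⟩
      exact congrArg Prod.snd (Subgroup.mem_bot.1 hx)
    · rintro rfl
      exact ⟨1, one_mem _⟩
  have h1 : ∀ k, ev k (t k) ≠ 1 := by
    intro k
    rw [hev, if_pos rfl]; decide
  refine ⟨fun i => ψ (t i), ψ.range, ?_⟩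
  exact
  { free := by
      rintro _ ⟨q, rfl⟩ ω h
      rw [hfree q ω h, map_one]
    card := mk_range_le.trans (mk_le_aleph0.trans hκ)
    sub := by
      intro h σ hx
      have : σ = 1 := congrArg Prod.snd (Subgroup.mem_bot.1 hx)
      rw [this]; exact one_mem _
    inj1 := by
      intro σ hx
      exact congrArg Prod.snd (Subgroup.mem_bot.1 hx)
    inj2 := by
      intro h hx
      exact congrArg Prod.fst (Subgroup.mem_bot.1 hx)
    mal := by
      intro p hp hpI h σ h' σ' hx _ _
      exact congrArg Prod.fst (Subgroup.mem_bot.1 hx)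
    sP := fun i _ => ⟨_, rfl⟩
    sIm := by
      intro i _ h
      rw [hIm, ← map_one ψ] at h
      apply h1 i
      rw [hψinj h, map_one]
    sdc := by
      intro i _ j _ hij σ hσ σ' hσ'
      rw [hIm] at hσ hσ'
      subst hσ; subst hσ'
      rw [one_mul, mul_one, one_mul, mul_one, ← map_inv]
      constructor
      · intro h
        have := congrArg (ev i) (hψinj h)
        apply h1 i
        rw [this, hev, if_neg hij.symm]; rfl
      · intro h
        have := congrArg (ev i) (hψinj h)
        apply h1 i
        rw [this, map_inv, hev, if_neg hij.symm]; rfl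
    gad := by
      intro h σ hx h1
      exact absurd (congrArg Prod.fst (Subgroup.mem_bot.1 hx)) h1
    sprod := by
      intro h
      rw [hIm] at h
      have h2 : ((List.range 18).map fun i => ψ (t i)).prod = ψ ((List.range 18).map t).prod := by
        rw [map_list_prod, List.map_map]; rfl
      rw [h2, ← map_one ψ] at h
      have := congrArg (ev 0) (hψinj h)
      rw [map_list_prod, List.map_map, map_one] at this
      have h3 : List.map (⇑(ev 0) ∘ t) (List.range 18) =
        List.map (fun i => Multiplicative.ofAdd (if i = 0 then (1:ℤ) else 0)) (List.range 18) := by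
        apply List.map_congr_left
        intro i _
        exact hev 0 i
      rw [h3] at this
      revert this; decide }

end ShelahFormalization

namespace ShelahFormalization
open Cardinal
universe u

abbrev St (H Ω : Type u) [Group H] := Subgroup (H × Equiv.Perm Ω) × Subgroup (Equiv.Perm Ω) × Set H

def St.ok {H Ω : Type u} [Group H] (κ : Cardinal.{u}) (s : ℕ → Equiv.Perm Ω) (σ : St H Ω) : Prop :=
  Inv κ s σ.1 σ.2.1 ∧ ∀ h τ, (h, τ) ∈ σ.1 → h ∈ Subgroup.closure σ.2.2

structure StepRel {H Ω : Type u} [Group H] (κ : Cardinal.{u}) (s : ℕ → Equiv.Perm Ω)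
    (h₀ : H) (A : Set H) (y : H) (σ σ' : St H Ω) : Prop where
  le : σ ≤ σ'
  fin : (σ'.2.2 \ σ.2.2).Finite
  ok : σ'.ok κ s
  ex : ∃ τ, (h₀, τ) ∈ σ'.1
  back : ∀ h τ, (h, τ) ∈ σ'.1 → τ ∈ σ.2.1 → (h, τ) ∈ σ.1
  cc : ∀ a α, (a, α) ∈ σ'.1 → (a, α) ∉ σ.1 → ∀ p ∈ σ.2.1, ∀ p' ∈ σ.2.1, p * α = α * p' →
    p ∈ Im σ.1 ∧ p' ∈ Im σ.1
  poly : ∃ x ∈ σ'.2.1, ∀ L : List (Equiv.Perm Ω), (∀ c ∈ L, c ∈ σ.2.1) → L ≠ [] → ∀ c₀ ∈ σ.2.1,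
        c₀ * (L.map fun c => x * c).prod ∉ σ.2.1
  task : Large κ A → ∀ z ∈ σ.2.1, z ∉ Im σ.1 → ∃ (a : ℕ → H) (α : ℕ → Equiv.Perm Ω) (η : Equiv.Perm Ω),
        (∀ i < 18, a i ∈ A ∧ (a i, α i) ∈ σ'.1) ∧ (y, η) ∈ σ'.1 ∧
        ((List.range 18).map fun i => z * α i).prod = η

theorem step' {H Ω : Type u} [Group H] {κ : Cardinal.{u}} (hκ : ℵ₀ ≤ κ) (hΩ : #Ω = Order.succ κ) (hH : #H ≤ κ)
    {s : ℕ → Equiv.Perm Ω} {σ : St H Ω} (hσ : σ.ok κ s) (hT : #σ.2.2 < κ)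
    (h₀ : H) (A : Set H) (y : H) : ∃ σ', StepRel κ s h₀ A y σ σ' := by
  obtain ⟨Γ', P', T', h1, h2, h3, h4, h5, h6, h7, h8, h9, h10⟩ := step hκ hΩ hH hσ.1 hT hσ.2 h₀ A y
  refine ⟨⟨Γ', P', σ.2.2 ∪ T'⟩, ⟨⟨h2, h3, Set.subset_union_left⟩, ?_, ⟨h4, h5⟩, h6, h7, h8, h9, h10⟩⟩
  apply h1.subset
  rintro x ⟨h | h, h'⟩
  · exact absurd h h'
  · exact h

theorem inner {H Ω : Type u} [Group H] {κ : Cardinal.{u}} (hκ : ℵ₀ ≤ κ) (hΩ : #Ω = Order.succ κ) (hH : #H ≤ κ)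
    (𝓐 : Set (Set H)) (h𝓐 : #𝓐 ≤ κ) :
    ∃ (G : Type u) (_ : Group G) (ι : H →* G), #G ≤ κ ∧ Function.Injective ι ∧
      (∀ q, q ∉ ι.range → ∀ h h', q⁻¹ * ι h * q = ι h' → h = 1) ∧
      (∀ z, z ∉ ι.range → ∀ A ∈ 𝓐, Large κ A → ∀ y, ∃ a : ℕ → H, (∀ i < 18, a i ∈ A) ∧
        ((List.range 18).map fun i => z * ι (a i)).prod = ι y) ∧
      (∃ s : ℕ → G, (∀ h, h ≠ 1 → ((List.range 18).map fun i => ι h * s i).prod = 1) ∧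
        ((List.range 18).map s).prod ∉ ι.range) ∧
      (∀ t : Set G, t.Finite → ∃ x : G, ∀ L : List G, (∀ c ∈ L, c ∈ t) → L ≠ [] → ∀ c₀ ∈ t,
        c₀ * (L.map fun c => x * c).prod ∉ t) ∧
      (∀ t : Set G, t.Finite → ∃ T : Set H, #T < κ ∧ ∀ a, Good (Subgroup.closure T) a →
        Good (Subgroup.closure t) (ι a)) := by
  classical
  let I := κ.ord.ToType
  have hI : #I = κ := mk_ord_toType κ
  have : NoMaxOrder I := noMaxOrder hκ
  have : Nonempty I := by
    rw [← mk_ne_zero_iff, hI]; rintro rfl; exact absurd hκ (not_le.2 aleph0_pos)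
  obtain ⟨s, P₀, hinit⟩ := inv_init hκ hΩ H
  let B := H × (insert ∅ 𝓐 : Set (Set H)) × H
  have : Nonempty B := ⟨(1, ⟨∅, by simp⟩, 1)⟩
  have hB : #B ≤ κ := by
    simp only [B, mk_prod, lift_id]
    have : #(insert ∅ 𝓐 : Set (Set H)) ≤ κ :=
      mk_insert_le.trans (add_le_of_le hκ h𝓐 (one_lt_aleph0.le.trans hκ))
    exact (mul_le_mul' hH (mul_le_mul' this hH)).trans_eq (by rw [mul_eq_self hκ, mul_eq_self hκ])
  obtain ⟨b, hb⟩ := bookkeeping hκ hB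
  let R : I → St H Ω → St H Ω → Prop := fun i => StepRel κ s (b i).1 (b i).2.1 (b i).2.2
  let F : I → St H Ω → St H Ω := fun i σ => if h : ∃ σ', R i σ σ' then h.choose else σ
  have hF : ∀ i σ, σ ≤ F i σ := by
    intro i σ
    simp only [F]; split_ifs with h
    · exact h.choose_spec.le
    · exact le_rfl
  have hFfin : ∀ i σ, ((F i σ).2.2 \ σ.2.2).Finite := by
    intro i σ
    simp only [F]; split_ifs with h
    · exact h.choose_spec.fin
    · simp
  obtain ⟨f, pre, hf, hpf, hfp, hmono, hbase, hpre1, hpre0⟩ := chain_exists (⟨⊥, P₀, ∅⟩ : St H Ω) F hF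
  -- monotone components
  have m1 : Monotone fun i => (f i).1 := fun i j h => (hmono h).1
  have m2 : Monotone fun i => (f i).2.1 := fun i j h => (hmono h).2.1
  have m3 : Monotone fun i => (f i).2.2 := fun i j h => (hmono h).2.2
  have p1 : ∀ i, (Set.Iio i).Nonempty → ∀ x, x ∈ (pre i).1 ↔ ∃ j, j < i ∧ x ∈ (f j).1 := by
    intro i hi x
    have := hi.to_subtype
    rw [hpre1 i hi, Prod.fst_iSup, mem_iSup_mono (K := fun j : Set.Iio i => (f j).1) (fun a b h => m1 h)]
    simp
  have p2 : ∀ i, (Set.Iio i).Nonempty → ∀ x, x ∈ (pre i).2.1 ↔ ∃ j, j < i ∧ x ∈ (f j).2.1 := by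
    intro i hi x
    have := hi.to_subtype
    rw [hpre1 i hi, Prod.snd_iSup, Prod.fst_iSup, mem_iSup_mono (K := fun j : Set.Iio i => (f j).2.1) (fun a b h => m2 h)]
    simp
  have p3 : ∀ i x, x ∈ (pre i).2.2 → ∃ j, j < i ∧ x ∈ (f j).2.2 := by
    intro i x hx
    by_cases hi : (Set.Iio i).Nonempty
    · rw [hpre1 i hi, Prod.snd_iSup, Prod.snd_iSup] at hx
      simpa using hx
    · rw [hpre0 i hi] at hx
      simp at hx
  have hTlt' : ∀ i, ∀ x ∈ (f i).2.2, ∃ j, j ≤ i ∧ x ∈ (f j).2.2 \ (pre j).2.2 := by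
    intro i
    induction i using WellFoundedLT.induction with
    | ind i ih =>
      intro x hx
      by_cases h : x ∈ (pre i).2.2
      · obtain ⟨j, hj, hxj⟩ := p3 i x h
        obtain ⟨k, hk, hxk⟩ := ih j hj x hxj
        exact ⟨k, hk.trans hj.le, hxk⟩
      · exact ⟨i, le_rfl, hx, h⟩
  have hTf : ∀ i, #(f i).2.2 < κ := by
    intro i
    refine (mk_le_mk_of_subset ?_).trans_lt (mk_iUnion_lt hκ (mk_Iic_lt hκ i)
      (fun j : Set.Iic i => (f j).2.2 \ (pre j).2.2) (fun j => by rw [hf]; exact hFfin _ _))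
    intro x hx
    obtain ⟨j, hj, hxj⟩ := hTlt' i x hx
    exact Set.mem_iUnion.2 ⟨⟨j, hj⟩, hxj⟩
  have hTp : ∀ i, #(pre i).2.2 < κ := fun i => (mk_le_mk_of_subset (hpf i).2.2).trans_lt (hTf i)
  have okbase : St.ok κ s (⟨⊥, P₀, ∅⟩ : St H Ω) := by
    refine ⟨hinit, ?_⟩
    intro h τ hx
    have : h = 1 := congrArg Prod.fst (Subgroup.mem_bot.1 hx)
    rw [this]; exact one_mem _
  have hpok : ∀ i, St.ok κ s (pre i) := by
    intro i
    induction i using WellFoundedLT.induction with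
    | ind i ih =>
      have hfj : ∀ j < i, St.ok κ s (f j) := by
        intro j hj
        have h := step' hκ hΩ hH (ih j hj) (hTp j) (b j).1 (b j).2.1 (b j).2.2
        rw [hf]
        change St.ok κ s (if h : ∃ σ', R j (pre j) σ' then h.choose else _)
        rw [dif_pos h]
        exact h.choose_spec.ok
      by_cases hi : (Set.Iio i).Nonempty
      · refine ⟨?_, ?_⟩
        · have := hi.to_subtype
          rw [hpre1 i hi, Prod.fst_iSup, Prod.snd_iSup, Prod.fst_iSup]
          exact Inv_iSup hκ ((mk_subtype_le _).trans_eq hI) (fun a b h => m1 h) (fun a b h => m2 h)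
            (fun j => (hfj j.1 j.2).1)
        · intro h τ hx
          obtain ⟨j, hj, hx⟩ := (p1 i hi _).1 hx
          exact Subgroup.closure_mono (hfp j i hj).2.2 ((hfj j hj).2 h τ hx)
      · rw [hpre0 i hi]; exact okbase
  have hR : ∀ i, R i (pre i) (f i) := by
    intro i
    have h := step' hκ hΩ hH (hpok i) (hTp i) (b i).1 (b i).2.1 (b i).2.2
    rw [hf]
    change R i (pre i) (if h : ∃ σ', R i (pre i) σ' then h.choose else _)
    rw [dif_pos h]
    exact h.choose_spec
  let Γ : Subgroup (H × Equiv.Perm Ω) := ⨆ i, (f i).1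
  let P : Subgroup (Equiv.Perm Ω) := ⨆ i, (f i).2.1
  have hInv : Inv κ s Γ P := Inv_iSup hκ hI.le m1 m2 fun i => (hR i).ok.1
  have mΓ : ∀ {x}, x ∈ Γ ↔ ∃ i, x ∈ (f i).1 := mem_iSup_mono m1
  have mP : ∀ {x}, x ∈ P ↔ ∃ i, x ∈ (f i).2.1 := mem_iSup_mono m2
  have htot : ∀ h, ∃ τ, (h, τ) ∈ Γ := by
    intro h
    obtain ⟨i, -, hi⟩ := hb (h, ⟨∅, by simp⟩, 1) (Classical.arbitrary I)
    obtain ⟨τ, hτ⟩ := (hR i).ex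
    rw [hi] at hτ
    exact ⟨τ, mΓ.2 ⟨i, hτ⟩⟩
  have hfun : ∀ h τ τ', (h, τ) ∈ Γ → (h, τ') ∈ Γ → τ = τ' := by
    intro h τ τ' h1 h2
    have h3 := mul_mem h1 (inv_mem h2)
    simp only [Prod.inv_mk, Prod.mk_mul_mk, mul_inv_cancel] at h3
    exact mul_inv_eq_one.1 (hInv.inj1 _ h3)
  have hfun' : ∀ h h' τ, (h, τ) ∈ Γ → (h', τ) ∈ Γ → h = h' := by
    intro h τ τ' h1 h2
    have h3 := mul_mem h1 (inv_mem h2)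
    simp only [Prod.inv_mk, Prod.mk_mul_mk, mul_inv_cancel] at h3
    exact mul_inv_eq_one.1 (hInv.inj2 _ h3)
  choose j hj using htot
  let ι : H →* P :=
    { toFun := fun h => ⟨j h, hInv.sub _ _ (hj h)⟩
      map_one' := Subtype.ext (hInv.inj1 _ (hj 1))
      map_mul' := fun x y => Subtype.ext (hfun _ _ _ (hj (x * y)) (mul_mem (hj x) (hj y))) }
  have hι : ∀ h, ((ι h : P) : Equiv.Perm Ω) = j h := fun h => rfl
  have hιIm : ∀ q : P, q ∈ ι.range ↔ (q : Equiv.Perm Ω) ∈ Im Γ := by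
    intro q
    constructor
    · rintro ⟨h, rfl⟩
      exact ⟨h, hj h⟩
    · rintro ⟨h, hx⟩
      exact ⟨h, Subtype.ext (hfun _ _ _ (hj h) hx)⟩
  have hback : ∀ i k, k ≤ i → ∀ h τ, (h, τ) ∈ (f i).1 → τ ∈ (f k).2.1 → (h, τ) ∈ (f k).1 := by
    intro i
    induction i using WellFoundedLT.induction with
    | ind i ih =>
      intro k hk h τ hx hτ
      rcases hk.eq_or_lt with rfl | hk
      · exact hx
      · have h1 := (hR i).back h τ hx ((hfp k i hk).2.1 hτ)
        obtain ⟨l, hl, hxl⟩ := (p1 i ⟨k, hk⟩ _).1 h1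
        rcases le_total l k with h2 | h2
        · exact m1 h2 hxl
        · exact ih l hl k h2 h τ hxl hτ
  have hbackΓ : ∀ k h τ, (h, τ) ∈ Γ → τ ∈ (f k).2.1 → (h, τ) ∈ (f k).1 := by
    intro k h τ hx hτ
    obtain ⟨i, hi⟩ := mΓ.1 hx
    exact hback (max i k) k (le_max_right _ _) h τ (m1 (le_max_left _ _) hi) hτ
  have hfin : ∀ t : Set P, t.Finite → ∃ k, ∀ x ∈ t, (x : Equiv.Perm Ω) ∈ (f k).2.1 := by
    intro t ht
    induction t, ht using Set.Finite.induction_on with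
    | empty => exact ⟨Classical.arbitrary I, by simp⟩
    | @insert a t _ _ ih =>
      obtain ⟨k, hk⟩ := ih
      obtain ⟨l, hl⟩ := mP.1 a.2
      refine ⟨max k l, ?_⟩
      rintro x (rfl | hx)
      · exact m2 (le_max_right _ _) hl
      · exact m2 (le_max_left _ _) (hk x hx)
  refine ⟨P, inferInstance, ι, hInv.card, ?_, ?_, ?_, ?_, ?_, ?_⟩
  · intro x y h
    have h1 : j x = j y := congrArg Subtype.val h
    have h2 := hj x
    rw [h1] at h2
    exact hfun' _ _ _ h2 (hj y)
  · intro q hq h h' he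
    rw [hιIm] at hq
    exact hInv.mal q q.2 hq h (j h) h' (j h') (hj h) (hj h') (congrArg Subtype.val he)
  · intro z hz A hA hL y
    rw [hιIm] at hz
    obtain ⟨k, hk⟩ := mP.1 z.2
    obtain ⟨i, hi, hbi⟩ := hb (1, ⟨A, by right; exact hA⟩, y) k
    have hT := (hR i).task
    rw [hbi] at hT
    obtain ⟨a, α, η, h1, h2, h3⟩ := hT hL z ((hfp k i hi).2.1 hk) (by
      rintro ⟨h, hx⟩
      exact hz ⟨h, mΓ.2 ⟨i, (hpf i).1 hx⟩⟩)
    refine ⟨a, fun n hn => (h1 n hn).1, ?_⟩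
    apply Subtype.ext
    have h4 : η = j y := hfun y _ _ (mΓ.2 ⟨i, h2⟩) (hj y)
    rw [hι, ← h4, ← h3]
    rw [Subgroup.val_list_prod, List.map_map]
    congr 1
    apply List.map_congr_left
    intro n hn
    have := hfun _ _ _ (mΓ.2 ⟨i, (h1 n (List.mem_range.1 hn)).2⟩) (hj (a n))
    rw [this]; rfl
  · let sP : ℕ → P := fun n => if h : n < 18 then ⟨s n, hInv.sP n h⟩ else 1
    have hsPv : ∀ n < 18, ((sP n : P) : Equiv.Perm Ω) = s n := fun n hn => by simp [sP, hn]
    refine ⟨sP, ?_, ?_⟩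
    · intro h h1
      have := hInv.gad h _ (hj h) h1
      apply Subtype.ext
      rw [Subgroup.val_list_prod, List.map_map, OneMemClass.coe_one, ← this]
      congr 1
    · rw [hιIm]
      have : ((((List.range 18).map sP).prod : P) : Equiv.Perm Ω) = ((List.range 18).map s).prod := by
        rw [Subgroup.val_list_prod, List.map_map]
        congr 1
      rw [this]; exact hInv.sprod
  · intro t ht
    obtain ⟨k, hk⟩ := hfin t ht
    obtain ⟨i, hi⟩ := exists_gt k
    obtain ⟨x, hx, hpoly⟩ := (hR i).poly
    refine ⟨⟨x, mP.2 ⟨i, hx⟩⟩, ?_⟩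
    intro L hL hne c₀ hc₀ hmem
    have hle := (hfp k i hi).2.1
    apply hpoly (L.map Subtype.val) ?_ (by rwa [Ne, List.map_eq_nil_iff]) c₀ (hle (hk _ hc₀))
    · have := hle (hk _ hmem)
      convert this
      rw [Subgroup.coe_mul]
      congr 1
      rw [Subgroup.val_list_prod, List.map_map, List.map_map]; rfl
    · intro c hc
      obtain ⟨d, hd, rfl⟩ := List.mem_map.1 hc
      exact hle (hk _ (hL d hd))
  · intro t ht
    obtain ⟨k, hk⟩ := hfin t ht
    refine ⟨(f k).2.2, hTf k, ?_⟩
    intro a ha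
    have hcl : ∀ x ∈ Subgroup.closure t, (x : Equiv.Perm Ω) ∈ (f k).2.1 := by
      intro x hx
      have : Subgroup.closure t ≤ (f k).2.1.comap P.subtype := (Subgroup.closure_le _).2 hk
      exact this hx
    have hdom := (hR k).ok.2
    have hna : (a, j a) ∉ (f k).1 := fun h => ha.1 (hdom _ _ h)
    refine ⟨fun h => hna (hbackΓ k _ _ (hj a) (hcl _ h)), ?_⟩
    intro p hp hp'
    have hp1 := hcl _ hp
    have hp2 := hcl _ hp'
    obtain ⟨i, hi, hmin⟩ := WellFounded.has_min (wellFounded_lt (α := I)) {i | (a, j a) ∈ (f i).1} (mΓ.1 (hj a))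
    have hki : k < i := by
      by_contra h
      exact hna (m1 (not_lt.1 h) hi)
    have hnp : (a, j a) ∉ (pre i).1 := by
      intro h
      obtain ⟨l, hl, hx⟩ := (p1 i ⟨k, hki⟩ _).1 h
      exact hmin l hx hl
    have hle := (hfp k i hki).2.1
    obtain ⟨⟨h, hx⟩, ⟨h', hx'⟩⟩ := (hR i).cc a (j a) hi hnp _ (hle hp1) _ (hle hp2) (by
      simp only [Subgroup.coe_mul, Subgroup.coe_inv, hι]; group)
    have hxΓ := mΓ.2 ⟨i, (hpf i).1 hx⟩
    have hxΓ' := mΓ.2 ⟨i, (hpf i).1 hx'⟩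
    have hd := hdom _ _ (hbackΓ k _ _ hxΓ hp1)
    have hd' := hdom _ _ (hbackΓ k _ _ hxΓ' hp2)
    have he : a⁻¹ * h * a = h' := by
      refine hfun' _ _ _ ?_ hxΓ'
      exact mul_mem (mul_mem (inv_mem (hj a)) hxΓ) (hj a)
    have h1 := ha.2 h hd (by rw [he]; exact hd')
    subst h1
    exact Subtype.ext (hInv.inj1 _ hxΓ)

end ShelahFormalization

namespace ShelahFormalization
open Cardinal
universe u

theorem good_map {H G : Type u} [Group H] [Group G] (ι : H →* G) (hι : Function.Injective ι)
    (S : Subgroup H) (a : H) : Good (S.map ι) (ι a) ↔ Good S a := by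
  unfold Good
  rw [Subgroup.mem_map_iff_mem hι]
  refine and_congr Iff.rfl ?_
  constructor
  · intro h s hs hs'
    have := h (ι s) (Subgroup.mem_map_of_mem _ hs) (by
      rw [← map_inv, ← map_mul, ← map_mul]; exact Subgroup.mem_map_of_mem _ hs')
    exact hι (by rw [this, map_one])
  · rintro h _ ⟨s, hs, rfl⟩ hs'
    rw [← map_inv, ← map_mul, ← map_mul, Subgroup.mem_map_iff_mem hι] at hs'
    rw [h s hs hs', map_one]

structure Ext {M : Type u} [Group M] (κ : Cardinal.{u}) (Y X : Subgroup M) (𝓐 : Set (Set M)) : Prop where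
  le : Y ≤ X
  card : #X ≤ κ
  mal : ∀ q ∈ X, q ∉ Y → ∀ h ∈ Y, q⁻¹ * h * q ∈ Y → h = 1
  task : ∀ z ∈ X, z ∉ Y → ∀ A ∈ 𝓐, A ⊆ Y →
    (∀ T : Set M, T ⊆ Y → #T < κ → ∃ a ∈ A, Good (Subgroup.closure T) a) →
    ∀ y ∈ Y, ∃ a : ℕ → M, (∀ i < 18, a i ∈ A) ∧ ((List.range 18).map fun i => z * a i).prod = y
  gad : ∃ s : ℕ → M, (∀ i < 18, s i ∈ X) ∧
    (∀ h ∈ Y, h ≠ 1 → ((List.range 18).map fun i => h * s i).prod = 1) ∧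
    ((List.range 18).map s).prod ∉ Y
  poly : ∀ t : Set M, t ⊆ X → t.Finite → ∃ x ∈ X, ∀ L : List M, (∀ c ∈ L, c ∈ t) → L ≠ [] → ∀ c₀ ∈ t,
        c₀ * (L.map fun c => x * c).prod ∉ t
  good : ∀ t : Set M, t ⊆ X → t.Finite → ∃ T : Set M, T ⊆ Y ∧ #T < κ ∧
    ∀ a ∈ Y, Good (Subgroup.closure T) a → Good (Subgroup.closure t) a

theorem step2 {Ω : Type u} {κ : Cardinal.{u}} (hκ : ℵ₀ ≤ κ) (hΩ : #Ω = Order.succ κ)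
    (Y : Subgroup (Equiv.Perm Ω)) (hY : ∀ p ∈ Y, ∀ ω, p ω = ω → p = 1) (hYc : #Y ≤ κ)
    (𝓐 : Set (Set (Equiv.Perm Ω))) (h𝓐 : #𝓐 ≤ κ) :
    ∃ X : Subgroup (Equiv.Perm Ω), (∀ p ∈ X, ∀ ω, p ω = ω → p = 1) ∧ Ext κ Y X 𝓐 := by
  obtain ⟨G, _, ι, hG, hι, g1, g2, ⟨s, g3, g3'⟩, g4, g5⟩ := inner (H := Y) hκ hΩ hYc
    ((fun A => (Subtype.val ⁻¹' A : Set Y)) '' 𝓐) (mk_image_le.trans h𝓐)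
  obtain ⟨ψ, hψ, hfree⟩ := emb hκ hΩ Y hY hYc hG ι hι
  have hinj : Function.Injective ψ := by
    rw [injective_iff_map_eq_one]
    intro q hq
    have hne : Nonempty Ω := by
      rw [← mk_ne_zero_iff, hΩ]; exact (Order.succ_ne_bot κ)
    exact hfree q (Classical.arbitrary Ω) (by rw [hq]; rfl)
  have hrange : ∀ q, ψ q ∈ Y ↔ q ∈ ι.range := by
    intro q
    constructor
    · intro h
      exact ⟨⟨ψ q, h⟩, hinj (hψ _)⟩
    · rintro ⟨y, rfl⟩
      rw [hψ]; exact y.2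
  refine ⟨ψ.range, ?_, ?_⟩
  · rintro _ ⟨q, rfl⟩ ω h
    rw [hfree q ω h, map_one]
  refine ⟨?_, ?_, ?_, ?_, ?_, ?_, ?_⟩
  · intro y hy
    exact ⟨ι ⟨y, hy⟩, hψ _⟩
  · exact mk_range_le.trans hG
  · rintro _ ⟨q, rfl⟩ hq h hh hh'
    have := g1 q (fun h => hq ((hrange q).2 h)) ⟨h, hh⟩ ⟨_, hh'⟩ (by
      apply hinj
      rw [map_mul, map_mul, hψ, hψ, map_inv])
    exact congrArg Subtype.val this
  · rintro _ ⟨z, rfl⟩ hz A hA hAY hL y hy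
    obtain ⟨a, ha, hp⟩ := g2 z (fun h => hz ((hrange z).2 h)) _ ⟨A, hA, rfl⟩ (by
      intro T hT
      obtain ⟨a, ha, hgood⟩ := hL (Subtype.val '' T) (by rintro _ ⟨x, -, rfl⟩; exact x.2)
        (mk_image_le.trans_lt hT)
      refine ⟨⟨a, hAY ha⟩, ha, ?_⟩
      rw [← good_map Y.subtype Subtype.val_injective, MonoidHom.map_closure]
      exact hgood) ⟨y, hy⟩
    refine ⟨fun i => a i, ha, ?_⟩
    have := congrArg ψ hp
    rw [map_list_prod, List.map_map, hψ] at this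
    refine Eq.trans ?_ this
    congr 1
    apply List.map_congr_left
    intro n _
    simp [hψ]
  · refine ⟨fun i => ψ (s i), fun i _ => ⟨_, rfl⟩, ?_, ?_⟩
    · intro h hh h1
      have := congrArg ψ (g3 ⟨h, hh⟩ (by simpa using h1))
      rw [map_list_prod, List.map_map, map_one] at this
      rw [← this]
      congr 1
      apply List.map_congr_left
      intro n _
      simp [hψ]
    · intro h
      apply g3'
      rw [← hrange, map_list_prod, List.map_map]
      exact h
  · intro t ht htf
    obtain ⟨x, hx⟩ := g4 (ψ ⁻¹' t) (htf.preimage hinj.injOn)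
    refine ⟨ψ x, ⟨x, rfl⟩, ?_⟩
    intro L hL hne c₀ hc₀ hmem
    obtain ⟨d₀, rfl⟩ := ht hc₀
    have hL' : ∃ L' : List G, L'.map ψ = L := by
      clear hne hmem
      induction L with
      | nil => exact ⟨[], rfl⟩
      | cons c L ih =>
        obtain ⟨L', rfl⟩ := ih (fun c hc => hL c (List.mem_cons_of_mem _ hc))
        obtain ⟨d, rfl⟩ := ht (hL c List.mem_cons_self)
        exact ⟨d :: L', rfl⟩
    obtain ⟨L, rfl⟩ := hL'
    apply hx L (fun c hc => hL _ (List.mem_map_of_mem hc)) (by simpa using hne) d₀ hc₀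
    change ψ _ ∈ t
    rw [map_mul, map_list_prod, List.map_map]
    rw [List.map_map] at hmem
    have hfe : (⇑ψ ∘ fun c => x * c) = ((fun c => ψ x * c) ∘ ⇑ψ) := by
      funext c; simp
    rw [hfe]; exact hmem
  · intro t ht htf
    obtain ⟨T, hT, hT'⟩ := g5 (ψ ⁻¹' t) (htf.preimage hinj.injOn)
    refine ⟨Subtype.val '' T, by rintro _ ⟨x, -, rfl⟩; exact x.2, mk_image_le.trans_lt hT, ?_⟩
    intro a ha hgood
    have h1 := hT' ⟨a, ha⟩ (by
      rw [← good_map Y.subtype Subtype.val_injective, MonoidHom.map_closure]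
      exact hgood)
    rw [← good_map ψ hinj, MonoidHom.map_closure, hψ, Set.image_preimage_eq_of_subset ht] at h1
    exact h1

theorem tower {κ : Cardinal.{u}} (hκ : ℵ₀ ≤ κ) (hsucc : Order.succ κ = 2 ^ κ) :
    ∃ (M : Type u) (_ : Group M) (X Y : (Order.succ κ).ord.ToType → Subgroup M)
      (e : (Order.succ κ).ord.ToType → (Order.succ κ).ord.ToType → Set M),
      (∀ i, Ext κ (Y i) (X i) {A | ∃ β < i, ∃ γ < i, A = e β γ}) ∧
      (∀ β (A : Set M), A ⊆ X β → ∃ γ, e β γ = A) ∧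
      (∀ j i, j < i → X j ≤ Y i) ∧
      (∀ i, ∀ x ∈ Y i, x = 1 ∨ ∃ j < i, x ∈ X j) := by
  classical
  let I := (Order.succ κ).ord.ToType
  have hI : #I = Order.succ κ := mk_ord_toType _
  let Ω := I
  have hIio : ∀ i : I, #(Set.Iio i) ≤ κ := fun i => Order.lt_succ_iff.1 (mk_Iio_toType_ord_lt i)
  let M := Equiv.Perm Ω
  have he : ∀ Z : Subgroup M, ∃ e : I → Set M, #Z ≤ κ → ∀ A : Set M, A ⊆ Z → ∃ γ, e γ = A := by
    intro Z
    by_cases hZ : #Z ≤ κ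
    · have h1 : #(Set.powerset (Z : Set M)) ≤ #I := by
        rw [mk_powerset, hI, hsucc]
        exact power_le_power_left two_ne_zero hZ
      obtain ⟨g⟩ := h1
      have : Nonempty (Set.powerset (Z : Set M)) := ⟨⟨∅, by simp⟩⟩
      refine ⟨fun i => (Function.invFun g i).1, fun _ A hA => ⟨g ⟨A, hA⟩, ?_⟩⟩
      exact congrArg Subtype.val (Function.leftInverse_invFun g.injective (⟨A, hA⟩ : Set.powerset (Z : Set M)))
    · exact ⟨fun _ => ∅, fun h => absurd h hZ⟩
  choose e he using he
  let 𝓐 : I → Set (Subgroup M) → Set (Set M) := fun i D => {A | ∃ Z ∈ D, ∃ γ < i, A = e Z γ}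
  have h𝓐 : ∀ i (D : Set (Subgroup M)), #D ≤ κ → #(𝓐 i D) ≤ κ := by
    intro i D hD
    have : 𝓐 i D = Set.range (fun x : D × Set.Iio i => e x.1 x.2) := by
      ext A
      constructor
      · rintro ⟨Z, hZ, γ, hγ, rfl⟩
        exact ⟨(⟨Z, hZ⟩, ⟨γ, hγ⟩), rfl⟩
      · rintro ⟨⟨⟨Z, hZ⟩, ⟨γ, hγ⟩⟩, rfl⟩
        exact ⟨Z, hZ, γ, hγ, rfl⟩
    rw [this]
    refine mk_range_le.trans ?_
    rw [mk_prod, lift_id, lift_id]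
    exact (mul_le_mul' hD (hIio i)).trans_eq (mul_eq_self hκ)
  let R : I → Subgroup M → Set (Subgroup M) → Subgroup M → Prop := fun i Y D X =>
    (∀ p ∈ X, ∀ ω, p ω = ω → p = 1) ∧ Ext κ Y X (𝓐 i D)
  let F : I → Subgroup M × Set (Subgroup M) → Subgroup M × Set (Subgroup M) := fun i σ =>
    if h : ∃ X, R i σ.1 σ.2 X then (h.choose, insert h.choose σ.2) else σ
  have hF : ∀ i σ, σ ≤ F i σ := by
    intro i σ
    simp only [F]; split_ifs with h
    · exact ⟨h.choose_spec.2.le, Set.subset_insert _ _⟩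
    · exact le_rfl
  obtain ⟨f, pre, hf, hpf, hfp, hmono, hbase, hpre1, hpre0⟩ := chain_exists (⟨⊥, ∅⟩ : Subgroup M × Set (Subgroup M)) F hF
  have m1 : Monotone fun i => (f i).1 := fun i j h => (hmono h).1
  have p1 : ∀ i, (Set.Iio i).Nonempty → ∀ x, x ∈ (pre i).1 ↔ ∃ j, j < i ∧ x ∈ (f j).1 := by
    intro i hi x
    have := hi.to_subtype
    rw [hpre1 i hi, Prod.fst_iSup, mem_iSup_mono (K := fun j : Set.Iio i => (f j).1) (fun a b h => m1 h)]
    simp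
  have p2 : ∀ i x, x ∈ (pre i).2 → ∃ j, j < i ∧ x ∈ (f j).2 := by
    intro i x hx
    by_cases hi : (Set.Iio i).Nonempty
    · rw [hpre1 i hi, Prod.snd_iSup] at hx
      simpa using hx
    · rw [hpre0 i hi] at hx
      simp at hx
  have hD1 : ∀ i, ∀ Z ∈ (f i).2, ∃ j ≤ i, Z = (f j).1 := by
    intro i
    induction i using WellFoundedLT.induction with
    | ind i ih =>
      intro Z hZ
      have hpreD : Z ∈ (pre i).2 → ∃ j ≤ i, Z = (f j).1 := by
        intro h
        obtain ⟨j, hj, h⟩ := p2 i Z h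
        obtain ⟨k, hk, h⟩ := ih j hj Z h
        exact ⟨k, hk.trans hj.le, h⟩
      by_cases h : ∃ X, R i (pre i).1 (pre i).2 X
      · have h1 : f i = (h.choose, insert h.choose (pre i).2) := by
          rw [hf]; exact dif_pos h
        rw [h1] at hZ
        rcases hZ with rfl | hZ
        · exact ⟨i, le_rfl, by rw [h1]⟩
        · exact hpreD hZ
      · have h1 : f i = pre i := by
          rw [hf]; exact dif_neg h
        rw [h1] at hZ
        exact hpreD hZ
  have hDc : ∀ i, #(pre i).2 ≤ κ := by
    intro i
    have : (pre i).2 ⊆ (fun j => (f j).1) '' Set.Iio i := by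
      intro Z hZ
      obtain ⟨j, hj, h⟩ := p2 i Z hZ
      obtain ⟨k, hk, h⟩ := hD1 j Z h
      exact ⟨k, hk.trans_lt hj, h.symm⟩
    exact (mk_le_mk_of_subset this).trans (mk_image_le.trans (hIio i))
  have hpok : ∀ i, (∀ p ∈ (pre i).1, ∀ ω, p ω = ω → p = 1) ∧ #(pre i).1 ≤ κ := by
    intro i
    induction i using WellFoundedLT.induction with
    | ind i ih =>
      have hfj : ∀ j < i, (∀ p ∈ (f j).1, ∀ ω, p ω = ω → p = 1) ∧ #(f j).1 ≤ κ := by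
        intro j hj
        have h : ∃ X, R j (pre j).1 (pre j).2 X :=
          step2 hκ hI (pre j).1 (ih j hj).1 (ih j hj).2 _ (h𝓐 j _ (hDc j))
        have h1 : f j = (h.choose, insert h.choose (pre j).2) := by
          rw [hf]; exact dif_pos h
        rw [h1]
        exact ⟨h.choose_spec.1, h.choose_spec.2.card⟩
      by_cases hi : (Set.Iio i).Nonempty
      · constructor
        · intro p hp
          obtain ⟨j, hj, hp⟩ := (p1 i hi p).1 hp
          exact (hfj j hj).1 p hp
        · have := hi.to_subtype
          rw [hpre1 i hi, Prod.fst_iSup]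
          exact card_iSup_le (K := fun j : Set.Iio i => (f j).1) (fun a b h => m1 h) hκ (hIio i) fun j => (hfj j.1 j.2).2
      · rw [hpre0 i hi]
        constructor
        · intro p hp ω _
          exact Subgroup.mem_bot.1 hp
        · exact mk_le_aleph0.trans hκ
  have hR : ∀ i, R i (pre i).1 (pre i).2 (f i).1 ∧ (f i).1 ∈ (f i).2 := by
    intro i
    have h : ∃ X, R i (pre i).1 (pre i).2 X :=
      step2 hκ hI (pre i).1 (hpok i).1 (hpok i).2 _ (h𝓐 i _ (hDc i))
    have h1 : f i = (h.choose, insert h.choose (pre i).2) := by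
      rw [hf]; exact dif_pos h
    rw [h1]
    exact ⟨h.choose_spec, Set.mem_insert _ _⟩
  refine ⟨M, inferInstance, fun i => (f i).1, fun i => (pre i).1, fun i => e (f i).1, ?_, ?_, ?_, ?_⟩
  · intro i
    have h := (hR i).1.2
    exact ⟨h.le, h.card, h.mal, fun z hz hzY A hA => h.task z hz hzY A (by
      obtain ⟨β, hβ, γ, hγ, rfl⟩ := hA
      exact ⟨(f β).1, (hfp β i hβ).2 (hR β).2, γ, hγ, rfl⟩), h.gad, h.poly, h.good⟩
  · intro β A hA
    exact he _ (hR β).1.2.card A hA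
  · exact fun j i h => (hfp j i h).1
  · intro i x hx
    by_cases hi : (Set.Iio i).Nonempty
    · exact Or.inr ((p1 i hi x).1 hx)
    · dsimp only at hx
      rw [hpre0 i hi] at hx
      exact Or.inl (Subgroup.mem_bot.1 hx)

end ShelahFormalization

namespace ShelahFormalization
open Cardinal
universe u

structure Tower {M I : Type u} [Group M] [LinearOrder I] (κ : Cardinal.{u}) (X Y : I → Subgroup M)
    (e : I → I → Set M) : Prop where
  ext : ∀ i, Ext κ (Y i) (X i) {A | ∃ β < i, ∃ γ < i, A = e β γ}
  enum : ∀ β (A : Set M), A ⊆ X β → ∃ γ, e β γ = A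
  XY : ∀ j i, j < i → X j ≤ Y i
  Yx : ∀ i, ∀ x ∈ Y i, x = 1 ∨ ∃ j < i, x ∈ X j
  hI : #I = Order.succ κ
  hIio : ∀ i : I, #(Set.Iio i) ≤ κ

section
variable {M I : Type u} [Group M] [LinearOrder I] [WellFoundedLT I] {κ : Cardinal.{u}} {X Y : I → Subgroup M}
    {e : I → I → Set M}

theorem Tower.bdd (T : Tower κ X Y e) (hκ : ℵ₀ ≤ κ) (S : Set I) (hS : #S ≤ κ) : ∃ δ, ∀ s ∈ S, s < δ := by
  by_contra! h
  have h1 : (Set.univ : Set I) ⊆ ⋃ s : S, Set.Iic (s : I) := by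
    intro i _
    obtain ⟨s, hs, his⟩ := h i
    exact Set.mem_iUnion.2 ⟨⟨s, hs⟩, his⟩
  have h2 : #I ≤ κ := by
    rw [← mk_univ]
    refine (mk_le_mk_of_subset h1).trans ((mk_iUnion_le _).trans ?_)
    refine (mul_le_mul' hS (ciSup_le' fun s => ?_)).trans_eq (mul_eq_self hκ)
    rw [← Set.Iio_insert]
    exact mk_insert_le.trans (add_le_of_le hκ (T.hIio s) (one_lt_aleph0.le.trans hκ))
  rw [T.hI] at h2
  exact absurd h2 (not_le.2 (Order.lt_succ κ))

theorem Tower.gt (T : Tower κ X Y e) (hκ : ℵ₀ ≤ κ) (i : I) : ∃ j, i < j := by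
  obtain ⟨j, hj⟩ := T.bdd hκ {i} (by simpa using one_lt_aleph0.le.trans hκ)
  exact ⟨j, hj i rfl⟩

theorem Tower.mono (T : Tower κ X Y e) : Monotone X := by
  intro i j h
  rcases h.eq_or_lt with rfl | h
  · exact le_rfl
  · exact (T.XY i j h).trans (T.ext j).le

def IsRk (X Y : I → Subgroup M) (x : M) (δ : I) : Prop := x ∈ X δ ∧ x ∉ Y δ

theorem Tower.exRk (T : Tower κ X Y e) {x : M} (h1 : x ≠ 1) : ∀ {i : I}, x ∈ X i → ∃ δ ≤ i, IsRk X Y x δ := by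
  intro i
  induction i using WellFoundedLT.induction with
  | ind i ih =>
    intro h
    by_cases hY : x ∈ Y i
    · rcases T.Yx i x hY with h2 | ⟨j, hj, hx⟩
      · exact absurd h2 h1
      · obtain ⟨δ, hδ, hr⟩ := ih j hj hx
        exact ⟨δ, hδ.trans hj.le, hr⟩
    · exact ⟨i, le_rfl, h, hY⟩

theorem Tower.uniq (T : Tower κ X Y e) {x : M} {δ δ' : I} (h : IsRk X Y x δ) (h' : IsRk X Y x δ') : δ = δ' := by
  rcases lt_trichotomy δ δ' with h1 | h1 | h1
  · exact absurd (T.XY _ _ h1 h.1) h'.2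
  · exact h1
  · exact absurd (T.XY _ _ h1 h'.1) h.2

theorem Tower.goodRk (T : Tower κ X Y e) {δ : I} {a : M} (ha : IsRk X Y a δ) {t : Set M} (ht : t ⊆ Y δ) :
    Good (Subgroup.closure t) a := by
  have h : Subgroup.closure t ≤ Y δ := (Subgroup.closure_le _).2 ht
  exact ⟨fun h' => ha.2 (h h'), fun s hs hs' => (T.ext δ).mal a ha.1 ha.2 s (h hs) (h hs')⟩

theorem Tower.comm (T : Tower κ X Y e) {σ γ : I} {s c : M} (hs : IsRk X Y s σ) (hc : IsRk X Y c γ)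
    (h : c⁻¹ * s * c = s) : σ = γ := by
  rcases lt_trichotomy σ γ with h1 | h1 | h1
  · have hY := T.XY _ _ h1 hs.1
    have := (T.ext γ).mal c hc.1 hc.2 s hY (by rw [h]; exact hY)
    exact absurd (this ▸ one_mem _) hs.2
  · exact h1
  · have hY := T.XY _ _ h1 hc.1
    have h' : s⁻¹ * c * s = c := by
      have : s * c = c * s := by
        calc s * c = c * (c⁻¹ * s * c) := by group
          _ = c * s := by rw [h]
      rw [mul_assoc, ← this]; group
    have := (T.ext σ).mal s hs.1 hs.2 c hY (by rw [h']; exact hY)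
    exact absurd (this ▸ one_mem _) hc.2

theorem Tower.large (T : Tower κ X Y e) (hκ : ℵ₀ ≤ κ) (a : κ.ord.ToType → M) (ρ : κ.ord.ToType → I)
    (hρ : StrictMono ρ) (ha : ∀ i, IsRk X Y (a i) (ρ i)) (δ : I) :
    ∀ t : Set M, t ⊆ Y δ → #t < κ → ∃ i, Good (Subgroup.closure t) (a i) := by
  have hno := noMaxOrder hκ
  have hne : Nonempty κ.ord.ToType := by
    rw [← mk_ne_zero_iff, mk_ord_toType]; rintro rfl; exact absurd hκ (not_le.2 aleph0_pos)
  have ainj : ∀ i j, i < j → a i ∈ Y (ρ j) := fun i j h => T.XY _ _ (hρ h) (ha i).1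
  rcases hκ.eq_or_lt with hκ' | hκ'
  · -- countable case
    subst hκ'
    induction δ using WellFoundedLT.induction with
    | ind δ ih =>
      intro t ht htc
      have htf : t.Finite := lt_aleph0_iff_set_finite.1 htc
      have hcase : t ⊆ {1} ∨ ∃ j < δ, t ⊆ X j := by
        clear htc
        induction t, htf using Set.Finite.induction_on with
        | empty => left; simp
        | @insert x t _ _ ih =>
          rcases T.Yx δ x (ht (Set.mem_insert _ _)) with rfl | ⟨j, hj, hx⟩
          · rcases ih (fun y hy => ht (Set.mem_insert_of_mem _ hy)) with h | ⟨j, hj, h⟩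
            · left; exact Set.insert_subset rfl h
            · right; exact ⟨j, hj, Set.insert_subset (one_mem _) h⟩
          · right
            rcases ih (fun y hy => ht (Set.mem_insert_of_mem _ hy)) with h | ⟨k, hk, h⟩
            · refine ⟨j, hj, Set.insert_subset hx (h.trans ?_)⟩
              rintro _ rfl; exact one_mem _
            · exact ⟨max j k, max_lt hj hk, Set.insert_subset (T.mono (le_max_left _ _) hx)
                (h.trans (T.mono (le_max_right _ _)))⟩
      rcases hcase with h | ⟨j, hj, h⟩
      · obtain ⟨i⟩ := hne
        exact ⟨i, T.goodRk (ha i) (h.trans (by rintro _ rfl; exact one_mem _))⟩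
      · by_cases hall : ∀ n, a n ∈ Y j
        · obtain ⟨t', ht', htc', hg⟩ := (T.ext j).good t h htf
          obtain ⟨i, hi⟩ := ih j hj t' ht' htc'
          exact ⟨i, hg _ (hall i) hi⟩
        · push Not at hall
          obtain ⟨m, hm⟩ := hall
          obtain ⟨n, hn⟩ := exists_gt m
          have h1 : j < ρ n := by
            refine lt_of_le_of_lt ?_ (hρ hn)
            by_contra h2
            exact hm (T.XY _ _ (not_le.1 h2) (ha m).1)
          exact ⟨n, T.goodRk (ha n) (h.trans (T.XY _ _ h1))⟩
  · intro t ht htc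
    by_contra! hbad
    have hSY : Subgroup.closure t ≤ Y δ := (Subgroup.closure_le _).2 ht
    have hSc : #(Subgroup.closure t) < κ := (card_closure_le _).trans_lt (max_lt htc hκ')
    have hinj : Function.Injective a := by
      intro i j hij
      by_contra hne
      rcases lt_or_gt_of_ne hne with h | h
      · exact (ha j).2 (hij ▸ ainj i j h)
      · exact (ha i).2 (hij ▸ ainj j i h)
    let S := Subgroup.closure t
    let B : S × S → Set κ.ord.ToType := fun p => {i | (p.1 : M) ≠ 1 ∧ (a i)⁻¹ * p.1 * a i = p.2}
    have hBf : ∀ p, (B p).Finite := by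
      rintro ⟨⟨s, hs⟩, ⟨s', hs'⟩⟩
      by_cases h : (B (⟨s, hs⟩, ⟨s', hs'⟩)).Nonempty
      swap
      · rw [Set.not_nonempty_iff_eq_empty.1 h]; exact Set.finite_empty
      obtain ⟨i, hi, hmin⟩ := WellFounded.has_min (wellFounded_lt (α := κ.ord.ToType)) _ h
      have hs1 : s ≠ 1 := hi.1
      obtain ⟨σ, -, hσ⟩ := T.exRk hs1 ((T.ext δ).le (hSY hs))
      have hsub : B (⟨s, hs⟩, ⟨s', hs'⟩) ⊆ {i} ∪ {j | ρ j = σ} := by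
        intro j hj
        by_cases hij : j = i
        · left; exact hij
        right
        have hlt : i < j := lt_of_le_of_ne (not_lt.1 (hmin j hj)) (Ne.symm hij)
        have h1 : (a i)⁻¹ * s * a i = s' := hi.2
        have h2 : (a j)⁻¹ * s * a j = s' := hj.2
        have hYi := ainj i j hlt
        have hc : IsRk X Y (a j * (a i)⁻¹) (ρ j) := by
          constructor
          · exact mul_mem (ha j).1 (inv_mem ((T.ext _).le hYi))
          · intro h3
            apply (ha j).2
            simpa using mul_mem h3 hYi
        refine (T.comm hσ hc ?_).symm
        calc (a j * (a i)⁻¹)⁻¹ * s * (a j * (a i)⁻¹) = a i * ((a j)⁻¹ * s * a j) * (a i)⁻¹ := by group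
          _ = s := by rw [h2, ← h1]; group
      refine Set.Finite.subset ?_ hsub
      refine (Set.finite_singleton i).union (Set.Subsingleton.finite ?_)
      intro j hj k hk
      exact hρ.injective (hj.trans hk.symm)
    have hU : #(⋃ p, B p) < κ := by
      refine mk_iUnion_lt hκ ?_ B hBf
      rw [mk_prod, lift_id]
      exact mul_lt_of_lt hκ hSc hSc
    have hV : #(a ⁻¹' (S : Set M)) < κ := (mk_preimage_of_injective _ _ hinj).trans_lt hSc
    have hcov : (Set.univ : Set κ.ord.ToType) ⊆ (⋃ p, B p) ∪ a ⁻¹' (S : Set M) := by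
      intro i _
      by_cases hi : a i ∈ S
      · right; exact hi
      left
      have := hbad i
      unfold Good at this
      push Not at this
      obtain ⟨s, hs, hs', h1⟩ := this hi
      exact Set.mem_iUnion.2 ⟨(⟨s, hs⟩, ⟨_, hs'⟩), h1, rfl⟩
    have h1 := mk_le_mk_of_subset hcov
    rw [mk_univ, mk_ord_toType] at h1
    exact absurd h1 (not_le.2 ((mk_union_le _ _).trans_lt (add_lt_of_lt hκ hU hV)))

theorem Tower.unb (T : Tower κ X Y e) (S : Set M) (hS : Order.succ κ ≤ #S) (hX : ∀ x ∈ S, ∃ i, x ∈ X i) (δ : I) :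
    ∃ x ∈ S, ∃ ρ, δ < ρ ∧ IsRk X Y x ρ := by
  by_contra! h
  have h1 : S ⊆ X δ := by
    intro x hx
    by_cases h1 : x = 1
    · rw [h1]; exact one_mem _
    obtain ⟨i, hi⟩ := hX x hx
    obtain ⟨ρ, -, hρ⟩ := T.exRk h1 hi
    by_cases h2 : δ < ρ
    · exact absurd hρ (h x hx ρ h2)
    · exact T.mono (not_lt.1 h2) hρ.1
  have h2 := (mk_le_mk_of_subset h1).trans (T.ext δ).card
  exact absurd (hS.trans h2) (not_le.2 (Order.lt_succ κ))

theorem Tower.shelah (T : Tower κ X Y e) (hκ : ℵ₀ ≤ κ) (A : Set M) (hA : Order.succ κ ≤ #A)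
    (hX : ∀ x ∈ A, ∃ i, x ∈ X i) (y : M) (hy : ∃ i, y ∈ X i) :
    ∃ z ∈ A, ∃ a : ℕ → M, (∀ i < 18, a i ∈ A) ∧ ((List.range 18).map fun i => z * a i).prod = y := by
  classical
  have hex : ∀ (i : κ.ord.ToType) (g : (j : κ.ord.ToType) → j < i → M × I),
      ∃ p : M × I, p.1 ∈ A ∧ IsRk X Y p.1 p.2 ∧ ∀ j hj, (g j hj).2 < p.2 := by
    intro i g
    obtain ⟨δ, hδ⟩ := T.bdd hκ (Set.range fun j : Set.Iio i => (g j.1 j.2).2)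
      (mk_range_le.trans (mk_Iio_toType_ord_lt i).le)
    obtain ⟨x, hx, ρ, hρ, hr⟩ := T.unb A hA hX δ
    exact ⟨(x, ρ), hx, hr, fun j hj => (hδ _ ⟨⟨j, hj⟩, rfl⟩).trans hρ⟩
  let g : κ.ord.ToType → M × I := WellFoundedLT.fix (fun i ih => (hex i ih).choose)
  have hg : ∀ i, (g i).1 ∈ A ∧ IsRk X Y (g i).1 (g i).2 ∧ ∀ j < i, (g j).2 < (g i).2 := by
    intro i
    have h1 : g i = (hex i (fun j _ => g j)).choose := WellFoundedLT.fix_eq _ i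
    rw [h1]
    exact (hex i (fun j _ => g j)).choose_spec
  obtain ⟨β, hβ⟩ := T.bdd hκ (Set.range fun i => (g i).2) (mk_range_le.trans (mk_ord_toType κ).le)
  have hsub : Set.range (fun i => (g i).1) ⊆ X β := by
    rintro _ ⟨i, rfl⟩
    exact T.mono (hβ _ ⟨i, rfl⟩).le (hg i).2.1.1
  obtain ⟨γ, hγ⟩ := T.enum β _ hsub
  obtain ⟨η, hη⟩ := hy
  obtain ⟨z, hz, δ, hδ, hr⟩ := T.unb A hA hX (max β (max γ η))
  have hβδ : β < δ := (le_max_left _ _).trans_lt hδ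
  have hγδ : γ < δ := ((le_max_left _ _).trans (le_max_right _ _)).trans_lt hδ
  have hηδ : η < δ := ((le_max_right _ _).trans (le_max_right _ _)).trans_lt hδ
  obtain ⟨a, ha, hp⟩ := (T.ext δ).task z hr.1 hr.2 _ ⟨β, hβδ, γ, hγδ, rfl⟩ (by
      rw [hγ]; exact hsub.trans (T.XY _ _ hβδ)) (by
      intro t ht htc
      obtain ⟨i, hi⟩ := T.large hκ (fun i => (g i).1) (fun i => (g i).2) (fun i j h => (hg j).2.2 i h)
        (fun i => (hg i).2.1) δ t ht htc
      exact ⟨_, by rw [hγ]; exact ⟨i, rfl⟩, hi⟩) y (T.XY _ _ hηδ hη)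
  refine ⟨z, hz, a, fun i hi => ?_, hp⟩
  have := ha i hi
  rw [hγ] at this
  obtain ⟨k, hk⟩ := this
  rw [← hk]; exact (hg k).1

end

theorem exists_tower {κ : Cardinal.{u}} (hκ : ℵ₀ ≤ κ) (hsucc : Order.succ κ = 2 ^ κ) :
    ∃ (M : Type u) (_ : Group M) (X Y : (Order.succ κ).ord.ToType → Subgroup M)
      (e : (Order.succ κ).ord.ToType → (Order.succ κ).ord.ToType → Set M), Tower κ X Y e := by
  obtain ⟨M, _, X, Y, e, h1, h2, h3, h4⟩ := tower hκ hsucc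
  exact ⟨M, inferInstance, X, Y, e, h1, h2, h3, h4, mk_ord_toType _,
    fun i => Order.lt_succ_iff.1 (mk_Iio_toType_ord_lt i)⟩

end ShelahFormalization

namespace ShelahFormalization
open Cardinal Topology
universe u v

theorem not_polybounded {X : Type u} [Group X]
    (h : ∀ t : Set X, t.Finite → ∃ x, ∀ L : List X, (∀ c ∈ L, c ∈ t) → L ≠ [] → ∀ c₀ ∈ t,
        c₀ * (L.map fun c => x * c).prod ∉ t) : ¬ Polybounded X := by
  rintro ⟨k, A, hA, hU⟩
  choose m c b hA using hA
  let φ : WithOne X →* X := WithOne.lift (MulHom.id X)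
  have hφ : ∀ x : X, φ (x : WithOne X) = x := fun x => WithOne.lift_coe _ _
  let t : Set X := Set.range b ∪ ⋃ i, Set.range (fun j => φ (c i j))
  have ht : t.Finite := (Set.finite_range b).union (Set.finite_iUnion fun i => Set.finite_range _)
  obtain ⟨x, hx⟩ := h t ht
  have hxU : x ∈ ⋃ i, A i := hU ▸ Set.mem_univ x
  obtain ⟨i, hi⟩ := Set.mem_iUnion.1 hxU
  rw [hA i] at hi
  have h1 := congrArg φ hi
  rw [hφ, map_mul, map_list_prod, List.map_ofFn] at h1
  have hc : ∀ j, φ (c i j) ∈ t := fun j => Or.inr (Set.mem_iUnion.2 ⟨i, j, rfl⟩)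
  refine hx (List.ofFn fun j : Fin (m i + 1) => φ (c i j.succ)) ?_ ?_ _ (hc 0) ?_
  · intro d hd
    obtain ⟨j, rfl⟩ := List.mem_ofFn.1 hd
    exact hc _
  · intro h2
    have := congrArg List.length h2
    simp at this
  · rw [List.map_ofFn]
    have : b i ∈ t := Or.inl ⟨i, rfl⟩
    rw [← h1] at this
    have hfe : ((fun c => x * c) ∘ fun j : Fin (m i + 1) => φ (c i j.succ)) =
        ⇑φ ∘ fun j : Fin (m i + 1) => (x : WithOne X) * c i j.succ := by
      funext j
      simp [hφ]
    rw [hfe]; exact this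

def pr {Y : Type*} [Mul Y] (u : Y) (t : ℕ → Y) : ℕ → Y
  | 0 => u * t 0
  | n + 1 => pr u t n * (u * t (n + 1))

theorem pr_cont {Y : Type*} [Mul Y] [TopologicalSpace Y] [ContinuousMul Y] (t : ℕ → Y) (n : ℕ) :
    Continuous fun u : Y => pr u t n := by
  induction n with
  | zero => exact continuous_id.mul continuous_const
  | succ n ih => exact ih.mul (continuous_id.mul continuous_const)

theorem map_pr {X Y : Type*} [Mul X] [Mul Y] (h : X →ₙ* Y) (u : X) (t : ℕ → X) (n : ℕ) :
    h (pr u t n) = pr (h u) (fun i => h (t i)) n := by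
  induction n with
  | zero => simp [pr]
  | succ n ih => simp [pr, ih]

theorem pr_eq {X : Type*} [Monoid X] (u : X) (t : ℕ → X) (n : ℕ) :
    pr u t n = ((List.range (n + 1)).map fun i => u * t i).prod := by
  induction n with
  | zero => simp [pr]
  | succ n ih => rw [List.range_succ, List.map_append, List.prod_append, ← ih]; simp [pr]

theorem pr_shift {X : Type*} [Monoid X] (u : X) (t : ℕ → X) (n : ℕ) :
    pr u t (n + 1) = u * (t 0 * pr u (fun i => t (i + 1)) n) := by
  induction n with
  | zero => simp [pr, mul_assoc]
  | succ n ih => rw [pr, ih, pr]; simp only [mul_assoc]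

def powS {Y : Type*} [Mul Y] (y : Y) : ℕ → Y
  | 0 => y
  | n + 1 => powS y n * y

theorem powS_nhds {X : Type u} {Y : Type v} [Group X] [Semigroup Y] [TopologicalSpace Y] [ContinuousMul Y]
    (h : X →ₙ* Y) (y : Y) (n : ℕ) : ∀ W ∈ 𝓝 (powS y n), ∃ V ∈ 𝓝 y, ∀ f : Fin (n + 1) → X,
      (∀ i, h (f i) ∈ V) → h (List.ofFn f).prod ∈ W := by
  induction n with
  | zero =>
    intro W hW
    refine ⟨W, hW, fun f hf => ?_⟩
    simpa using hf 0
  | succ n ih =>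
    intro W hW
    have hc : Filter.Tendsto (fun p : Y × Y => p.1 * p.2) (𝓝 (powS y n, y)) (𝓝 (powS y (n+1))) :=
      continuous_mul.continuousAt
    have h1 := hc hW
    rw [nhds_prod_eq] at h1
    obtain ⟨W1, hW1, V2, hV2, hs⟩ := Filter.mem_prod_iff.1 h1
    obtain ⟨V1, hV1, hV⟩ := ih W1 hW1
    refine ⟨V1 ∩ V2, Filter.inter_mem hV1 hV2, fun f hf => ?_⟩
    rw [List.ofFn_succ', List.concat_eq_append, List.prod_append, List.prod_singleton, map_mul]
    exact hs (Set.mk_mem_prod (hV _ fun i => (hf _).1) (hf _).2)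

theorem abs_closed {X : Type u} [Group X] {κ : Cardinal.{u}} (hκ : ℵ₀ ≤ κ) (hX : #X = Order.succ κ)
    (hsh : IsNShelah X 36)
    (hgad : ∀ S : Subgroup X, #S ≤ κ → ∃ s : ℕ → X,
      (∀ a ∈ S, a ≠ 1 → ((List.range 18).map fun i => a * s i).prod = 1) ∧
      ((List.range 18).map s).prod ∉ S) : AbsolutelyT1SClosed.{u, v} X := by
  intro Y _ _ _ _ h
  have hconst : ∀ y₀, (∀ x, h x = y₀) → IsClosed (Set.range h) := by
    intro y₀ h0
    have : Set.range h = {y₀} := by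
      ext z; constructor
      · rintro ⟨x, rfl⟩; exact h0 x
      · rintro rfl; exact ⟨1, h0 1⟩
    rw [this]; exact isClosed_singleton
  rw [← isOpen_compl_iff, isOpen_iff_mem_nhds]
  by_contra! hcon
  obtain ⟨y, hy, hcl⟩ := hcon
  have hncl : ¬ IsClosed (Set.range h) := fun hc => hcl (hc.isOpen_compl.mem_nhds hy)
  have hmeet : ∀ V ∈ 𝓝 y, ∃ x, h x ∈ V := by
    intro V hV
    by_contra! h1
    refine hcl (Filter.mem_of_superset hV ?_)
    rintro _ hz ⟨x, rfl⟩
    exact h1 x hz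
  have hne : ∀ x, y ≠ h x := fun x hx => hy ⟨x, hx.symm⟩
  by_cases hall : ∀ U ∈ 𝓝 y, #(h ⁻¹' U) = Order.succ κ
  · apply hncl
    refine hconst (powS y 35) fun x => ?_
    by_contra hx
    obtain ⟨V, hV, hVW⟩ := powS_nhds h y 35 {h x}ᶜ (isOpen_compl_singleton.mem_nhds (Ne.symm hx))
    obtain ⟨f, hf, hp⟩ := hsh (h ⁻¹' V) ((hall V hV).trans hX.symm) x
    have := hVW f hf
    rw [hp] at this
    exact this rfl
  · push Not at hall
    obtain ⟨U, hU, hUc⟩ := hall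
    have hUc' : #(h ⁻¹' U) ≤ κ := Order.lt_succ_iff.1 (lt_of_le_of_ne (hX ▸ mk_set_le _) hUc)
    let K : Set X := {x | h x = h 1}
    have hK : ¬ #K ≤ κ := by
      intro hK
      let S := Subgroup.closure (h ⁻¹' U ∪ K)
      have hS : #S ≤ κ := (card_closure_le _).trans
        (max_le ((mk_union_le _ _).trans (add_le_of_le hκ hUc' hK)) hκ)
      obtain ⟨s, hs1, hs2⟩ := hgad S hS
      set g := ((List.range 18).map s).prod with hg
      apply hs2
      apply Subgroup.subset_closure
      right
      change h g = h 1
      have hinv : ∀ b ∈ S, b ≠ 1 → s 0 * pr b (fun i => s (i + 1)) 16 = b⁻¹ := by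
        intro b hb hb1
        have := hs1 b hb hb1
        rw [← pr_eq b s 17, pr_shift] at this
        exact eq_inv_of_mul_eq_one_right this
      let Φ : X → X → X := fun a b => pr (a * (s 0 * pr b (fun i => s (i + 1)) 16)) s 17
      let Ψ : Y × Y → Y := fun p => pr (p.1 * (h (s 0) * pr p.2 (fun i => h (s (i + 1))) 16)) (fun i => h (s i)) 17
      have hΨc : Continuous Ψ := (pr_cont (fun i => h (s i)) 17).comp
        (continuous_fst.mul (continuous_const.mul ((pr_cont _ 16).comp continuous_snd)))
      have hΨ : ∀ a b, Ψ (h a, h b) = h (Φ a b) := by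
        intro a b
        simp only [Φ, Ψ, map_pr, map_mul]
      have hΦ1 : ∀ a ∈ S, ∀ b ∈ S, b ≠ 1 → a ≠ b → Φ a b = 1 := by
        intro a ha b hb hb1 hab
        simp only [Φ]
        rw [hinv b hb hb1, pr_eq]
        exact hs1 _ (mul_mem ha (inv_mem hb)) (fun h => hab (mul_inv_eq_one.1 h))
      have hΦ2 : ∀ a ∈ S, a ≠ 1 → Φ a a = g := by
        intro a ha ha1
        simp only [Φ]
        rw [hinv a ha ha1, pr_eq, mul_inv_cancel]
        simp [hg]
      have hSU : ∀ x, h x ∈ U → x ∈ S := fun x hx => Subgroup.subset_closure (Or.inl hx)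
      have key : ∀ w, Ψ (y, y) ≠ w → ∃ V ∈ 𝓝 y, ∀ p ∈ V, ∀ q ∈ V, Ψ (p, q) ≠ w := by
        intro w hw
        have h1 : Ψ ⁻¹' {w}ᶜ ∈ 𝓝 (y, y) := (isOpen_compl_singleton.preimage hΨc).mem_nhds hw
        rw [nhds_prod_eq] at h1
        obtain ⟨V1, hV1, V2, hV2, hs⟩ := Filter.mem_prod_iff.1 h1
        exact ⟨V1 ∩ V2, Filter.inter_mem hV1 hV2, fun p hp q hq => hs (Set.mk_mem_prod hp.1 hq.2)⟩
      have avoid : ∀ x, ({h x}ᶜ : Set Y) ∈ 𝓝 y := fun x => isOpen_compl_singleton.mem_nhds (hne x)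
      have e1 : Ψ (y, y) = h g := by
        by_contra hw
        obtain ⟨V, hV, hVw⟩ := key _ hw
        obtain ⟨x, ⟨hx1, hx2⟩, hx3⟩ := hmeet _ (Filter.inter_mem (Filter.inter_mem hV hU) (avoid 1))
        apply hVw _ hx1 _ hx1
        rw [hΨ, hΦ2 x (hSU x hx2) (by rintro rfl; exact hx3 rfl)]
      have e2 : Ψ (y, y) = h 1 := by
        by_contra hw
        obtain ⟨V, hV, hVw⟩ := key _ hw
        obtain ⟨a, ⟨ha1, ha2⟩, ha3⟩ := hmeet _ (Filter.inter_mem (Filter.inter_mem hV hU) (avoid 1))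
        obtain ⟨b, ⟨⟨hb1, hb2⟩, hb3⟩, hb4⟩ := hmeet _ (Filter.inter_mem (Filter.inter_mem (Filter.inter_mem hV hU) (avoid 1)) (avoid a))
        apply hVw _ ha1 _ hb1
        rw [hΨ, hΦ1 a (hSU a ha2) b (hSU b hb2) (by rintro rfl; exact hb3 rfl) (by rintro rfl; exact hb4 rfl)]
      rw [← e1, e2]
    apply hncl
    refine hconst (h 1) fun x => ?_
    have hKc : #K = #X := le_antisymm (mk_set_le _) (hX ▸ Order.succ_le_of_lt (not_le.1 hK))
    obtain ⟨f, hf, rfl⟩ := hsh K hKc x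
    have : ∀ L : List X, (∀ c ∈ L, h c = h 1) → h L.prod = h 1 := by
      intro L
      induction L with
      | nil => intro _; rfl
      | cons c L ih =>
        intro hL
        rw [List.prod_cons, map_mul, ih (fun c hc => hL c (List.mem_cons_of_mem _ hc)), hL c List.mem_cons_self,
          ← map_mul, mul_one]
    apply this
    intro c hc
    obtain ⟨j, rfl⟩ := List.mem_ofFn.1 hc
    exact hf j

theorem ofFn_pairs {X : Type u} [Monoid X] (z : X) (a : ℕ → X) (n : ℕ) :
    (List.ofFn fun i : Fin (2 * n) => if (i : ℕ) % 2 = 0 then z else a (i / 2)).prod =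
      ((List.range n).map fun i => z * a i).prod := by
  have h1 : (List.ofFn fun i : Fin (2 * n) => if (i : ℕ) % 2 = 0 then z else a (i / 2)) =
      (List.range (2 * n)).map (fun i : ℕ => if i % 2 = 0 then z else a (i / 2)) := by
    apply List.ext_getElem <;> simp
  rw [h1]
  clear h1
  induction n with
  | zero => simp
  | succ n ih =>
    rw [show 2 * (n + 1) = 2 * n + 1 + 1 by ring, List.range_succ, List.range_succ, List.range_succ,
      List.map_append, List.map_append, List.map_append, List.prod_append, List.prod_append, List.prod_append, ih]
    have : (2 * n + 1) / 2 = n := by omega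
    simp [mul_assoc, this]

end ShelahFormalization

namespace ShelahFormalization
universe u v

/-- Theorem 1.1 (main theorem): for every infinite cardinal `κ` with `κ⁺ = 2^κ` there
exists a non-polybounded absolutely `T₁S`-closed `36`-Shelah group `X` of cardinality
`|X| = κ⁺`. -/
theorem exists_shelah_group (κ : Cardinal.{u}) (hκ : Cardinal.aleph0 ≤ κ)
    (hsucc : Order.succ κ = 2 ^ κ) :
    ∃ (X : Type u) (_ : Group X),
      Cardinal.mk X = Order.succ κ ∧
      IsNShelah X 36 ∧
      AbsolutelyT1SClosed.{u, v} X ∧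
      ¬ Polybounded X := by
  classical
  obtain ⟨M, _, X, Y, e, T⟩ := exists_tower hκ hsucc
  have hne : Nonempty (Order.succ κ).ord.ToType := by
    rw [← Cardinal.mk_ne_zero_iff, Cardinal.mk_ord_toType]; exact Order.succ_ne_bot κ
  let Z : Subgroup M := ⨆ i, X i
  have mZ : ∀ {x}, x ∈ Z ↔ ∃ i, x ∈ X i := mem_iSup_mono T.mono
  have hκ' : Cardinal.aleph0 ≤ Order.succ κ := hκ.trans (Order.le_succ κ)
  have hcard : Cardinal.mk Z = Order.succ κ := by
    apply le_antisymm
    · exact card_iSup_le T.mono hκ' T.hI.le fun i => (T.ext i).card.trans (Order.le_succ κ)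
    · have : ∀ i, ∃ x : Z, IsRk X Y x i := by
        intro i
        obtain ⟨s, hs, -, h⟩ := (T.ext i).gad
        have hm : ((List.range 18).map s).prod ∈ X i := by
          apply Subgroup.list_prod_mem
          intro c hc
          obtain ⟨j, hj, rfl⟩ := List.mem_map.1 hc
          exact hs j (List.mem_range.1 hj)
        exact ⟨⟨_, mZ.2 ⟨i, hm⟩⟩, hm, h⟩
      choose g hg using this
      rw [← T.hI]
      refine Cardinal.mk_le_of_injective (f := g) ?_
      intro i j hij
      exact T.uniq (hg i) (hij ▸ hg j)
  have hsub : ∀ S : Set Z, Cardinal.mk S ≤ κ → ∃ δ, ∀ x ∈ S, (x : M) ∈ Y δ := by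
    intro S hS
    choose r hr using fun x : Z => mZ.1 x.2
    obtain ⟨δ, hδ⟩ := T.bdd hκ (r '' S) (Cardinal.mk_image_le.trans hS)
    exact ⟨δ, fun x hx => T.XY _ _ (hδ _ ⟨x, hx, rfl⟩) (hr x)⟩
  have hsh : IsNShelah Z 36 := by
    intro A hA y
    obtain ⟨z, hz, a, ha, hp⟩ := T.shelah hκ (Subtype.val '' A) (by
        rw [Cardinal.mk_image_eq Subtype.val_injective, hA, hcard]) (by
        rintro _ ⟨x, -, rfl⟩; exact mZ.1 x.2) y (mZ.1 y.2)
    obtain ⟨z, hzA, rfl⟩ := hz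
    have : ∀ i, ∃ b : Z, i < 18 → b ∈ A ∧ (b : M) = a i := by
      intro i
      by_cases hi : i < 18
      · obtain ⟨b, hb, hba⟩ := ha i hi
        exact ⟨b, fun _ => ⟨hb, hba⟩⟩
      · exact ⟨1, fun h => absurd h hi⟩
    choose b hb using this
    refine ⟨fun i : Fin (2 * 18) => if (i : ℕ) % 2 = 0 then z else b (i / 2), ?_, ?_⟩
    · intro i
      dsimp only
      split_ifs
      · exact hzA
      · exact (hb _ (by omega)).1
    · refine (ofFn_pairs z b 18).trans ?_
      apply Subtype.ext
      rw [← hp, Subgroup.val_list_prod, List.map_map]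
      refine congrArg List.prod (List.map_congr_left ?_)
      intro n hn
      simp [(hb n (List.mem_range.1 hn)).2]
  refine ⟨Z, inferInstance, hcard, hsh, ?_, ?_⟩
  · refine abs_closed hκ hcard hsh ?_
    intro S hS
    obtain ⟨δ, hδ⟩ := hsub S hS
    obtain ⟨s, hs, h1, h2⟩ := (T.ext δ).gad
    have : ∀ i, ∃ b : Z, i < 18 → (b : M) = s i := by
      intro i
      by_cases hi : i < 18
      · exact ⟨⟨s i, mZ.2 ⟨δ, hs i hi⟩⟩, fun _ => rfl⟩
      · exact ⟨1, fun h => absurd h hi⟩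
    choose b hb using this
    refine ⟨b, ?_, ?_⟩
    · intro a ha ha1
      apply Subtype.ext
      rw [Subgroup.val_list_prod, List.map_map]
      refine Eq.trans ?_ (h1 a (hδ a ha) (by simpa using ha1))
      refine congrArg List.prod (List.map_congr_left ?_)
      intro n hn
      simp [hb n (List.mem_range.1 hn)]
    · intro h3
      apply h2
      have h4 := hδ _ h3
      rw [Subgroup.val_list_prod, List.map_map] at h4
      convert h4 using 2
      apply List.map_congr_left
      intro n hn
      simp [hb n (List.mem_range.1 hn)]
  · apply not_polybounded
    intro t ht
    obtain ⟨δ, hδ⟩ := hsub t (ht.lt_aleph0.le.trans hκ)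
    obtain ⟨x, hx, hp⟩ := (T.ext δ).poly (Subtype.val '' t) (by
      rintro _ ⟨y, hy, rfl⟩; exact (T.ext δ).le (hδ y hy)) (ht.image _)
    refine ⟨⟨x, mZ.2 ⟨δ, hx⟩⟩, ?_⟩
    intro L hL hne c₀ hc₀ hmem
    refine hp (L.map Subtype.val) ?_ (by rwa [Ne, List.map_eq_nil_iff]) c₀ ⟨c₀, hc₀, rfl⟩ ⟨_, hmem, ?_⟩
    · intro c hc
      obtain ⟨d, hd, rfl⟩ := List.mem_map.1 hc
      exact ⟨d, hL d hd, rfl⟩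
    · rw [Subgroup.coe_mul, Subgroup.val_list_prod, List.map_map, List.map_map]
      rfl

end ShelahFormalization
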